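/- Let H : 𝕋^d × ℝ^d → ℝ be a C² Tonelli Hamiltonian, (u_λ)_{λ∈(0,1]} the solutions of the associated discounted problem, and u : 𝕋^d → ℝ their uniform limit as λ → 0⁺. If u is C¹ and upper Green regular, then u is a weak K.A.M. solution and lim_{λ→0⁺} d_{2,1}(u_λ, u) = 0. -/

import Mathlib

/-!
Throughout, the closed manifold `M = 𝕋^d = ℝ^d/ℤ^d` is modelled by `ℤ^d`-periodic
functions on `ℝ^d` (with the Euclidean structure), and its (co)tangent bundle
`T^*𝕋^d = 𝕋^d × ℝ^d` by `ℤ^d`-periodic (in the base variable) data on `ℝ^d × ℝ^d`.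
-/

open scoped RealInnerProductSpace
open Filter MeasureTheory Metric Set Asymptotics

noncomputable section

/-- The universal cover `ℝ^d` of the torus `𝕋^d`. -/
abbrev Euc (d : ℕ) : Type := EuclideanSpace ℝ (Fin d)

/-- The phase space `T^*𝕋^d`, modelled as `ℝ^d × ℝ^d` with `ℤ^d`-periodic data. -/
abbrev Phase (d : ℕ) : Type := Euc d × Euc d

/-- An integer vector, viewed in `ℝ^d`. -/
def intVec {d : ℕ} (k : Fin d → ℤ) : Euc d := WithLp.toLp 2 fun i => (k i : ℝ)

/-- `f` descends to the torus `𝕋^d = ℝ^d/ℤ^d`. -/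
def PerFun {d : ℕ} {α : Type*} (f : Euc d → α) : Prop :=
  ∀ (k : Fin d → ℤ) (x : Euc d), f (x + intVec k) = f x

/-- `H` descends to `T^*𝕋^d = 𝕋^d × ℝ^d`. -/
def PerPhase {d : ℕ} {α : Type*} (H : Phase d → α) : Prop :=
  ∀ (k : Fin d → ℤ) (q p : Euc d), H (q + intVec k, p) = H (q, p)

/-- Positive definiteness of the fiberwise Hessian. -/
def ConvexInFiber {d : ℕ} (H : Phase d → ℝ) : Prop :=
  ∀ q p v, v ≠ 0 → 0 < iteratedFDeriv ℝ 2 (fun p' => H (q, p')) p ![v, v]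

/-- A `C²` Tonelli Hamiltonian on `T^*𝕋^d`. -/
structure TonelliHam {d : ℕ} (H : Phase d → ℝ) : Prop where
  periodic : PerPhase H
  smooth : ContDiff ℝ 2 H
  convex : ConvexInFiber H
  superlinear : ∀ A : ℝ, ∃ B : ℝ, ∀ q p, A * ‖p‖ + B ≤ H (q, p)

/-- A `C²` Tonelli Lagrangian on `T𝕋^d`. -/
structure TonelliLag {d : ℕ} (L : Phase d → ℝ) : Prop where
  periodic : PerPhase L
  smooth : ContDiff ℝ 2 L
  convex : ConvexInFiber L
  superlinear : ∀ A : ℝ, ∃ B : ℝ, ∀ q v, A * ‖v‖ + B ≤ L (q, v)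

/-- The Lagrangian associated to `H` by Legendre duality. -/
def LegendreL {d : ℕ} (H : Phase d → ℝ) (x : Phase d) : ℝ :=
  sSup {r | ∃ p : Euc d, r = ⟪p, x.2⟫ - H (x.1, p)}

/-- The Mañé critical value `α(H)`. -/
def maneCritical {d : ℕ} (H : Phase d → ℝ) : ℝ :=
  sInf {c | ∃ u : Euc d → ℝ, ContDiff ℝ (⊤ : ℕ∞) u ∧ PerFun u ∧ ∀ q, H (q, gradient u q) ≤ c}

/-- The Mañé critical value `α(c)` of the cohomology class of the constant form `cf`. -/
def maneCriticalOf {d : ℕ} (H : Phase d → ℝ) (cf : Euc d) : ℝ :=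
  maneCritical fun x : Phase d => H (x.1, cf + x.2)

/-- `γ` is absolutely continuous on `[a,b]` with a.e. derivative `γ'`. -/
def ACOn {d : ℕ} (γ γ' : ℝ → Euc d) (a b : ℝ) : Prop :=
  IntervalIntegrable γ' volume a b ∧ ∀ t ∈ Icc a b, γ t = γ a + ∫ s in a..t, γ' s

/-- Values entering the (discounted, cohomologically twisted) Lax–Oleinik infimum. -/
def LOvals {d : ℕ} (L : Phase d → ℝ) (cf : Euc d) (av lam : ℝ) (u : Euc d → ℝ) (t : ℝ)
    (q : Euc d) : Set ℝ :=
  {r | ∃ γ γ' : ℝ → Euc d, ACOn γ γ' (-t) 0 ∧ γ 0 = q ∧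
     IntervalIntegrable (fun s => Real.exp (lam * s) * (L (γ s, γ' s) - ⟪cf, γ' s⟫ + av))
       volume (-t) 0 ∧
     r = Real.exp (-(lam * t)) * u (γ (-t)) +
         ∫ s in (-t)..0, Real.exp (lam * s) * (L (γ s, γ' s) - ⟪cf, γ' s⟫ + av)}

/-- The (discounted, twisted) Lax–Oleinik semigroup `T^{cf,λ}_t u (q)`. -/
def LaxOleinik {d : ℕ} (L : Phase d → ℝ) (cf : Euc d) (av lam : ℝ) (u : Euc d → ℝ) (t : ℝ)
    (q : Euc d) : ℝ :=
  sInf (LOvals L cf av lam u t q)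

/-- A weak K.A.M. solution: a fixed point of the Lax–Oleinik semigroup. -/
def IsWeakKAM {d : ℕ} (H : Phase d → ℝ) (u : Euc d → ℝ) : Prop :=
  Continuous u ∧ PerFun u ∧
    ∀ t > (0:ℝ), ∀ q, LaxOleinik (LegendreL H) 0 (maneCritical H) 0 u t q = u q

/-- A fixed point of the modified Lax–Oleinik semigroup `T^c_t` for the class `cf`. -/
def IsFixedPtModified {d : ℕ} (H : Phase d → ℝ) (cf : Euc d) (u : Euc d → ℝ) : Prop :=
  Continuous u ∧ PerFun u ∧
    ∀ t > (0:ℝ), ∀ q, LaxOleinik (LegendreL H) cf (maneCriticalOf H cf) 0 u t q = u q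

/-- The discounted solution `u_λ` of `λu + H(x,du) = α(H)`, via its variational formula. -/
def IsDiscountedSol {d : ℕ} (H : Phase d → ℝ) (lam : ℝ) (u : Euc d → ℝ) : Prop :=
  Continuous u ∧ PerFun u ∧
    ∀ q, u q = sInf {r | ∃ γ γ' : ℝ → Euc d, (∀ a ≤ (0:ℝ), ACOn γ γ' a 0) ∧ γ 0 = q ∧
      IntegrableOn (fun s => Real.exp (lam * s) * (LegendreL H (γ s, γ' s) + maneCritical H))
        (Iic 0) volume ∧
      r = ∫ s in Iic (0:ℝ), Real.exp (lam * s) * (LegendreL H (γ s, γ' s) + maneCritical H)}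

/-- The `λ`-discounted Hamiltonian vector field `(∂H/∂p, -∂H/∂q - λp)`. -/
def hamVF {d : ℕ} (H : Phase d → ℝ) (lam : ℝ) (x : Phase d) : Phase d :=
  (gradient (fun p => H (x.1, p)) x.2, -gradient (fun q => H (q, x.2)) x.1 - lam • x.2)

/-- `φ` is the (conformally) Hamiltonian flow of equation (1) for `(H, λ)`. -/
def IsConformalFlow {d : ℕ} (H : Phase d → ℝ) (lam : ℝ) (φ : ℝ → Phase d → Phase d) : Prop :=
  (∀ x, φ 0 x = x) ∧ (∀ s t x, φ s (φ t x) = φ (s + t) x) ∧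
    ∀ x t, HasDerivAt (fun τ => φ τ x) (hamVF H lam (φ t x)) t

/-- The vertical subspace `V = ker Dπ`. -/
def Vert (d : ℕ) : Submodule ℝ (Phase d) :=
  Submodule.prod (⊥ : Submodule ℝ (Euc d)) (⊤ : Submodule ℝ (Euc d))

/-- The image `Dφ_t(y) V(y)` of the vertical at `y` by the linearized flow. -/
def pushV {d : ℕ} (φ : ℝ → Phase d → Phase d) (t : ℝ) (y : Phase d) : Submodule ℝ (Phase d) :=
  Submodule.map (fderiv ℝ (φ t) y).toLinearMap (Vert d)

/-- `G_t(x) = Dφ_t V(φ_{-t} x)`. -/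
def GreenT {d : ℕ} (φ : ℝ → Phase d → Phase d) (t : ℝ) (x : Phase d) : Submodule ℝ (Phase d) :=
  pushV φ t (φ (-t) x)

/-- The piece of orbit `(φ_t x)_{t ∈ I}` has no conjugate points. -/
def NoConjPts {d : ℕ} (φ : ℝ → Phase d → Phase d) (x : Phase d) (I : Set ℝ) : Prop :=
  ∀ s ∈ I, ∀ t ∈ I, s ≠ t → pushV φ (t - s) (φ s x) ⊓ Vert d = ⊥

/-- `S` is the height `ℋ(G)` of the Lagrangian subspace `G`:
`G` is the graph `{(δθ, S δθ)}` of the symmetric map `S`. -/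
def IsHeight {d : ℕ} (G : Submodule ℝ (Phase d)) (S : Euc d →L[ℝ] Euc d) : Prop :=
  (∀ v w, ⟪S v, w⟫ = ⟪v, S w⟫) ∧ G = LinearMap.graph (S : Euc d →ₗ[ℝ] Euc d)

open Classical in
/-- The height of a subspace transverse to the vertical (junk value `0` otherwise). -/
def heightOf {d : ℕ} (G : Submodule ℝ (Phase d)) : Euc d →L[ℝ] Euc d :=
  if h : ∃ S, IsHeight G S then h.choose else 0

/-- Order of symmetric operators as quadratic forms. -/
def SymLE {d : ℕ} (S T : Euc d →L[ℝ] Euc d) : Prop := ∀ v, ⟪S v, v⟫ ≤ ⟪T v, v⟫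

/-- Strict order of symmetric operators as quadratic forms (positive definite difference). -/
def SymLT {d : ℕ} (S T : Euc d →L[ℝ] Euc d) : Prop := ∀ v, v ≠ 0 → ⟪S v, v⟫ < ⟪T v, v⟫

/-- `u` has (Alexandrov) derivative `p` and second derivative `S` at `θ`. -/
def HasAlexandrovAt {d : ℕ} (u : Euc d → ℝ) (p : Euc d) (S : Euc d →L[ℝ] Euc d)
    (θ : Euc d) : Prop :=
  HasGradientAt u p θ ∧
    (fun y => u y - u θ - ⟪p, y - θ⟫ - (1/2) * ⟪S (y - θ), y - θ⟫)
      =o[nhds θ] fun y => ‖y - θ‖ ^ 2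

open Classical in
/-- The Alexandrov second derivative `D²u(θ)` (junk value `0` where it does not exist). -/
def D2 {d : ℕ} (u : Euc d → ℝ) (θ : Euc d) : Euc d →L[ℝ] Euc d :=
  if h : ∃ pS : Euc d × (Euc d →L[ℝ] Euc d), HasAlexandrovAt u pS.1 pS.2 θ then h.choose.2 else 0

/-- `‖S‖ = sup_{‖v‖=1} |S(v,v)|`. -/
def qNorm {d : ℕ} (S : Euc d →L[ℝ] Euc d) : ℝ :=
  ⨆ v : (sphere (0 : Euc d) 1 : Set (Euc d)), |⟪S v.1, v.1⟫|

/-- A fundamental domain of `𝕋^d` in `ℝ^d`. -/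
def fundCube (d : ℕ) : Set (Euc d) := {x | ∀ i, x i ∈ Ico (0:ℝ) 1}

/-- The distance `d_{2,1}(u,v) = ∫_{𝕋^d} ‖D²u - D²v‖`. -/
def d21 {d : ℕ} (u v : Euc d → ℝ) : ℝ := ∫ θ in fundCube d, qNorm (D2 u θ - D2 v θ)

/-- Semi-concavity. -/
def SemiConcave {d : ℕ} (u : Euc d → ℝ) : Prop :=
  ∃ K : ℝ, ∀ x, ∃ p, ∀ y, u y ≤ u x + ⟪p, y - x⟫ + K * ‖y - x‖ ^ 2

/-- `u` is upper Green regular: at Lebesgue-a.e. `θ`, `ℋ(G₊(θ, du(θ))) = D²u(θ)`. -/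
def UpperGreenRegular {d : ℕ} (φ : ℝ → Phase d → Phase d) (u : Euc d → ℝ) : Prop :=
  ∀ᵐ θ ∂(volume : Measure (Euc d)), ∃ p S, HasGradientAt u p θ ∧
    (∀ t > (0:ℝ), ∃ S', IsHeight (GreenT φ t (θ, p)) S') ∧
    Tendsto (fun t : ℝ => heightOf (GreenT φ t (θ, p))) atTop (nhds S) ∧
    HasAlexandrovAt u p S θ

/-- The graph `𝒢(du) ⊂ T^*𝕋^d` of the differential of `u`. -/
def gradGraph {d : ℕ} (u : Euc d → ℝ) : Set (Phase d) := {x | HasGradientAt u x.2 x.1}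

/-- The graph `𝒢(η_c + du)` where `η_c` is the constant form `cf`. -/
def gradGraphShift {d : ℕ} (cf : Euc d) (u : Euc d → ℝ) : Set (Phase d) :=
  {x | ∃ p, HasGradientAt u p x.1 ∧ x.2 = cf + p}

namespace K5
variable {d : ℕ}

instance {E F : Type*} [NormedAddCommGroup E] [NormedSpace ℝ E] [NormedAddCommGroup F] [NormedSpace ℝ F] : ContinuousSMul ℝ (E →L[ℝ] F) := IsBoundedSMul.continuousSMul
instance {E F : Type*} [NormedAddCommGroup E] [NormedSpace ℝ E] [NormedAddCommGroup F] [NormedSpace ℝ F] : T2Space (E →L[ℝ] F) := inferInstance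
instance : ContinuousSMul ℝ (Euc d) := inferInstance
instance : T2Space (Euc d) := inferInstance
instance : IsTopologicalAddGroup (Euc d) := inferInstance
instance : ContinuousSMul ℝ (Phase d) := inferInstance
instance : T2Space (Phase d) := inferInstance
instance : IsTopologicalAddGroup (Phase d) := inferInstance

lemma exists_rep (q : Euc d) : ∃ k : Fin d → ℤ, ‖q + intVec k‖ ≤ Real.sqrt d := by
  refine ⟨fun i => -⌊q i⌋, ?_⟩
  rw [EuclideanSpace.norm_eq]
  apply Real.sqrt_le_sqrt
  calc ∑ i, ‖(q + intVec (fun i => -⌊q i⌋)) i‖ ^ 2 ≤ ∑ _i : Fin d, (1:ℝ) := by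
        apply Finset.sum_le_sum
        intro i _
        have h : (q + intVec (fun i => -⌊q i⌋)) i = Int.fract (q i) := by
          simp [intVec, Int.fract, sub_eq_add_neg]
        rw [h, Real.norm_eq_abs, abs_of_nonneg (Int.fract_nonneg _)]
        have := Int.fract_nonneg (q i)
        have := (Int.fract_lt_one (q i)).le
        nlinarith
    _ = d := by simp

lemma per_bound {E : Type*} [NormedAddCommGroup E] {F : Phase d → E} (hc : Continuous F)
    (hp : PerPhase F) (R : ℝ) : ∃ C : ℝ, 0 < C ∧ ∀ z : Phase d, ‖z.2‖ ≤ R → ‖F z‖ ≤ C := by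
  have hK : IsCompact (closedBall (0 : Euc d) (Real.sqrt d) ×ˢ closedBall (0 : Euc d) R) :=
    (isCompact_closedBall _ _).prod (isCompact_closedBall _ _)
  obtain ⟨C, hC⟩ := hK.exists_bound_of_continuousOn hc.continuousOn
  refine ⟨max C 1, by positivity, fun z hz => ?_⟩
  obtain ⟨k, hk⟩ := exists_rep z.1
  have := hC (z.1 + intVec k, z.2) ⟨by simpa using hk, by simpa using hz⟩
  rw [hp k z.1 z.2] at this
  exact this.trans (le_max_left _ _)

lemma per_ucont {E : Type*} [NormedAddCommGroup E] {F : Phase d → E} (hc : Continuous F)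
    (hp : PerPhase F) (R : ℝ) (ε : ℝ) (hε : 0 < ε) : ∃ δ : ℝ, 0 < δ ∧
    ∀ z z' : Phase d, ‖z.2‖ ≤ R → ‖z' - z‖ < δ → ‖F z' - F z‖ < ε := by
  have hK : IsCompact (closedBall (0 : Euc d) (Real.sqrt d) ×ˢ closedBall (0 : Euc d) R) :=
    (isCompact_closedBall _ _).prod (isCompact_closedBall _ _)
  have h := hK.uniformContinuousAt_of_continuousAt F (fun a _ => hc.continuousAt)
    (dist_mem_uniformity hε)
  obtain ⟨δ, hδ, h⟩ := Metric.mem_uniformity_dist.1 h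
  refine ⟨δ, hδ, fun z z' hz hzz => ?_⟩
  obtain ⟨k, hk⟩ := exists_rep z.1
  have h1 := @h (z.1 + intVec k, z.2) (z'.1 + intVec k, z'.2) (by
    have e : (z.1 + intVec k, z.2) - (z'.1 + intVec k, z'.2) = z - z' := by
      ext1 <;> simp
    rw [dist_eq_norm, e, norm_sub_rev]; exact hzz) ⟨by simpa using hk, by simpa using hz⟩
  simp only [mem_ofPred_eq] at h1
  rw [hp k z.1 z.2, hp k z'.1 z'.2, dist_eq_norm, norm_sub_rev] at h1
  exact h1

def BB (H : Phase d → ℝ) (z : Phase d) : Phase d →L[ℝ] Phase d →L[ℝ] ℝ :=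
  fderiv ℝ (fderiv ℝ H) z

def Hq (H : Phase d → ℝ) (z : Phase d) : Euc d := gradient (fun q => H (q, z.2)) z.1
def Hp (H : Phase d → ℝ) (z : Phase d) : Euc d := gradient (fun p => H (z.1, p)) z.2

lemma perPhase_fderiv {E : Type*} [NormedAddCommGroup E] [NormedSpace ℝ E] {F : Phase d → E}
    (hp : PerPhase F) : PerPhase (fderiv ℝ F) := by
  intro k q p
  have h : (fun z : Phase d => F (z + (intVec k, 0))) = F := by
    funext z
    have := hp k z.1 z.2
    rw [← this]
    congr 1
    ext1 <;> simp
  have h2 := fderiv_comp_add_right (𝕜 := ℝ) (f := F) (x := (q, p)) (intVec k, 0)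
  rw [h] at h2
  rw [h2]; simp

section
variable {H : Phase d → ℝ} (hs : ContDiff ℝ 2 H)
include hs

lemma diffH (z : Phase d) : HasFDerivAt H (fderiv ℝ H z) z :=
  ((hs.differentiable (by norm_num)) z).hasFDerivAt

lemma contDiff_fderivH : ContDiff ℝ 1 (fderiv ℝ H) := hs.fderiv_right (by norm_num)

lemma diffdH (z : Phase d) : HasFDerivAt (fderiv ℝ H) (BB H z) z :=
  (((contDiff_fderivH hs).differentiable (by norm_num)) z).hasFDerivAt

lemma cont_BB : Continuous (BB H) :=
  (contDiff_fderivH hs).continuous_fderiv (by norm_num)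

lemma hp_inner (z : Phase d) (w : Euc d) : ⟪Hp H z, w⟫ = fderiv ℝ H z (0, w) := by
  have h1 : HasFDerivAt (fun p : Euc d => ((z.1, p) : Phase d)) (ContinuousLinearMap.inr ℝ _ _) z.2 :=
    hasFDerivAt_prodMk_right z.1 z.2
  have h2 := HasFDerivAt.comp z.2 (diffH hs (z.1, z.2)) h1
  have h3 : HasGradientAt (fun p => H (z.1, p)) _ z.2 := h2.hasGradientAt
  rw [Hp, HasGradientAt.gradient h3, InnerProductSpace.toDual_symm_apply]
  rfl

lemma hq_inner (z : Phase d) (w : Euc d) : ⟪Hq H z, w⟫ = fderiv ℝ H z (w, 0) := by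
  have h1 : HasFDerivAt (fun q : Euc d => ((q, z.2) : Phase d)) (ContinuousLinearMap.inl ℝ _ _) z.1 :=
    hasFDerivAt_prodMk_left z.1 z.2
  have h2 := HasFDerivAt.comp z.1 (diffH hs (z.1, z.2)) h1
  have h3 : HasGradientAt (fun q => H (q, z.2)) _ z.1 := h2.hasGradientAt
  rw [Hq, HasGradientAt.gradient h3, InnerProductSpace.toDual_symm_apply]
  rfl

lemma dH_eq (z ζ : Phase d) : fderiv ℝ H z ζ = ⟪Hq H z, ζ.1⟫ + ⟪Hp H z, ζ.2⟫ := by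
  rw [hp_inner hs, hq_inner hs, ← map_add]; simp

lemma BB_symm (z a b : Phase d) : BB H z a b = BB H z b a := by
  have := (hs.contDiffAt (x := z)).isSymmSndFDerivAt (by simp)
  exact this a b

lemma BB_fiber (q p v : Euc d) :
    iteratedFDeriv ℝ 2 (fun p' => H (q, p')) p ![v, v] = BB H (q, p) (0, v) (0, v) := by
  rw [iteratedFDeriv_two_apply]
  have e : fderiv ℝ (fun p' => H (q, p')) =
      fun p' => (fderiv ℝ H (q, p')).comp (ContinuousLinearMap.inr ℝ (Euc d) (Euc d)) := by
    funext p'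
    exact (HasFDerivAt.comp p' (diffH hs (q, p')) (hasFDerivAt_prodMk_right q p')).fderiv
  rw [e]
  have h2 := HasFDerivAt.comp p (diffdH hs (q, p)) (hasFDerivAt_prodMk_right q p)
  have h3 := (((ContinuousLinearMap.compL ℝ (Euc d) (Phase d) ℝ).flip
    (ContinuousLinearMap.inr ℝ (Euc d) (Euc d))).hasFDerivAt).comp p h2
  have h4 : HasFDerivAt (fun p' => (fderiv ℝ H (q, p')).comp (ContinuousLinearMap.inr ℝ (Euc d) (Euc d))) _ p := h3
  rw [h4.fderiv]
  simp

lemma cont_Hp : Continuous (Hp H) := by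
  have : Hp H = fun z => (InnerProductSpace.toDual ℝ (Euc d)).symm
      ((fderiv ℝ H z).comp (ContinuousLinearMap.inr ℝ (Euc d) (Euc d))) := by
    funext z
    apply ext_inner_right ℝ
    intro w
    rw [hp_inner hs, InnerProductSpace.toDual_symm_apply]; simp
  rw [this]
  exact (LinearIsometryEquiv.continuous _).comp
    ((contDiff_fderivH hs).continuous.clm_comp continuous_const)

lemma cont_Hq : Continuous (Hq H) := by
  have : Hq H = fun z => (InnerProductSpace.toDual ℝ (Euc d)).symm
      ((fderiv ℝ H z).comp (ContinuousLinearMap.inl ℝ (Euc d) (Euc d))) := by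
    funext z
    apply ext_inner_right ℝ
    intro w
    rw [hq_inner hs, InnerProductSpace.toDual_symm_apply]; simp
  rw [this]
  exact (LinearIsometryEquiv.continuous _).comp
    ((contDiff_fderivH hs).continuous.clm_comp continuous_const)

/-- second order Taylor lower bound -/
lemma taylor_lower (z ζ : Phase d) (m : ℝ)
    (hm : ∀ s ∈ Icc (0:ℝ) 1, m ≤ BB H (z + s • ζ) ζ ζ) :
    H z + fderiv ℝ H z ζ + m / 2 ≤ H (z + ζ) := by
  have hl : ∀ s : ℝ, HasDerivAt (fun s : ℝ => z + s • ζ) ζ s := by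
    intro s
    simpa using ((hasDerivAt_id s).smul_const ζ).const_add z
  have h1 : ∀ s : ℝ, HasDerivAt (fun s : ℝ => H (z + s • ζ)) (fderiv ℝ H (z + s • ζ) ζ) s :=
    fun s => (diffH hs _).comp_hasDerivAt s (hl s)
  have h2 : ∀ s : ℝ, HasDerivAt (fun s : ℝ => fderiv ℝ H (z + s • ζ) ζ)
      (BB H (z + s • ζ) ζ ζ) s := by
    intro s
    have := ((diffdH hs _).comp_hasDerivAt s (hl s)).clm_apply (hasDerivAt_const s ζ)
    simpa using this
  have h2' : ∀ s : ℝ, HasDerivAt (fun s : ℝ => fderiv ℝ H (z + s • ζ) ζ - m * s)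
      (BB H (z + s • ζ) ζ ζ - m) s := by
    intro s
    refine ((h2 s).sub ((hasDerivAt_id s).const_mul m)).congr_deriv ?_
    simp
  have g1 : MonotoneOn (fun s : ℝ => fderiv ℝ H (z + s • ζ) ζ - m * s) (Icc 0 1) := by
    apply monotoneOn_of_deriv_nonneg (convex_Icc 0 1)
    · exact fun s _ => (h2' s).continuousAt.continuousWithinAt
    · exact fun s _ => (h2' s).differentiableAt.differentiableWithinAt
    · intro s hs'
      rw [interior_Icc] at hs'
      rw [(h2' s).deriv]
      have := hm s ⟨hs'.1.le, hs'.2.le⟩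
      linarith
  have h3 : ∀ s : ℝ, HasDerivAt (fun s : ℝ => H (z + s • ζ) - fderiv ℝ H z ζ * s - m / 2 * s ^ 2)
      (fderiv ℝ H (z + s • ζ) ζ - fderiv ℝ H z ζ - m * s) s := by
    intro s
    have := ((h1 s).sub ((hasDerivAt_id s).const_mul (fderiv ℝ H z ζ))).sub
      (((hasDerivAt_id s).pow 2).const_mul (m / 2))
    refine (this.congr_deriv ?_)
    simp; ring
  have g2 : MonotoneOn (fun s : ℝ => H (z + s • ζ) - fderiv ℝ H z ζ * s - m / 2 * s ^ 2) (Icc 0 1) := by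
    apply monotoneOn_of_deriv_nonneg (convex_Icc 0 1)
    · exact fun s _ => (h3 s).continuousAt.continuousWithinAt
    · exact fun s _ => (h3 s).differentiableAt.differentiableWithinAt
    · intro s hs'
      rw [interior_Icc] at hs'
      rw [(h3 s).deriv]
      have := g1 (left_mem_Icc.2 zero_le_one) ⟨hs'.1.le, hs'.2.le⟩ hs'.1.le
      simp at this; linarith
  have := g2 (left_mem_Icc.2 zero_le_one) (right_mem_Icc.2 zero_le_one) zero_le_one
  simp at this; linarith

end

lemma taylor_upper {H : Phase d → ℝ} (hs : ContDiff ℝ 2 H) (z ζ : Phase d) (m : ℝ)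
    (hm : ∀ s ∈ Icc (0:ℝ) 1, BB H (z + s • ζ) ζ ζ ≤ m) :
    H (z + ζ) ≤ H z + fderiv ℝ H z ζ + m / 2 := by
  have hB : ∀ y, BB (fun x => - H x) y = - BB H y := by
    intro y
    have : fderiv ℝ (fun x => - H x) = fun y => - fderiv ℝ H y := by
      funext y; exact (diffH hs y).neg.fderiv
    rw [BB, this]; exact (diffdH hs y).neg.fderiv
  have := taylor_lower (H := fun x => - H x) hs.neg z ζ (-m) (by
    intro s hs'; rw [hB]; simpa using hm s hs')
  have e : fderiv ℝ (fun x => - H x) z = - fderiv ℝ H z := (diffH hs z).neg.fderiv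
  rw [e] at this
  simp at this; linarith

end K5

namespace K5
variable {d : ℕ} {H : Phase d → ℝ}

lemma perBB (hH : TonelliHam H) : PerPhase (BB H) :=
  perPhase_fderiv (perPhase_fderiv hH.periodic)

lemma coercive (hH : TonelliHam H) (R : ℝ) : ∃ c : ℝ, 0 < c ∧
    ∀ z : Phase d, ‖z.2‖ ≤ R → ∀ w : Euc d, c * ‖w‖ ^ 2 ≤ BB H z (0, w) (0, w) := by
  have hK : IsCompact ((closedBall (0 : Euc d) (Real.sqrt d) ×ˢ closedBall (0 : Euc d) R) ×ˢ
      sphere (0 : Euc d) 1) :=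
    ((isCompact_closedBall _ _).prod (isCompact_closedBall _ _)).prod (isCompact_sphere _ _)
  have hcont : Continuous (fun y : Phase d × Euc d => BB H y.1 (0, y.2) (0, y.2)) := by
    have := cont_BB hH.smooth
    fun_prop
  have key : ∃ c : ℝ, 0 < c ∧ ∀ y ∈ ((closedBall (0 : Euc d) (Real.sqrt d) ×ˢ
      closedBall (0 : Euc d) R) ×ˢ sphere (0 : Euc d) 1), c ≤ BB H y.1 (0, y.2) (0, y.2) := by
    rcases ((closedBall (0 : Euc d) (Real.sqrt d) ×ˢ
      closedBall (0 : Euc d) R) ×ˢ sphere (0 : Euc d) 1).eq_empty_or_nonempty with h | h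
    · exact ⟨1, one_pos, by rw [h]; simp⟩
    · obtain ⟨y, hy, hmin⟩ := hK.exists_isMinOn h hcont.continuousOn
      refine ⟨_, ?_, fun y' hy' => hmin hy'⟩
      have := hH.convex y.1.1 y.1.2 y.2 (by
        have h1 := hy.2
        intro h0; rw [h0] at h1; simp at h1)
      rwa [BB_fiber hH.smooth] at this
  obtain ⟨c, hc, hk⟩ := key
  refine ⟨c, hc, fun z hz w => ?_⟩
  rcases eq_or_ne w 0 with rfl | hw
  · have e : ((0, 0) : Phase d) = 0 := rfl
    simp [e]
  obtain ⟨k, hk'⟩ := exists_rep z.1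
  have h1 := hk (((z.1 + intVec k, z.2)), (‖w‖⁻¹ • w)) ⟨⟨by simpa using hk', by simpa using hz⟩, by
    simp [norm_smul, hw]⟩
  rw [perBB hH k] at h1
  have e : ((0, ‖w‖⁻¹ • w) : Phase d) = ‖w‖⁻¹ • (0, w) := by simp
  simp only [e, map_smul, _root_.smul_apply, smul_eq_mul] at h1
  have hn : 0 < ‖w‖ := norm_pos_iff.2 hw
  have h2 : ‖w‖⁻¹ * (‖w‖⁻¹ * BB H (z.1, z.2) (0, w) (0, w)) = BB H z (0, w) (0, w) / ‖w‖ ^ 2 := by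
    field_simp
  rw [h2, le_div_iff₀ (by positivity)] at h1
  exact h1

lemma bounds (hH : TonelliHam H) (R : ℝ) : ∃ C c : ℝ, 0 < C ∧ 0 < c ∧ ∀ z : Phase d, ‖z.2‖ ≤ R →
    |H z| ≤ C ∧ ‖fderiv ℝ H z‖ ≤ C ∧ ‖BB H z‖ ≤ C ∧
      ∀ w : Euc d, c * ‖w‖ ^ 2 ≤ BB H z (0, w) (0, w) := by
  obtain ⟨C1, h1, h1'⟩ := per_bound hH.smooth.continuous hH.periodic R
  obtain ⟨C2, h2, h2'⟩ := per_bound (contDiff_fderivH hH.smooth).continuous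
    (perPhase_fderiv hH.periodic) R
  obtain ⟨C3, h3, h3'⟩ := per_bound (cont_BB hH.smooth) (perBB hH) R
  obtain ⟨c, hc, hc'⟩ := coercive hH R
  refine ⟨C1 + C2 + C3, c, by positivity, hc, fun z hz => ⟨?_, ?_, ?_, hc' z hz⟩⟩
  · have := h1' z hz; rw [Real.norm_eq_abs] at this; linarith
  · have := h2' z hz; linarith
  · have := h3' z hz; linarith

lemma norm_Hp_le (hs : ContDiff ℝ 2 H) (z : Phase d) : ‖Hp H z‖ ≤ ‖fderiv ℝ H z‖ := by
  have h := hp_inner hs z (Hp H z)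
  rw [real_inner_self_eq_norm_sq] at h
  have h2 := (fderiv ℝ H z).le_opNorm (0, Hp H z)
  have h3 : ‖((0, Hp H z) : Phase d)‖ = ‖Hp H z‖ := by simp [Prod.norm_def]
  rw [h3, ← h, Real.norm_eq_abs, abs_of_nonneg (by positivity)] at h2
  by_contra hlt
  push Not at hlt
  nlinarith [norm_nonneg (fderiv ℝ H z)]

lemma norm_Hq_le (hs : ContDiff ℝ 2 H) (z : Phase d) : ‖Hq H z‖ ≤ ‖fderiv ℝ H z‖ := by
  have h := hq_inner hs z (Hq H z)
  rw [real_inner_self_eq_norm_sq] at h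
  have h2 := (fderiv ℝ H z).le_opNorm (Hq H z, 0)
  have h3 : ‖((Hq H z, 0) : Phase d)‖ = ‖Hq H z‖ := by simp [Prod.norm_def]
  rw [h3, ← h, Real.norm_eq_abs, abs_of_nonneg (by positivity)] at h2
  by_contra hlt
  push Not at hlt
  nlinarith [norm_nonneg (fderiv ℝ H z)]

/-- lower bound of the Hessian form -/
lemma BB_lower (hs : ContDiff ℝ 2 H) {C c : ℝ} {z : Phase d} (hC : ‖BB H z‖ ≤ C)
    (hc : ∀ w : Euc d, c * ‖w‖ ^ 2 ≤ BB H z (0, w) (0, w)) (ξ δ : Euc d) :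
    c * ‖δ‖ ^ 2 - 2 * C * ‖ξ‖ * ‖δ‖ - C * ‖ξ‖ ^ 2 ≤ BB H z (ξ, δ) (ξ, δ) := by
  have e : ((ξ, δ) : Phase d) = (ξ, 0) + (0, δ) := by simp
  have e2 : BB H z (ξ, δ) (ξ, δ) = BB H z (ξ, 0) (ξ, 0) + 2 * BB H z (ξ, 0) (0, δ)
      + BB H z (0, δ) (0, δ) := by
    rw [e]; simp only [map_add, _root_.add_apply]
    rw [BB_symm hs z (0, δ) (ξ, 0)]; ring
  have n1 : ‖((ξ, 0) : Phase d)‖ = ‖ξ‖ := by simp [Prod.norm_def]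
  have n2 : ‖((0, δ) : Phase d)‖ = ‖δ‖ := by simp [Prod.norm_def]
  have b1 := (BB H z).le_opNorm₂ (ξ, 0) (ξ, 0)
  have b2 := (BB H z).le_opNorm₂ (ξ, 0) (0, δ)
  rw [n1, Real.norm_eq_abs] at b1
  rw [n1, n2, Real.norm_eq_abs] at b2
  have b1' := neg_le_of_abs_le b1
  have b2' := neg_le_of_abs_le b2
  have k1 : ‖BB H z‖ * ‖ξ‖ * ‖ξ‖ ≤ C * ‖ξ‖ * ‖ξ‖ := by gcongr
  have k2 : ‖BB H z‖ * ‖ξ‖ * ‖δ‖ ≤ C * ‖ξ‖ * ‖δ‖ := by gcongr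
  have := hc δ
  rw [e2]; linarith

lemma BB_upper {C : ℝ} {z : Phase d} (hC : ‖BB H z‖ ≤ C) (ζ : Phase d) :
    |BB H z ζ ζ| ≤ C * ‖ζ‖ ^ 2 := by
  have b1 := (BB H z).le_opNorm₂ ζ ζ
  have k1 : ‖BB H z‖ * ‖ζ‖ * ‖ζ‖ ≤ C * ‖ζ‖ * ‖ζ‖ := by gcongr
  rw [Real.norm_eq_abs] at b1
  linarith

/-- strong convexity in the fibre -/
lemma strong_conv (hs : ContDiff ℝ 2 H) {R c : ℝ}
    (hc : ∀ z : Phase d, ‖z.2‖ ≤ R → ∀ w : Euc d, c * ‖w‖ ^ 2 ≤ BB H z (0, w) (0, w))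
    (x p p' : Euc d) (hp : ‖p‖ ≤ R) (hp' : ‖p'‖ ≤ R) :
    H (x, p) + ⟪Hp H (x, p), p' - p⟫ + c / 2 * ‖p' - p‖ ^ 2 ≤ H (x, p') := by
  have := taylor_lower hs (x, p) (0, p' - p) (c * ‖p' - p‖ ^ 2) (by
    intro s hs'
    apply hc
    have : ((x, p) + s • ((0 : Euc d), p' - p) : Phase d).2 = (1 - s) • p + s • p' := by
      simp [smul_sub, sub_smul]; abel
    rw [this]
    calc ‖(1 - s) • p + s • p'‖ ≤ ‖(1 - s) • p‖ + ‖s • p'‖ := norm_add_le _ _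
      _ = (1 - s) * ‖p‖ + s * ‖p'‖ := by
        rw [norm_smul, norm_smul, Real.norm_of_nonneg (by linarith [hs'.2]),
          Real.norm_of_nonneg hs'.1]
      _ ≤ (1 - s) * R + s * R := by
        have := hs'.1; have : 0 ≤ 1 - s := by linarith [hs'.2]
        gcongr
      _ = R := by ring)
  rw [hp_inner hs]
  have e : ((x, p) + ((0 : Euc d), p' - p) : Phase d) = (x, p') := by simp
  rw [e] at this
  linarith

/-- convexity in the fibre -/
lemma conv_fiber (hH : TonelliHam H) (x p p' : Euc d) :
    H (x, p) + ⟪Hp H (x, p), p' - p⟫ ≤ H (x, p') := by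
  obtain ⟨c, hc, h⟩ := coercive hH (max ‖p‖ ‖p'‖)
  have := strong_conv hH.smooth h x p p' (le_max_left _ _) (le_max_right _ _)
  nlinarith [norm_nonneg (p' - p), sq_nonneg ‖p' - p‖]

lemma leg_bdd (hH : TonelliHam H) (x v : Euc d) :
    BddAbove {r | ∃ p : Euc d, r = ⟪p, v⟫ - H (x, p)} := by
  obtain ⟨B, hB⟩ := hH.superlinear ‖v‖
  refine ⟨-B, ?_⟩
  rintro r ⟨p, rfl⟩
  have := hB x p
  have := real_inner_le_norm p v
  linarith [mul_comm ‖p‖ ‖v‖]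

lemma fenchel (hH : TonelliHam H) (x v p : Euc d) : ⟪p, v⟫ - H (x, p) ≤ LegendreL H (x, v) :=
  le_csSup (leg_bdd hH x v) ⟨p, rfl⟩

lemma leg_eq_of (hH : TonelliHam H) {x v p : Euc d} (h : ∀ p', ⟪p', v⟫ - H (x, p') ≤ ⟪p, v⟫ - H (x, p)) :
    LegendreL H (x, v) = ⟪p, v⟫ - H (x, p) := by
  apply le_antisymm
  · have hne : {r | ∃ p : Euc d, r = ⟪p, v⟫ - H (x, p)}.Nonempty := ⟨_, p, rfl⟩
    refine csSup_le hne ?_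
    rintro r ⟨p', rfl⟩
    exact h p'
  · exact fenchel hH x v p

lemma leg_Hp (hH : TonelliHam H) (x p : Euc d) :
    LegendreL H (x, Hp H (x, p)) = ⟪p, Hp H (x, p)⟫ - H (x, p) := by
  apply leg_eq_of hH
  intro p'
  have := conv_fiber hH x p p'
  rw [inner_sub_right, real_inner_comm p', real_inner_comm p] at this
  linarith

lemma leg_exists (hH : TonelliHam H) (x v : Euc d) : ∃ p, Hp H (x, p) = v := by
  obtain ⟨B, hB⟩ := hH.superlinear (‖v‖ + 1)
  have hc : Continuous (fun p : Euc d => H (x, p) - ⟪v, p⟫) := by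
    have := hH.smooth.continuous
    fun_prop
  obtain ⟨p, hp⟩ := hc.exists_forall_le (by
    refine tendsto_atTop_mono (f := fun p : Euc d => ‖p‖ + B) ?_
      (tendsto_atTop_add_const_right _ _ (tendsto_norm_cocompact_atTop))
    intro p
    have := hB x p
    have := real_inner_le_norm v p
    nlinarith)
  refine ⟨p, ?_⟩
  have hmin : IsLocalMin (fun p : Euc d => H (x, p) - ⟪v, p⟫) p := Eventually.of_forall hp
  have hd : HasFDerivAt (fun p : Euc d => H (x, p) - ⟪v, p⟫)
      ((fderiv ℝ H (x, p)).comp (ContinuousLinearMap.inr ℝ (Euc d) (Euc d)) - innerSL ℝ v) p :=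
    (HasFDerivAt.comp p (diffH hH.smooth (x, p)) (hasFDerivAt_prodMk_right x p)).sub
      (innerSL ℝ v).hasFDerivAt
  have h0 := hmin.hasFDerivAt_eq_zero hd
  apply ext_inner_right ℝ
  intro w
  rw [hp_inner hH.smooth]
  have := congrArg (fun l => l w) h0
  simp at this
  linarith

/-- the maximiser -/
lemma leg_max (hH : TonelliHam H) (x v : Euc d) : ∃ p, Hp H (x, p) = v ∧
    LegendreL H (x, v) = ⟪p, v⟫ - H (x, p) := by
  obtain ⟨p, hp⟩ := leg_exists hH x v
  refine ⟨p, hp, ?_⟩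
  have := leg_Hp hH x p
  rwa [hp] at this

lemma leg_bound (hH : TonelliHam H) (M : ℝ) : ∃ R : ℝ, 0 < R ∧ ∀ x v p : Euc d, ‖v‖ ≤ M →
    Hp H (x, p) = v → ‖p‖ ≤ R := by
  obtain ⟨B, hB⟩ := hH.superlinear (M + 1)
  obtain ⟨C, hC, hb⟩ := per_bound hH.smooth.continuous hH.periodic 0
  refine ⟨max (C - B) 1, by positivity, fun x v p hv hp => le_max_of_le_left ?_⟩
  have h1 := fenchel hH x v 0
  have h2 := leg_Hp hH x p
  rw [hp] at h2
  have h3 := hB x p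
  have h4 := hb (x, 0) (by simp)
  have h5 := (abs_le.1 (by simpa using h4)).2
  have h6 := real_inner_le_norm p v
  simp only [inner_zero_left] at h1
  nlinarith [norm_nonneg p]

lemma leg_near (hs : ContDiff ℝ 2 H) {R c : ℝ} (hc0 : 0 < c)
    (hc : ∀ z : Phase d, ‖z.2‖ ≤ R → ∀ w : Euc d, c * ‖w‖ ^ 2 ≤ BB H z (0, w) (0, w))
    (x p p' : Euc d) (hp : ‖p‖ ≤ R) (hp' : ‖p'‖ ≤ R) :
    ‖p' - p‖ ≤ ‖Hp H (x, p') - Hp H (x, p)‖ / c := by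
  have h1 := strong_conv hs hc x p p' hp hp'
  have h2 := strong_conv hs hc x p' p hp' hp
  rw [norm_sub_rev p p', ← neg_sub p' p, inner_neg_right] at h2
  have h3 := real_inner_le_norm (Hp H (x, p') - Hp H (x, p)) (p' - p)
  rw [inner_sub_left] at h3
  rw [le_div_iff₀ hc0]
  by_contra hlt
  push Not at hlt
  have hpos : 0 < ‖p' - p‖ := by
    by_contra h0
    have : ‖p' - p‖ = 0 := le_antisymm (not_lt.1 h0) (norm_nonneg _)
    rw [this] at hlt
    linarith [norm_nonneg (Hp H (x, p') - Hp H (x, p))]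
  nlinarith
end K5

namespace K5
variable {d : ℕ} {H : Phase d → ℝ}

lemma slab_lip {E : Type*} [NormedAddCommGroup E] [NormedSpace ℝ E] {F : Phase d → E}
    (hF : Differentiable ℝ F) {R C : ℝ} (hC : ∀ z : Phase d, ‖z.2‖ ≤ R → ‖fderiv ℝ F z‖ ≤ C)
    (z z' : Phase d) (hz : ‖z.2‖ ≤ R) (hz' : ‖z'.2‖ ≤ R) : ‖F z' - F z‖ ≤ C * ‖z' - z‖ := by
  have hconv : Convex ℝ {z : Phase d | ‖z.2‖ ≤ R} := by
    have : {z : Phase d | ‖z.2‖ ≤ R} = (LinearMap.snd ℝ (Euc d) (Euc d)) ⁻¹' closedBall 0 R := by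
      ext z; simp
    rw [this]
    exact (convex_closedBall _ _).linear_preimage _
  exact hconv.norm_image_sub_le_of_norm_fderiv_le (fun x _ => hF x) (fun x hx => hC x hx) hz hz'

lemma H_lip (hH : TonelliHam H) {R C : ℝ} (hC : ∀ z : Phase d, ‖z.2‖ ≤ R → ‖fderiv ℝ H z‖ ≤ C)
    (x y p : Euc d) (hp : ‖p‖ ≤ R) : |H (y, p) - H (x, p)| ≤ C * ‖y - x‖ := by
  have := slab_lip (hH.smooth.differentiable (by norm_num)) hC (x, p) (y, p) hp hp
  have e : ‖((y, p) - (x, p) : Phase d)‖ = ‖y - x‖ := by simp [Prod.norm_def]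
  rwa [e] at this

lemma leg_lip (hH : TonelliHam H) (M : ℝ) : ∃ C : ℝ, 0 < C ∧ ∀ x y v : Euc d, ‖v‖ ≤ M →
    |LegendreL H (y, v) - LegendreL H (x, v)| ≤ C * ‖y - x‖ := by
  obtain ⟨R, hR, hRb⟩ := leg_bound hH M
  obtain ⟨C, c, hC, hc, hb⟩ := bounds hH R
  have key : ∀ x y v : Euc d, ‖v‖ ≤ M → LegendreL H (y, v) - LegendreL H (x, v) ≤ C * ‖y - x‖ := by
    intro x y v hv
    obtain ⟨p, hp, hL⟩ := leg_max hH y v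
    have h1 := fenchel hH x v p
    have h2 := H_lip hH (fun z hz => (hb z hz).2.1) x y p (hRb y v p hv hp)
    have := (abs_le.1 h2).1
    linarith
  refine ⟨C, hC, fun x y v hv => abs_le.2 ⟨?_, key x y v hv⟩⟩
  have := key y x v hv
  rw [norm_sub_rev] at this
  linarith

lemma leg_super (hH : TonelliHam H) (A : ℝ) (hA : 0 ≤ A) : ∃ B : ℝ, 0 < B ∧ ∀ x v : Euc d,
    A * ‖v‖ - B ≤ LegendreL H (x, v) := by
  obtain ⟨C, hC, hb⟩ := per_bound hH.smooth.continuous hH.periodic A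
  refine ⟨C, hC, fun x v => ?_⟩
  rcases eq_or_ne v 0 with rfl | hv
  · have h1 := fenchel hH x 0 0
    have h2 := hb (x, 0) (by simpa using hA)
    have := (abs_le.1 (by simpa using h2)).2
    simp at h1 ⊢; linarith
  · have hn : 0 < ‖v‖ := norm_pos_iff.2 hv
    have hp : ‖(A * ‖v‖⁻¹) • v‖ = A := by
      rw [norm_smul, Real.norm_of_nonneg (by positivity)]; field_simp
    have h1 := fenchel hH x v ((A * ‖v‖⁻¹) • v)
    have h2 := hb (x, (A * ‖v‖⁻¹) • v) (by simp only [hp]; exact le_rfl)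
    have := (abs_le.1 (by simpa using h2)).2
    rw [real_inner_smul_left, real_inner_self_eq_norm_sq] at h1
    have e : A * ‖v‖⁻¹ * ‖v‖ ^ 2 = A * ‖v‖ := by field_simp
    rw [e] at h1; linarith

lemma leg_abs (hH : TonelliHam H) (M : ℝ) : ∃ C : ℝ, 0 < C ∧ ∀ x v : Euc d, ‖v‖ ≤ M →
    |LegendreL H (x, v)| ≤ C := by
  obtain ⟨R, hR, hRb⟩ := leg_bound hH M
  obtain ⟨C, c, hC, hc, hb⟩ := bounds hH R
  refine ⟨C + R * |M| , by positivity, fun x v hv => ?_⟩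
  obtain ⟨p, hp, hL⟩ := leg_max hH x v
  have hpR := hRb x v p hv hp
  have h1 := (hb (x, p) hpR).1
  have h2 := abs_real_inner_le_norm p v
  have h3 : ‖p‖ * ‖v‖ ≤ R * |M| := by
    have := le_abs_self M
    gcongr; linarith
  rw [hL]
  calc |⟪p, v⟫ - H (x, p)| ≤ |⟪p, v⟫| + |H (x, p)| := abs_sub _ _
    _ ≤ _ := by linarith

/-- quadratic gap in Fenchel's inequality -/
lemma leg_gap (hH : TonelliHam H) (M R : ℝ) : ∃ c : ℝ, 0 < c ∧ ∀ x v p : Euc d, ‖v‖ ≤ M → ‖p‖ ≤ R →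
    c * ‖v - Hp H (x, p)‖ ^ 2 ≤ LegendreL H (x, v) + H (x, p) - ⟪p, v⟫ := by
  obtain ⟨C, _, hC, _, hb⟩ := bounds hH (R + 1)
  have hD : 0 < |M| + C := by positivity
  set a : ℝ := min (1 / C) (1 / (|M| + C)) with ha
  have ha0 : 0 < a := by positivity
  have ha1 : a * C ≤ 1 := by
    have : a ≤ 1 / C := min_le_left _ _
    rwa [le_div_iff₀ hC] at this
  have ha2 : a * (|M| + C) ≤ 1 := by
    have : a ≤ 1 / (|M| + C) := min_le_right _ _
    rwa [le_div_iff₀ hD] at this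
  refine ⟨a / 2, by positivity, fun x v p hv hp => ?_⟩
  set D := v - Hp H (x, p) with hDdef
  have hHp : ‖Hp H (x, p)‖ ≤ C :=
    (norm_Hp_le hH.smooth _).trans (hb (x, p) (by simp only; linarith)).2.1
  have hDn : ‖D‖ ≤ |M| + C := (norm_sub_le _ _).trans (by linarith [le_abs_self M])
  have hδ : ‖a • D‖ ≤ 1 := by
    rw [norm_smul, Real.norm_of_nonneg ha0.le]
    exact (mul_le_mul_of_nonneg_left hDn ha0.le).trans ha2
  have h1 := fenchel hH x v (p + a • D)
  have nn : ‖((0, a • D) : Phase d)‖ = a * ‖D‖ := by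
    simp only [Prod.norm_def, norm_zero, norm_smul, Real.norm_of_nonneg ha0.le]
    exact max_eq_right (by positivity)
  have h2 := taylor_upper hH.smooth (x, p) (0, a • D) (C * (a * ‖D‖) ^ 2) (by
    intro s hs
    have : ‖((x, p) + s • ((0 : Euc d), a • D) : Phase d).2‖ ≤ R + 1 := by
      simp only [Prod.snd_add, Prod.smul_snd]
      refine (norm_add_le _ _).trans (add_le_add hp ?_)
      rw [norm_smul, Real.norm_of_nonneg hs.1]
      exact mul_le_one₀ hs.2 (norm_nonneg _) hδ
    have h3 := BB_upper (hb _ this).2.2.1 (0, a • D)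
    rw [nn] at h3
    exact (le_abs_self _).trans h3)
  have e : ((x, p) + ((0 : Euc d), a • D) : Phase d) = (x, p + a • D) := by simp
  rw [e, ← hp_inner hH.smooth, real_inner_smul_right] at h2
  have hi : ⟪D, D⟫ = ‖D‖ ^ 2 := real_inner_self_eq_norm_sq D
  have hi2 : ⟪D, D⟫ = ⟪D, v⟫ - ⟪Hp H (x, p), D⟫ := by
    conv_lhs => rw [hDdef, inner_sub_right]
    rw [← hDdef, real_inner_comm D]
  rw [inner_add_left, real_inner_smul_left] at h1
  have k : C * (a * ‖D‖) ^ 2 / 2 ≤ a * ‖D‖ ^ 2 / 2 := by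
    have : C * (a * ‖D‖) ^ 2 = (a * C) * (a * ‖D‖ ^ 2) := by ring
    rw [this]
    have : 0 ≤ a * ‖D‖ ^ 2 := by positivity
    have := mul_le_mul_of_nonneg_right ha1 this; linarith
  have hm : a * ⟪D, v⟫ = a * ⟪Hp H (x, p), D⟫ + a * ‖D‖ ^ 2 := by
    rw [← mul_add]; congr 1; linarith
  linarith

/-- Taylor bound of `L` from above -/
lemma leg_sc (hH : TonelliHam H) (M : ℝ) : ∃ C : ℝ, 0 < C ∧ ∀ x v p ξ η : Euc d, ‖v‖ ≤ M →
    Hp H (x, p) = v → ‖η‖ ≤ 1 →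
    LegendreL H (x + ξ, v + η) ≤ LegendreL H (x, v) - ⟪Hq H (x, p), ξ⟫ + ⟪p, η⟫
      + C * (‖ξ‖ ^ 2 + ‖η‖ ^ 2) := by
  obtain ⟨R, hR, hRb⟩ := leg_bound hH (M + 1)
  obtain ⟨C, c, hC, hc, hb⟩ := bounds hH R
  refine ⟨1 / c * (C ^ 2 + 1) + C, by positivity, fun x v p ξ η hv hp hη => ?_⟩
  have hpR := hRb x v p (by linarith) hp
  obtain ⟨p', hp', hL'⟩ := leg_max hH (x + ξ) (v + η)
  have hpR' := hRb _ _ p' ((norm_add_le _ _).trans (by linarith)) hp'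
  have hL := leg_Hp hH x p
  rw [hp] at hL
  set δ := p' - p with hδ
  have h2 := taylor_lower hH.smooth (x, p) (ξ, δ) (c * ‖δ‖ ^ 2 - 2 * C * ‖ξ‖ * ‖δ‖ - C * ‖ξ‖ ^ 2) (by
    intro s hs
    have : ‖((x, p) + s • (ξ, δ) : Phase d).2‖ ≤ R := by
      have : ((x, p) + s • (ξ, δ) : Phase d).2 = (1 - s) • p + s • p' := by
        simp [hδ, smul_sub, sub_smul]; abel
      rw [this]
      calc ‖(1 - s) • p + s • p'‖ ≤ ‖(1 - s) • p‖ + ‖s • p'‖ := norm_add_le _ _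
        _ = (1 - s) * ‖p‖ + s * ‖p'‖ := by
          rw [norm_smul, norm_smul, Real.norm_of_nonneg (by linarith [hs.2]),
            Real.norm_of_nonneg hs.1]
        _ ≤ (1 - s) * R + s * R := by
          have := hs.1; have : 0 ≤ 1 - s := by linarith [hs.2]
          gcongr
        _ = R := by ring
    exact BB_lower hH.smooth (hb _ this).2.2.1 (hb _ this).2.2.2 ξ δ)
  rw [dH_eq hH.smooth, hp] at h2
  have e : ((x, p) + (ξ, δ) : Phase d) = (x + ξ, p') := by simp [hδ]
  rw [e] at h2
  simp only at h2
  rw [hL', hL]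
  have e1 : p' = p + δ := by simp [hδ]
  have i1 : ⟪p', v + η⟫ = ⟪p, v⟫ + ⟪v, δ⟫ + ⟪p, η⟫ + ⟪δ, η⟫ := by
    rw [e1, inner_add_left, inner_add_right, inner_add_right, real_inner_comm v δ]; ring
  have i2 := real_inner_le_norm δ η
  rw [i1]
  have i3 : ‖δ‖ * ‖η‖ + C * ‖ξ‖ * ‖δ‖ - c / 2 * ‖δ‖ ^ 2 ≤ 1 / c * (C ^ 2 + 1) * (‖ξ‖ ^ 2 + ‖η‖ ^ 2) := by
    have t1 : ‖δ‖ * (‖η‖ + C * ‖ξ‖) - c / 2 * ‖δ‖ ^ 2 ≤ 1 / (2 * c) * (‖η‖ + C * ‖ξ‖) ^ 2 := by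
      have : 1 / (2 * c) * (‖η‖ + C * ‖ξ‖) ^ 2 - ‖δ‖ * (‖η‖ + C * ‖ξ‖) + c / 2 * ‖δ‖ ^ 2
        = 1 / (2 * c) * ((‖η‖ + C * ‖ξ‖) - c * ‖δ‖) ^ 2 := by field_simp; ring
      have : 0 ≤ 1 / (2 * c) * ((‖η‖ + C * ‖ξ‖) - c * ‖δ‖) ^ 2 := by positivity
      linarith
    have t2 : (‖η‖ + C * ‖ξ‖) ^ 2 ≤ 2 * (C ^ 2 + 1) * (‖ξ‖ ^ 2 + ‖η‖ ^ 2) := by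
      linarith [sq_nonneg (‖η‖ - C * ‖ξ‖), sq_nonneg (C * ‖η‖), sq_nonneg ‖ξ‖]
    have t3 : 1 / (2 * c) * (‖η‖ + C * ‖ξ‖) ^ 2 ≤ 1 / (2 * c) * (2 * (C ^ 2 + 1) * (‖ξ‖ ^ 2 + ‖η‖ ^ 2)) := by
      gcongr
    have t4 : 1 / (2 * c) * (2 * (C ^ 2 + 1) * (‖ξ‖ ^ 2 + ‖η‖ ^ 2)) = 1 / c * (C ^ 2 + 1) * (‖ξ‖ ^ 2 + ‖η‖ ^ 2) := by
      field_simp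
    linarith
  linarith [mul_nonneg hC.le (sq_nonneg ‖ξ‖), mul_nonneg hC.le (sq_nonneg ‖η‖)]

/-- second difference of `L` -/
lemma leg_sd_raw (hH : TonelliHam H) (x v ξ η pp pm δ : Euc d)
    (h1 : Hp H (x + ξ, pp) = v + η) (h2 : Hp H (x - ξ, pm) = v - η) (m : ℝ)
    (hδ : δ = (1/2 : ℝ) • (pp - pm))
    (hm : ∀ s ∈ Icc (-1:ℝ) 1, m ≤ BB H (x + s • ξ, (1/2 : ℝ) • (pp + pm) + s • δ) (ξ, δ) (ξ, δ)) :
    LegendreL H (x + ξ, v + η) + LegendreL H (x - ξ, v - η) - 2 * LegendreL H (x, v)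
      ≤ 2 * ⟪δ, η⟫ - m := by
  set p := (1/2 : ℝ) • (pp + pm) with hp
  have e1 : pp = p + δ := by rw [hp, hδ]; module
  have e2 : pm = p - δ := by rw [hp, hδ]; module
  have L1 := leg_Hp hH (x + ξ) pp
  have L2 := leg_Hp hH (x - ξ) pm
  have L3 := fenchel hH x v p
  rw [h1] at L1; rw [h2] at L2
  have t1 := taylor_lower hH.smooth (x, p) (ξ, δ) m (by
    intro s hs
    exact hm s ⟨by linarith [hs.1], hs.2⟩)
  have t2 := taylor_lower hH.smooth (x, p) (-(ξ, δ)) m (by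
    intro s hs
    have := hm (-s) ⟨by linarith [hs.2], by linarith [hs.1]⟩
    have e : ((x, p) + s • -(ξ, δ) : Phase d) = (x + (-s) • ξ, p + (-s) • δ) := by simp
    rw [e]; simp only [map_neg, _root_.neg_apply, neg_neg]; exact this)
  have f1 : ((x, p) + (ξ, δ) : Phase d) = (x + ξ, pp) := by simp [e1]
  have f2 : ((x, p) + -(ξ, δ) : Phase d) = (x - ξ, pm) := by simp [e2, sub_eq_add_neg]
  rw [f1] at t1; rw [f2, map_neg] at t2
  have i1 : ⟪pp, v + η⟫ + ⟪pm, v - η⟫ = 2 * ⟪p, v⟫ + 2 * ⟪δ, η⟫ := by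
    rw [e1, e2]
    simp only [inner_add_left, inner_sub_left, inner_add_right, inner_sub_right]; ring
  linarith

lemma leg_sd_crude (hH : TonelliHam H) (M : ℝ) : ∃ C : ℝ, 0 < C ∧ ∀ x v ξ η : Euc d, ‖v‖ ≤ M →
    ‖η‖ ≤ 1 →
    LegendreL H (x + ξ, v + η) + LegendreL H (x - ξ, v - η) - 2 * LegendreL H (x, v)
      ≤ C * (‖ξ‖ ^ 2 + ‖η‖ ^ 2) := by
  obtain ⟨C, hC, h⟩ := leg_sc hH M
  refine ⟨2 * C, by positivity, fun x v ξ η hv hη => ?_⟩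
  obtain ⟨p, hp⟩ := leg_exists hH x v
  have h1 := h x v p ξ η hv hp hη
  have h2 := h x v p (-ξ) (-η) hv hp (by simpa using hη)
  rw [inner_neg_right, inner_neg_right, norm_neg, norm_neg, ← sub_eq_add_neg, ← sub_eq_add_neg] at h2
  linarith
end K5

namespace K5
variable {d : ℕ} {H : Phase d → ℝ}

lemma ac_diff {γ γ' : ℝ → Euc d} {a b s t : ℝ} (h : ACOn γ γ' a b) (has : a ≤ s) (hst : s ≤ t)
    (htb : t ≤ b) : γ t - γ s = ∫ r in s..t, γ' r := by
  have i1 : IntervalIntegrable γ' volume a s :=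
    h.1.mono_set (by rw [uIcc_of_le has, uIcc_of_le (by linarith)]; exact Icc_subset_Icc le_rfl (by linarith))
  have i2 : IntervalIntegrable γ' volume s t :=
    h.1.mono_set (by rw [uIcc_of_le hst, uIcc_of_le (by linarith)]; exact Icc_subset_Icc has htb)
  rw [h.2 t ⟨by linarith, htb⟩, h.2 s ⟨has, by linarith⟩,
    ← intervalIntegral.integral_add_adjacent_intervals i1 i2]
  abel

lemma ac_sub {γ γ' : ℝ → Euc d} {a b s t : ℝ} (h : ACOn γ γ' a b) (has : a ≤ s) (hst : s ≤ t)
    (htb : t ≤ b) : ACOn γ γ' s t := by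
  refine ⟨h.1.mono_set (by
    rw [uIcc_of_le hst, uIcc_of_le (by linarith)]; exact Icc_subset_Icc has htb), fun r hr => ?_⟩
  rw [← ac_diff h has hr.1 (hr.2.trans htb)]; abel

lemma ac_join {γ γ' : ℝ → Euc d} {a b c : ℝ} (h1 : ACOn γ γ' a b) (h2 : ACOn γ γ' b c)
    (hab : a ≤ b) (hbc : b ≤ c) : ACOn γ γ' a c := by
  refine ⟨h1.1.trans h2.1, fun t ht => ?_⟩
  rcases le_total t b with h | h
  · exact h1.2 t ⟨ht.1, h⟩
  · have i2 : IntervalIntegrable γ' volume b t :=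
      h2.1.mono_set (by rw [uIcc_of_le h, uIcc_of_le hbc]; exact Icc_subset_Icc le_rfl ht.2)
    rw [← intervalIntegral.integral_add_adjacent_intervals h1.1 i2, h2.2 t ⟨h, ht.2⟩,
      h1.2 b ⟨hab, le_rfl⟩]
    abel

lemma ac_congr {γ γ' σ σ' : ℝ → Euc d} {a b : ℝ} (hab : a ≤ b) (h : ACOn γ γ' a b)
    (h1 : ∀ s ∈ Icc a b, σ s = γ s) (h2 : ∀ s ∈ Ioc a b, σ' s = γ' s) : ACOn σ σ' a b := by
  refine ⟨h.1.congr ?_, fun t ht => ?_⟩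
  · rw [uIoc_of_le hab]
    exact fun s hs => (h2 s hs).symm
  · rw [h1 t ht, h1 a ⟨le_rfl, hab⟩, h.2 t ht]
    congr 1
    apply intervalIntegral.integral_congr_ae
    refine Eventually.of_forall fun s hs => ?_
    rw [uIoc_of_le ht.1] at hs
    exact (h2 s ⟨hs.1, hs.2.trans ht.2⟩).symm

lemma ac_shift {γ γ' : ℝ → Euc d} {a b : ℝ} (h : ACOn γ γ' a b) (t : ℝ) :
    ACOn (fun s => γ (s + t)) (fun s => γ' (s + t)) (a - t) (b - t) := by
  refine ⟨h.1.comp_add_right t, fun s hs => ?_⟩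
  have := h.2 (s + t) ⟨by linarith [hs.1], by linarith [hs.2]⟩
  simp only [intervalIntegral.integral_comp_add_right (fun r => γ' r), sub_add_cancel]
  exact this

lemma ac_line (x v : Euc d) (a b : ℝ) : ACOn (fun s => x + s • v) (fun _ => v) a b := by
  refine ⟨intervalIntegrable_const, fun t _ => ?_⟩
  rw [intervalIntegral.integral_const]; module

/-- values of the discounted cost -/
def DV (H : Phase d → ℝ) (a lam : ℝ) (q : Euc d) : Set ℝ :=
  {r | ∃ γ γ' : ℝ → Euc d, (∀ a ≤ (0:ℝ), ACOn γ γ' a 0) ∧ γ 0 = q ∧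
      IntegrableOn (fun s => Real.exp (lam * s) * (LegendreL H (γ s, γ' s) + a))
        (Iic 0) volume ∧
      r = ∫ s in Iic (0:ℝ), Real.exp (lam * s) * (LegendreL H (γ s, γ' s) + a)}

def DSol (H : Phase d → ℝ) (a lam : ℝ) (w : Euc d → ℝ) : Prop := ∀ q, w q = sInf (DV H a lam q)

lemma exp_intOn {lam : ℝ} (hl : 0 < lam) :
    IntegrableOn (fun s => Real.exp (lam * s)) (Iic 0) volume := by
  exact integrableOn_exp_mul_Iic hl 0

lemma DV_ne {a lam : ℝ} (hl : 0 < lam) (q : Euc d) : (DV H a lam q).Nonempty := by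
  refine ⟨_, fun s => q + s • (0 : Euc d), fun _ => 0, fun b _ => ac_line q 0 b 0, by simp, ?_, rfl⟩
  simp only [smul_zero, add_zero]
  exact (exp_intOn hl).mul_const _

lemma DV_bdd (hH : TonelliHam H) {a lam : ℝ} (hl : 0 < lam) (q : Euc d) :
    BddBelow (DV H a lam q) := by
  obtain ⟨B, hB, hb⟩ := leg_super hH 0 le_rfl
  refine ⟨∫ s in Iic (0:ℝ), Real.exp (lam * s) * (-B + a), ?_⟩
  rintro r ⟨γ, γ', -, -, hi, rfl⟩
  apply setIntegral_mono ((exp_intOn hl).mul_const _) hi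
  intro s
  have := hb (γ s) (γ' s)
  have : -B + a ≤ LegendreL H (γ s, γ' s) + a := by linarith
  simp only
  gcongr

lemma shift_int {G : ℝ → ℝ} {t : ℝ} : (IntegrableOn (fun s => G (s + t)) (Iic (-t)) volume ↔
    IntegrableOn G (Iic 0) volume) ∧ ∫ s in Iic (-t), G (s + t) = ∫ s in Iic (0:ℝ), G s := by
  have hmp : MeasurePreserving (fun s : ℝ => s + t) volume volume := measurePreserving_add_right volume t
  have he : MeasurableEmbedding (fun s : ℝ => s + t) := measurableEmbedding_addRight t
  have hpre : (fun s : ℝ => s + t) ⁻¹' (Iic 0) = Iic (-t) := by ext s; simp [le_neg_iff_add_nonpos_right]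
  constructor
  · rw [← hpre]; exact hmp.integrableOn_comp_preimage he
  · rw [← hpre]; exact hmp.setIntegral_preimage_emb he G _

lemma D1 (hH : TonelliHam H) {a lam : ℝ} (hl : 0 < lam) {w : Euc d → ℝ} (hw : DSol H a lam w)
    {t : ℝ} (ht : 0 ≤ t) {γ γ' : ℝ → Euc d} (hγ : ACOn γ γ' (-t) 0)
    (hi : IntervalIntegrable (fun s => Real.exp (lam * s) * (LegendreL H (γ s, γ' s) + a))
       volume (-t) 0) :
    w (γ 0) ≤ Real.exp (-(lam * t)) * w (γ (-t)) +
      ∫ s in (-t)..0, Real.exp (lam * s) * (LegendreL H (γ s, γ' s) + a) := by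
  set I := ∫ s in (-t)..0, Real.exp (lam * s) * (LegendreL H (γ s, γ' s) + a) with hI
  have key : ∀ r ∈ DV H a lam (γ (-t)), w (γ 0) ≤ Real.exp (-(lam * t)) * r + I := by
    rintro r ⟨σ, σ', hσ, hσ0, hσi, rfl⟩
    rw [hw]
    refine csInf_le (DV_bdd hH hl _) ?_
    set c : ℝ → Euc d := fun s => if s ≤ -t then σ (s + t) else γ s with hc
    set c' : ℝ → Euc d := fun s => if s ≤ -t then σ' (s + t) else γ' s with hc'
    have hc1 : ∀ s ≤ -t, c s = σ (s + t) := fun s hs => by simp [hc, hs]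
    have hc2 : ∀ s, -t ≤ s → c s = γ s := fun s hs => by
      rcases hs.lt_or_eq with h | h
      · simp [hc, not_le.2 h]
      · subst h; simp [hc, hσ0]
    have hc'1 : ∀ s ≤ -t, c' s = σ' (s + t) := fun s hs => by simp [hc', hs]
    have hc'2 : ∀ s, -t < s → c' s = γ' s := fun s hs => by simp [hc', not_le.2 hs]
    have hac0 : ACOn c c' (-t) 0 := ac_congr (by linarith) hγ (fun s hs => hc2 s hs.1)
      (fun s hs => hc'2 s hs.1)
    obtain ⟨G, hG⟩ : ∃ G : ℝ → ℝ, G = fun r => Real.exp (-(lam * t)) *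
      (Real.exp (lam * r) * (LegendreL H (σ r, σ' r) + a)) := ⟨_, rfl⟩
    have e1 : ∀ s ∈ Iic (-t), Real.exp (lam * s) * (LegendreL H (c s, c' s) + a) = G (s + t) := by
      intro s hs
      rw [hc1 s hs, hc'1 s hs, hG]
      simp only
      rw [← mul_assoc, ← Real.exp_add]; congr 2; ring
    have e2 : ∀ s ∈ Ioc (-t) 0, Real.exp (lam * s) * (LegendreL H (c s, c' s) + a) =
        Real.exp (lam * s) * (LegendreL H (γ s, γ' s) + a) := by
      intro s hs
      rw [hc2 s hs.1.le, hc'2 s hs.1]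
    have j1 : IntegrableOn (fun s => Real.exp (lam * s) * (LegendreL H (c s, c' s) + a)) (Iic (-t)) volume := by
      rw [integrableOn_congr_fun e1 measurableSet_Iic, shift_int.1, hG]
      exact hσi.const_mul _
    have j2 : IntegrableOn (fun s => Real.exp (lam * s) * (LegendreL H (c s, c' s) + a)) (Ioc (-t) 0) volume := by
      rw [integrableOn_congr_fun e2 measurableSet_Ioc]
      rwa [intervalIntegrable_iff_integrableOn_Ioc_of_le (by linarith)] at hi
    have hun : Iic (0:ℝ) = Iic (-t) ∪ Ioc (-t) 0 := (Iic_union_Ioc_eq_Iic (by linarith)).symm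
    refine ⟨c, c', ?_, hc2 0 (by linarith), ?_, ?_⟩
    · intro b hb
      rcases le_total (-t) b with h | h
      · exact ac_sub hac0 h hb le_rfl
      · refine ac_join ?_ hac0 h (by linarith)
        have := ac_shift (hσ (b + t) (by linarith)) t
        rw [add_sub_cancel_right, zero_sub] at this
        exact ac_congr h this (fun s hs => hc1 s hs.2) (fun s hs => hc'1 s hs.2)
    · rw [hun]; exact j1.union j2
    · have hs : ∫ s in Iic (0:ℝ), Real.exp (lam * s) * (LegendreL H (c s, c' s) + a) =
          (∫ s in Iic (-t), G (s + t)) + I := by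
        rw [hun, setIntegral_union (by
          rw [disjoint_left]; intro s h1 h2; exact absurd h1 (not_le.2 h2.1)) measurableSet_Ioc j1 j2,
          setIntegral_congr_fun measurableSet_Iic e1, setIntegral_congr_fun measurableSet_Ioc e2,
          hI, intervalIntegral.integral_of_le (by linarith)]
      rw [hs, shift_int.2, hG, integral_const_mul]
  have h2 : (w (γ 0) - I) * Real.exp (lam * t) ≤ w (γ (-t)) := by
    rw [hw (γ (-t))]
    refine le_csInf (DV_ne hl _) fun r hr => ?_
    have := key r hr
    rw [Real.exp_neg] at this
    have hpos := Real.exp_pos (lam * t)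
    rw [← sub_le_iff_le_add, ← div_eq_inv_mul, le_div_iff₀ hpos] at this
    exact this
  rw [Real.exp_neg, ← sub_le_iff_le_add, ← div_eq_inv_mul, le_div_iff₀ (Real.exp_pos _)]
  exact h2

lemma D2' (hH : TonelliHam H) {a lam : ℝ} (hl : 0 < lam) {w : Euc d → ℝ} (hw : DSol H a lam w)
    {t : ℝ} (ht : 0 ≤ t) (q : Euc d) {η : ℝ} (hη : 0 < η) : ∃ γ γ' : ℝ → Euc d,
    ACOn γ γ' (-t) 0 ∧ γ 0 = q ∧
    IntervalIntegrable (fun s => Real.exp (lam * s) * (LegendreL H (γ s, γ' s) + a))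
       volume (-t) 0 ∧
    Real.exp (-(lam * t)) * w (γ (-t)) +
      ∫ s in (-t)..0, Real.exp (lam * s) * (LegendreL H (γ s, γ' s) + a) ≤ w q + η := by
  obtain ⟨r, ⟨γ, γ', hγ, hγ0, hi, rfl⟩, hr⟩ := exists_lt_of_csInf_lt (DV_ne (H := H) (a := a) hl q)
    (show sInf (DV H a lam q) < w q + η by rw [hw q]; linarith)
  have hun : Iic (0:ℝ) = Iic (-t) ∪ Ioc (-t) 0 := (Iic_union_Ioc_eq_Iic (by linarith)).symm
  have j1 := hi.mono_set (show Iic (-t) ⊆ Iic (0:ℝ) from Iic_subset_Iic.2 (by linarith))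
  have j2 := hi.mono_set (show Ioc (-t) 0 ⊆ Iic (0:ℝ) from Ioc_subset_Iic_self)
  refine ⟨γ, γ', hγ _ (by linarith), hγ0, ?_, ?_⟩
  · rwa [intervalIntegrable_iff_integrableOn_Ioc_of_le (by linarith)]
  · rw [hun, setIntegral_union (by
        rw [disjoint_left]; intro s h1 h2; exact absurd h1 (not_le.2 h2.1)) measurableSet_Ioc j1 j2] at hr
    obtain ⟨G, hG⟩ : ∃ G : ℝ → ℝ, G = fun r => Real.exp (-(lam * t)) *
      (Real.exp (lam * r) * (LegendreL H (γ (r - t), γ' (r - t)) + a)) := ⟨_, rfl⟩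
    have e1 : ∀ s ∈ Iic (-t), Real.exp (lam * s) * (LegendreL H (γ s, γ' s) + a) = G (s + t) := by
      intro s hs
      rw [hG]
      simp only
      rw [← mul_assoc, ← Real.exp_add, add_sub_cancel_right]; congr 2; ring
    rw [integrableOn_congr_fun e1 measurableSet_Iic, shift_int.1, hG] at j1
    have j1' := j1.const_mul (Real.exp (lam * t))
    simp only [← mul_assoc, ← Real.exp_add] at j1'
    rw [setIntegral_congr_fun measurableSet_Iic e1, shift_int.2, hG, integral_const_mul] at hr
    have : w (γ (-t)) ≤ ∫ r in Iic (0:ℝ), Real.exp (lam * r) * (LegendreL H (γ (r - t), γ' (r - t)) + a) := by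
      rw [hw]
      refine csInf_le (DV_bdd hH hl _) ⟨fun r => γ (r - t), fun r => γ' (r - t), ?_, by simp, ?_, rfl⟩
      · intro b hb
        have := ac_shift (ac_sub (hγ (b - t) (by linarith)) le_rfl (show b - t ≤ -t by linarith) (by linarith)) (-t)
        simpa [sub_eq_add_neg] using this
      · simpa [IntegrableOn] using j1'
    rw [intervalIntegral.integral_of_le (by linarith)]
    have := mul_le_mul_of_nonneg_left this (Real.exp_pos (-(lam * t))).le
    linarith

end K5

namespace K5
variable {d : ℕ} {H : Phase d → ℝ}

def Dom (H : Phase d → ℝ) (a lam C M : ℝ) (w : Euc d → ℝ) : Prop :=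
  ∀ x v τ, ‖v‖ ≤ M → 0 ≤ τ → τ ≤ 1 →
    w x ≤ Real.exp (-(lam * τ)) * w (x - τ • v) + τ * (LegendreL H (x, v) + a) + C * τ ^ 2

def Step (H : Phase d → ℝ) (a lam C M : ℝ) (w : Euc d → ℝ) : Prop :=
  ∀ x τ, 0 < τ → τ ≤ 1 → ∃ v, ‖v‖ ≤ M ∧
    Real.exp (-(lam * τ)) * w (x - τ • v) + τ * (LegendreL H (x, v) + a) ≤ w x + C * τ ^ 2

lemma exp_bd {lam t s : ℝ} (hl : 0 ≤ lam) (hs : s ∈ Icc (-t) 0) :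
    1 - lam * t ≤ Real.exp (lam * s) ∧ Real.exp (lam * s) ≤ 1 := by
  constructor
  · have := Real.add_one_le_exp (lam * s)
    linarith [mul_le_mul_of_nonneg_left hs.1 hl]
  · rw [Real.exp_le_one_iff]; exact mul_nonpos_of_nonneg_of_nonpos hl hs.2

lemma dom_of (hH : TonelliHam H) (a M : ℝ) : ∃ C : ℝ, 0 < C ∧ ∀ lam w, 0 < lam → lam ≤ 1 →
    DSol H a lam w → Dom H a lam C M w := by
  obtain ⟨C1, hC1, h1⟩ := leg_lip hH M
  obtain ⟨C2, hC2, h2⟩ := leg_abs hH M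
  refine ⟨C1 * |M| + (C2 + |a|), by positivity, fun lam w hl hl1 hw x v τ hv h0 hτ1 => ?_⟩
  have hcont : Continuous fun s : ℝ => LegendreL H (x + s • v, v) := by
    have : LipschitzWith C1.toNNReal fun y => LegendreL H (y, v) := by
      apply LipschitzWith.of_dist_le_mul
      intro y z
      rw [Real.dist_eq, dist_eq_norm, Real.coe_toNNReal _ hC1.le]
      exact h1 z y v hv
    exact this.continuous.comp (by fun_prop)
  have hc2 : Continuous fun s : ℝ => Real.exp (lam * s) * (LegendreL H (x + s • v, v) + a) := by
    fun_prop
  have := D1 hH hl hw h0 (ac_line x v (-τ) 0) (hc2.intervalIntegrable _ _)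
  simp only [zero_smul, add_zero, neg_smul] at this
  rw [← sub_eq_add_neg] at this
  have hI : ∫ s in (-τ)..0, Real.exp (lam * s) * (LegendreL H (x + s • v, v) + a) ≤
      ∫ s in (-τ)..0, ((LegendreL H (x, v) + a) + (C1 * |M| + (C2 + |a|)) * τ) := by
    apply intervalIntegral.integral_mono_on (by linarith) (hc2.intervalIntegrable _ _)
      (by simp)
    intro s hs
    have hb := exp_bd hl.le hs
    have l1 := h1 x (x + s • v) v hv
    have l2 := h2 (x + s • v) v hv
    have l3 : ‖x + s • v - x‖ ≤ τ * |M| := by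
      rw [add_sub_cancel_left, norm_smul, Real.norm_eq_abs, abs_of_nonpos hs.2]
      have := hv.trans (le_abs_self M)
      have := hs.1
      gcongr; linarith
    have l4 : C1 * ‖x + s • v - x‖ ≤ C1 * (τ * |M|) := by gcongr
    have l5 := (abs_le.1 l1).2
    have l6 : |LegendreL H (x + s • v, v) + a| ≤ C2 + |a| := (abs_add_le _ _).trans (by linarith)
    have l7 : (1 - Real.exp (lam * s)) * -(LegendreL H (x + s • v, v) + a) ≤ τ * (C2 + |a|) := by
      have h3 : -(LegendreL H (x + s • v, v) + a) ≤ C2 + |a| := by linarith [(abs_le.1 l6).1]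
      have h4 : 1 - Real.exp (lam * s) ≤ τ := by linarith [hb.1, mul_le_of_le_one_left h0 hl1]
      calc _ ≤ (1 - Real.exp (lam * s)) * (C2 + |a|) := by
            apply mul_le_mul_of_nonneg_left h3; linarith [hb.2]
        _ ≤ _ := by gcongr
    linarith
  rw [intervalIntegral.integral_const] at hI
  simp only [smul_eq_mul, zero_sub, neg_neg] at hI
  linarith

lemma lip_of (hH : TonelliHam H) (a C0 : ℝ) (hC0 : 0 ≤ C0) : ∃ Λ : ℝ, 0 < Λ ∧ ∀ lam w, 0 < lam → lam ≤ 1 →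
    DSol H a lam w → (∀ x, |w x| ≤ C0) → ∀ x y, w x - w y ≤ Λ * ‖x - y‖ := by
  obtain ⟨C, hC, hD⟩ := dom_of hH a 1
  obtain ⟨C2, hC2, h2⟩ := leg_abs hH 1
  refine ⟨2 * C0 + C0 + C2 + |a| + C, by positivity, fun lam w hl hl1 hw hb x y => ?_⟩
  have bx := abs_le.1 (hb x)
  have by' := abs_le.1 (hb y)
  rcases eq_or_ne x y with rfl | hxy
  · simp
  have hn : 0 < ‖x - y‖ := norm_pos_iff.2 (sub_ne_zero.2 hxy)
  rcases le_total ‖x - y‖ 1 with h | h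
  · have := hD lam w hl hl1 hw x (‖x - y‖⁻¹ • (x - y)) ‖x - y‖ (by
      rw [norm_smul, norm_inv, norm_norm]; field_simp; exact le_rfl) hn.le h
    rw [smul_smul, mul_inv_cancel₀ hn.ne', one_smul, sub_sub_cancel] at this
    have l1 := abs_le.1 (h2 x (‖x - y‖⁻¹ • (x - y)) (by
      rw [norm_smul, norm_inv, norm_norm]; field_simp; exact le_rfl))
    have e := exp_bd hl.le (show -‖x - y‖ ∈ Icc (-‖x-y‖) 0 from ⟨le_rfl, by linarith⟩)
    rw [mul_neg] at e
    have e2 : Real.exp (-(lam * ‖x - y‖)) * w y ≤ w y + ‖x - y‖ * C0 := by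
      have : (1 - Real.exp (-(lam * ‖x - y‖))) * (-w y) ≤ ‖x - y‖ * C0 := by
        have h3 : 1 - Real.exp (-(lam * ‖x - y‖)) ≤ ‖x - y‖ := by linarith [mul_le_of_le_one_left hn.le hl1]
        calc _ ≤ (1 - Real.exp (-(lam * ‖x - y‖))) * C0 := by
              apply mul_le_mul_of_nonneg_left (by linarith); linarith
          _ ≤ _ := by gcongr
      linarith
    have e3 : ‖x - y‖ * (LegendreL H (x, ‖x - y‖⁻¹ • (x - y)) + a) ≤ ‖x - y‖ * (C2 + |a|) := by
      gcongr
      · exact l1.2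
      · exact le_abs_self a
    have e4 : C * ‖x - y‖ ^ 2 ≤ C * ‖x - y‖ := by
      gcongr; rw [sq]; exact mul_le_of_le_one_left hn.le h
    linarith [mul_nonneg hC0 hn.le]
  · have : 0 ≤ (C0 + C2 + |a| + C) * ‖x - y‖ := by positivity
    linarith [mul_le_mul_of_nonneg_left h hC0]

lemma step_of (hH : TonelliHam H) (a C0 : ℝ) (hC0 : 0 ≤ C0) : ∃ C M : ℝ, 0 < C ∧ 0 < M ∧
    ∀ lam w, 0 < lam → lam ≤ 1 →
    DSol H a lam w → (∀ x, |w x| ≤ C0) → Step H a lam C M w := by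
  obtain ⟨Λ, hΛ, hlip⟩ := lip_of hH a C0 hC0
  obtain ⟨B, hB, hsup⟩ := leg_super hH (Real.exp 1 * (Λ + 1)) (by positivity)
  set M := C0 + (B + |a|) + 1 with hM
  have hM0 : 0 < M := by positivity
  obtain ⟨R, hR, hRb⟩ := leg_bound hH M
  obtain ⟨CH, _, hCH, -, hb⟩ := bounds hH R
  refine ⟨CH * M + R * M + (CH + |a| + CH * M) + 1, M, by positivity, hM0, ?_⟩
  intro lam w hl hl1 hw hwb x τ hτ hτ1
  obtain ⟨γ, γ', hac, hγ0, hi, hle⟩ := D2' hH hl hw hτ.le x (show (0:ℝ) < τ ^ 2 by positivity)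
  have hdiff := ac_diff hac le_rfl (show -τ ≤ 0 by linarith) le_rfl
  rw [hγ0] at hdiff
  have hnint : IntervalIntegrable (fun s => ‖γ' s‖) volume (-τ) 0 := hac.1.norm
  set N := ∫ s in (-τ)..0, ‖γ' s‖ with hN
  have hdN : ‖x - γ (-τ)‖ ≤ N := by
    rw [hdiff]; exact intervalIntegral.norm_integral_le_integral_norm (by linarith)
  have hN0 : 0 ≤ N := (norm_nonneg _).trans hdN
  have hew : Real.exp (-(lam * τ)) * w (γ (-τ)) ≥ w (γ (-τ)) - τ * C0 := by
    have e := exp_bd hl.le (show -τ ∈ Icc (-τ) 0 from ⟨le_rfl, by linarith⟩)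
    rw [mul_neg] at e
    have h3 : 1 - Real.exp (-(lam * τ)) ≤ τ := by linarith [mul_le_of_le_one_left hτ.le hl1]
    have h4 := abs_le.1 (hwb (γ (-τ)))
    have : (1 - Real.exp (-(lam * τ))) * w (γ (-τ)) ≤ τ * C0 := by
      calc _ ≤ (1 - Real.exp (-(lam * τ))) * C0 := by
            apply mul_le_mul_of_nonneg_left (by linarith); linarith
        _ ≤ _ := by gcongr
    linarith
  -- speed bound
  have hNM : N ≤ M * τ := by
    have m1 : ∫ s in (-τ)..0, ((Λ + 1) * ‖γ' s‖ - (B + |a|)) ≤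
        ∫ s in (-τ)..0, Real.exp (lam * s) * (LegendreL H (γ s, γ' s) + a) := by
      apply intervalIntegral.integral_mono_on (by linarith) ((hnint.const_mul _).sub (by simp)) hi
      intro s hs
      have hb := exp_bd hl.le hs
      have h1 := hsup (γ s) (γ' s)
      have h2 : Real.exp (-1) ≤ Real.exp (lam * s) := by
        apply Real.exp_le_exp.2; linarith [hs.1, mul_le_mul_of_nonpos_right hl1 hs.2]
      have h3 : Real.exp (lam * s) * (Real.exp 1 * (Λ + 1) * ‖γ' s‖ - (B + |a|)) ≤
          Real.exp (lam * s) * (LegendreL H (γ s, γ' s) + a) := by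
        apply mul_le_mul_of_nonneg_left _ (Real.exp_pos _).le
        linarith [neg_abs_le a]
      have h4 : (1:ℝ) ≤ Real.exp (lam * s) * Real.exp 1 := by
        rw [← Real.exp_add]; apply Real.one_le_exp; linarith [hs.1, mul_le_mul_of_nonpos_right hl1 hs.2]
      have h5 : 1 * ((Λ + 1) * ‖γ' s‖) ≤ Real.exp (lam * s) * Real.exp 1 * ((Λ + 1) * ‖γ' s‖) := by
        gcongr
      have h6 : Real.exp (lam * s) * (B + |a|) ≤ 1 * (B + |a|) := by
        have := hb.2; gcongr
      linarith
    rw [intervalIntegral.integral_sub (hnint.const_mul _) (by simp), intervalIntegral.integral_const_mul,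
      intervalIntegral.integral_const] at m1
    simp only [smul_eq_mul, zero_sub, neg_neg] at m1
    have m2 := hlip lam w hl hl1 hw hwb x (γ (-τ))
    have m3 : Λ * ‖x - γ (-τ)‖ ≤ Λ * N := by gcongr
    have m4 : τ ^ 2 ≤ τ := by rw [sq]; exact mul_le_of_le_one_left hτ.le hτ1
    rw [hM]; linarith
  -- the mean velocity
  set v := τ⁻¹ • (x - γ (-τ)) with hv
  have hvM : ‖v‖ ≤ M := by
    rw [hv, norm_smul, Real.norm_of_nonneg (by positivity), ← div_eq_inv_mul, div_le_iff₀ hτ]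
    linarith
  have hτv : τ • v = x - γ (-τ) := by rw [hv, smul_smul, mul_inv_cancel₀ hτ.ne', one_smul]
  refine ⟨v, hvM, ?_⟩
  rw [hτv, sub_sub_cancel]
  obtain ⟨p, hp, hL⟩ := leg_max hH x v
  have hpR := hRb x v p hvM hp
  have hHb := hb (x, p) hpR
  have hpint : IntervalIntegrable (fun s => ⟪p, γ' s⟫) volume (-τ) 0 :=
    ⟨(innerSL ℝ p).integrable_comp hac.1.1, (innerSL ℝ p).integrable_comp hac.1.2⟩
  have hpi : ∫ s in (-τ)..0, ⟪p, γ' s⟫ = τ * ⟪p, v⟫ := by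
    have := (innerSL ℝ p).intervalIntegral_comp_comm hac.1
    simp only [innerSL_apply_apply] at this
    rw [this, ← hdiff, ← hτv, inner_smul_right]
  have m1 : ∫ s in (-τ)..0, ((⟪p, γ' s⟫ - τ * R * ‖γ' s‖) + (- H (x, p) + a - CH * (M * τ) -
        τ * (CH + |a| + CH * M))) ≤
      ∫ s in (-τ)..0, Real.exp (lam * s) * (LegendreL H (γ s, γ' s) + a) := by
    apply intervalIntegral.integral_mono_on (by linarith)
      ((hpint.sub (hnint.const_mul _)).add (by simp)) hi
    intro s hs
    have he := exp_bd hl.le hs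
    have h1 := fenchel hH (γ s) (γ' s) p
    have h2 : ‖γ s - x‖ ≤ M * τ := by
      rw [← hγ0, norm_sub_rev, ac_diff hac hs.1 hs.2 le_rfl]
      refine (intervalIntegral.norm_integral_le_integral_norm hs.2).trans (le_trans ?_ hNM)
      apply intervalIntegral.integral_mono_interval hs.1 hs.2 le_rfl _ hnint
      exact Eventually.of_forall fun _ => norm_nonneg _
    have h3 := abs_le.1 (H_lip hH (fun z hz => (hb z hz).2.1) x (γ s) p hpR)
    have h4 : CH * ‖γ s - x‖ ≤ CH * (M * τ) := by gcongr
    set g := ⟪p, γ' s⟫ - H (x, p) + a - CH * (M * τ) with hg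
    have h5 : g ≤ LegendreL H (γ s, γ' s) + a := by linarith
    have h6 : g ≤ R * ‖γ' s‖ + (CH + |a| + CH * M) := by
      have i1 := (abs_le.1 (abs_real_inner_le_norm p (γ' s))).2
      have i2 : ‖p‖ * ‖γ' s‖ ≤ R * ‖γ' s‖ := by gcongr
      have i3 := (abs_le.1 hHb.1).1
      have i4 : 0 ≤ CH * (M * τ) := by positivity
      have i5 : 0 ≤ CH * M := by positivity
      linarith [le_abs_self a]
    have h7 : Real.exp (lam * s) * g ≤ Real.exp (lam * s) * (LegendreL H (γ s, γ' s) + a) :=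
      mul_le_mul_of_nonneg_left h5 (Real.exp_pos _).le
    have h8 : (1 - Real.exp (lam * s)) * g ≤ τ * (R * ‖γ' s‖ + (CH + |a| + CH * M)) := by
      calc _ ≤ (1 - Real.exp (lam * s)) * (R * ‖γ' s‖ + (CH + |a| + CH * M)) := by
            apply mul_le_mul_of_nonneg_left h6; linarith [he.2]
        _ ≤ _ := by
            have h9 : lam * τ ≤ 1 * τ := by gcongr
            have h10 : 1 - Real.exp (lam * s) ≤ τ := by linarith [he.1]
            gcongr
    have h11 : Real.exp (lam * s) * g = g - (1 - Real.exp (lam * s)) * g := by ring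
    linarith
  rw [intervalIntegral.integral_add (hpint.sub (hnint.const_mul _)) (by simp),
    intervalIntegral.integral_sub hpint (hnint.const_mul _), hpi,
    intervalIntegral.integral_const_mul, intervalIntegral.integral_const] at m1
  simp only [smul_eq_mul, zero_sub, neg_neg] at m1
  rw [← hN] at m1
  rw [hL]
  have m2 : τ * R * N ≤ τ * R * (M * τ) := by gcongr
  linarith

end K5

namespace K5
variable {d : ℕ} {H : Phase d → ℝ}

/-- `u` is approximated by discounted solutions. -/
def Appr (H : Phase d → ℝ) (a : ℝ) (u : Euc d → ℝ) : Prop :=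
  ∀ δ > (0:ℝ), ∃ lam w, 0 < lam ∧ lam ≤ δ ∧ lam ≤ 1 ∧ DSol H a lam w ∧ ∀ x, |w x - u x| ≤ δ

lemma exp_int {lam t : ℝ} {f : ℝ → ℝ} (hf : IntervalIntegrable f volume (-t) 0) :
    IntervalIntegrable (fun s => Real.exp (lam * s) * f s) volume (-t) 0 :=
  hf.continuousOn_mul (by fun_prop)

lemma appr_lb (hH : TonelliHam H) {a C0 : ℝ} {u : Euc d → ℝ} (hA : Appr H a u) (hu : ∀ x, |u x| ≤ C0)
    {t : ℝ} (ht : 0 < t) {γ γ' : ℝ → Euc d} (hγ : ACOn γ γ' (-t) 0)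
    (hi : IntervalIntegrable (fun s => LegendreL H (γ s, γ' s) + a) volume (-t) 0) :
    u (γ 0) ≤ u (γ (-t)) + ∫ s in (-t)..0, (LegendreL H (γ s, γ' s) + a) := by
  set f : ℝ → ℝ := fun s => LegendreL H (γ s, γ' s) + a with hf
  have hC0 : 0 ≤ C0 := (abs_nonneg _).trans (hu 0)
  set J := ∫ s in (-t)..0, |f s| with hJ
  have hJ0 : 0 ≤ J := intervalIntegral.integral_nonneg (by linarith) fun s _ => abs_nonneg _
  have key : ∀ δ > (0:ℝ), u (γ 0) ≤ u (γ (-t)) + (∫ s in (-t)..0, f s) + δ * (2 + t * (C0) + t * J) := by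
    intro δ hδ
    obtain ⟨lam, w, hl, hlδ, hl1, hw, hwu⟩ := hA δ hδ
    have h1 := D1 hH hl hw ht.le hγ (exp_int hi)
    have h2 : ∫ s in (-t)..0, Real.exp (lam * s) * f s ≤ ∫ s in (-t)..0, (f s + lam * t * |f s|) := by
      apply intervalIntegral.integral_mono_on (by linarith) (exp_int hi) (hi.add (hi.abs.const_mul _))
      intro s hs
      have hb := exp_bd hl.le hs
      have h3 : (1 - Real.exp (lam * s)) * (- f s) ≤ lam * t * |f s| := by
        calc _ ≤ (1 - Real.exp (lam * s)) * |f s| := by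
              apply mul_le_mul_of_nonneg_left (neg_le_abs _); linarith
          _ ≤ _ := by gcongr; linarith
      linarith
    rw [intervalIntegral.integral_add hi (hi.abs.const_mul _), intervalIntegral.integral_const_mul, ← hJ] at h2
    have h4 := abs_le.1 (hwu (γ 0))
    have h5 := abs_le.1 (hwu (γ (-t)))
    have e := exp_bd hl.le (show -t ∈ Icc (-t) 0 from ⟨le_rfl, by linarith⟩)
    rw [mul_neg] at e
    have h6 : Real.exp (-(lam * t)) * w (γ (-t)) ≤ u (γ (-t)) + δ + lam * t * C0 := by
      have i1 : Real.exp (-(lam * t)) * w (γ (-t)) ≤ Real.exp (-(lam * t)) * (u (γ (-t)) + δ) :=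
        mul_le_mul_of_nonneg_left (by linarith) (Real.exp_pos _).le
      have i2 : Real.exp (-(lam * t)) * δ ≤ 1 * δ := by have := e.2; gcongr
      have i3 : (1 - Real.exp (-(lam * t))) * (-u (γ (-t))) ≤ lam * t * C0 := by
        have := (abs_le.1 (hu (γ (-t)))).1
        calc _ ≤ (1 - Real.exp (-(lam * t))) * C0 := by
              apply mul_le_mul_of_nonneg_left (by linarith); linarith
          _ ≤ _ := by gcongr; linarith
      linarith
    have h7 : lam * t * C0 ≤ δ * t * C0 := by gcongr
    have h8 : lam * t * J ≤ δ * t * J := by gcongr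
    linarith
  by_contra hcon
  push Not at hcon
  set D := 2 + t * C0 + t * J
  have hD : 0 < D := by positivity
  set g := u (γ 0) - (u (γ (-t)) + ∫ s in (-t)..0, f s)
  have hg : 0 < g := sub_pos.2 hcon
  have := key (g / (2 * D)) (by positivity)
  have e : g / (2 * D) * D = g / 2 := by field_simp
  rw [e] at this
  linarith

lemma appr_ub (hH : TonelliHam H) {a C0 : ℝ} {u : Euc d → ℝ} (hA : Appr H a u) (hu : ∀ x, |u x| ≤ C0)
    {t : ℝ} (ht : 0 < t) (q : Euc d) {η : ℝ} (hη : 0 < η) : ∃ γ γ' : ℝ → Euc d, ACOn γ γ' (-t) 0 ∧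
    γ 0 = q ∧ IntervalIntegrable (fun s => LegendreL H (γ s, γ' s) + a) volume (-t) 0 ∧
    u (γ (-t)) + ∫ s in (-t)..0, (LegendreL H (γ s, γ' s) + a) ≤ u q + η := by
  have hC0 : 0 ≤ C0 := (abs_nonneg _).trans (hu 0)
  obtain ⟨B0, hB0, hb⟩ := leg_super hH 0 le_rfl
  set B := B0 + |a| with hB
  have hBp : 0 < B := by positivity
  set D := 3 + 2 * t * (C0 + 2 + B * t) with hD
  have hDp : 0 < D := by positivity
  set δ := min (min 1 (1 / t)) (η / D) with hδ
  have hδ0 : 0 < δ := by positivity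
  have hδ1 : δ ≤ 1 := (min_le_left _ _).trans (min_le_left _ _)
  have hδt : δ * t ≤ 1 := by
    have : δ ≤ 1 / t := (min_le_left _ _).trans (min_le_right _ _)
    rwa [le_div_iff₀ ht] at this
  have hδη : δ * D ≤ η := by
    have : δ ≤ η / D := min_le_right _ _
    rwa [le_div_iff₀ hDp] at this
  obtain ⟨lam, w, hl, hlδ, hl1, hw, hwu⟩ := hA δ hδ0
  obtain ⟨γ, γ', hac, h0, hi, hle⟩ := D2' hH hl hw ht.le q hδ0
  set f : ℝ → ℝ := fun s => LegendreL H (γ s, γ' s) + a with hf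
  have hfi : IntervalIntegrable f volume (-t) 0 := by
    have := exp_int (lam := -lam) hi
    refine this.congr (fun s _ => ?_)
    change Real.exp (-lam * s) * (Real.exp (lam * s) * f s) = f s
    rw [← mul_assoc, ← Real.exp_add]; simp
  refine ⟨γ, γ', hac, h0, hfi, ?_⟩
  have m1 : ∫ s in (-t)..0, (f s + B) ≤ ∫ s in (-t)..0, Real.exp (lam * t) * (Real.exp (lam * s) * f s + B) := by
    apply intervalIntegral.integral_mono_on (by linarith) (hfi.add (by simp))
      ((hi.add (by simp)).const_mul _)
    intro s hs
    have he := exp_bd hl.le hs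
    have hfB : 0 ≤ f s + B := by
      have := hb (γ s) (γ' s); simp only [hf, hB]; linarith [neg_abs_le a]
    have i1 : 1 ≤ Real.exp (lam * t) * Real.exp (lam * s) := by
      rw [← Real.exp_add]; apply Real.one_le_exp; linarith [mul_le_mul_of_nonneg_left hs.1 hl.le]
    have i2 : 1 * (f s + B) ≤ Real.exp (lam * t) * Real.exp (lam * s) * (f s + B) := by gcongr
    have i3 : Real.exp (lam * t) * (Real.exp (lam * s) * B) ≤ Real.exp (lam * t) * (1 * B) := by
      have := he.2; gcongr
    linarith
  rw [intervalIntegral.integral_const_mul, intervalIntegral.integral_add hfi (by simp),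
    intervalIntegral.integral_add hi (by simp), intervalIntegral.integral_const] at m1
  simp only [smul_eq_mul, zero_sub, neg_neg] at m1
  have m2 : Real.exp (lam * t) * (Real.exp (-(lam * t)) * w (γ (-t))) = w (γ (-t)) := by
    rw [← mul_assoc, ← Real.exp_add]; simp
  have m3 := mul_le_mul_of_nonneg_left hle (Real.exp_pos (lam * t)).le
  set E := Real.exp (lam * t) with hE
  have hlt : lam * t ≤ δ * t := by gcongr
  have m4 : E - 1 ≤ 2 * (δ * t) := by
    have := Real.abs_exp_sub_one_le (x := lam * t) (by rw [abs_of_pos (by positivity)]; linarith)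
    rw [abs_of_pos (a := lam * t) (by positivity)] at this
    linarith [(abs_le.1 this).2]
  have m5 : 1 ≤ E := Real.one_le_exp (by positivity)
  have h4 := abs_le.1 (hwu q)
  have h5 := abs_le.1 (hwu (γ (-t)))
  have h6 := abs_le.1 (hu q)
  have m6 : (E - 1) * (w q + δ + t * B) ≤ 2 * (δ * t) * (C0 + 2 + B * t) := by
    calc _ ≤ (E - 1) * (C0 + 2 + B * t) := by
          apply mul_le_mul_of_nonneg_left (by linarith); linarith
      _ ≤ _ := by gcongr
  rw [hD] at hδη
  linarith

lemma weakKAM_of (hH : TonelliHam H) {C0 : ℝ} {u : Euc d → ℝ} (hA : Appr H (maneCritical H) u)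
    (hu : ∀ x, |u x| ≤ C0) (hc : Continuous u) (hp : PerFun u) : IsWeakKAM H u := by
  refine ⟨hc, hp, fun t ht q => ?_⟩
  have hset : ∀ r, r ∈ LOvals (LegendreL H) 0 (maneCritical H) 0 u t q ↔
      ∃ γ γ' : ℝ → Euc d, ACOn γ γ' (-t) 0 ∧ γ 0 = q ∧
      IntervalIntegrable (fun s => LegendreL H (γ s, γ' s) + maneCritical H) volume (-t) 0 ∧
      r = u (γ (-t)) + ∫ s in (-t)..0, (LegendreL H (γ s, γ' s) + maneCritical H) := by
    intro r; simp [LOvals]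
  have hlb : ∀ r ∈ LOvals (LegendreL H) 0 (maneCritical H) 0 u t q, u q ≤ r := by
    intro r hr
    obtain ⟨γ, γ', hac, h0, hi, rfl⟩ := (hset r).1 hr
    rw [← h0]; exact appr_lb hH hA hu ht hac hi
  have hub : ∀ η > (0:ℝ), ∃ r ∈ LOvals (LegendreL H) 0 (maneCritical H) 0 u t q, r ≤ u q + η := by
    intro η hη
    obtain ⟨γ, γ', hac, h0, hi, hle⟩ := appr_ub hH hA hu ht q hη
    exact ⟨_, (hset _).2 ⟨γ, γ', hac, h0, hi, rfl⟩, hle⟩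
  apply le_antisymm
  · apply le_of_forall_pos_le_add
    intro η hη
    obtain ⟨r, hr, hrle⟩ := hub η hη
    exact (csInf_le ⟨u q, hlb⟩ hr).trans hrle
  · obtain ⟨r, hr, -⟩ := hub 1 one_pos
    exact le_csInf ⟨r, hr⟩ hlb

lemma dom_limit (hH : TonelliHam H) (a M : ℝ) : ∃ C : ℝ, 0 < C ∧ ∀ u C0, Appr H a u → (∀ x, |u x| ≤ C0) →
    Dom H a 0 C M u := by
  obtain ⟨C, hC, h⟩ := dom_of hH a M
  refine ⟨C, hC, fun u C0 hA hu x v τ hv h0 h1 => ?_⟩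
  have hC0 : 0 ≤ C0 := (abs_nonneg _).trans (hu 0)
  simp only [zero_mul, neg_zero, Real.exp_zero, one_mul]
  apply le_of_forall_pos_le_add
  intro ε hε
  obtain ⟨lam, w, hl, hlδ, hl1, hw, hwu⟩ := hA (ε / (C0 + 2)) (by positivity)
  have hd := h lam w hl hl1 hw x v τ hv h0 h1
  have e := exp_bd hl.le (show -τ ∈ Icc (-τ) 0 from ⟨le_rfl, by linarith⟩)
  rw [mul_neg] at e
  set δ := ε / (C0 + 2) with hδ
  have hδε : δ * (C0 + 2) = ε := by rw [hδ]; field_simp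
  have h5 := abs_le.1 (hwu (x - τ • v))
  have h4 := abs_le.1 (hwu x)
  set y := x - τ • v
  have h6 : Real.exp (-(lam * τ)) * w y ≤ u y + δ + δ * C0 := by
    have i1 : Real.exp (-(lam * τ)) * w y ≤ Real.exp (-(lam * τ)) * (u y + δ) :=
      mul_le_mul_of_nonneg_left (by linarith) (Real.exp_pos _).le
    have hδ0 : 0 ≤ δ := by positivity
    have i2 : Real.exp (-(lam * τ)) * δ ≤ 1 * δ := by have := e.2; gcongr
    have i3 : (1 - Real.exp (-(lam * τ))) * (-u y) ≤ δ * C0 := by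
      have := (abs_le.1 (hu y)).1
      calc _ ≤ (1 - Real.exp (-(lam * τ))) * C0 := by
            apply mul_le_mul_of_nonneg_left (by linarith); linarith
        _ ≤ _ := by
            have : lam * τ ≤ δ * 1 := by gcongr
            gcongr; linarith
    linarith
  linarith

lemma step_limit (hH : TonelliHam H) (a C0 : ℝ) (hC0 : 0 ≤ C0) : ∃ C M : ℝ, 0 < C ∧ 0 < M ∧
    ∀ u, Appr H a u → (∀ x, |u x| ≤ C0) → Step H a 0 C M u := by
  obtain ⟨C, M, hC, hM, h⟩ := step_of hH a (C0 + 1) (by positivity)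
  refine ⟨C + C0 + 3, M, by positivity, hM, fun u hA hu x τ h0 h1 => ?_⟩
  have hττ : τ ^ 2 ≤ 1 := by exact pow_le_one₀ h0.le h1
  obtain ⟨lam, w, hl, hlδ, hl1, hw, hwu⟩ := hA (τ ^ 2) (by positivity)
  have hw0 : ∀ x, |w x| ≤ C0 + 1 := fun x => by
    have i1 := hu x
    have i2 := hwu x
    calc |w x| = |u x + (w x - u x)| := by ring_nf
      _ ≤ _ := (abs_add_le _ _).trans (by linarith)
  obtain ⟨v, hv, hle⟩ := h lam w hl hl1 hw hw0 x τ h0 h1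
  refine ⟨v, hv, ?_⟩
  simp only [zero_mul, neg_zero, Real.exp_zero, one_mul]
  have e := exp_bd hl.le (show -τ ∈ Icc (-τ) 0 from ⟨le_rfl, by linarith⟩)
  rw [mul_neg] at e
  have h5 := abs_le.1 (hwu (x - τ • v))
  have h4 := abs_le.1 (hwu x)
  set y := x - τ • v
  have i3 : (1 - Real.exp (-(lam * τ))) * w y ≤ τ ^ 2 * (C0 + 1) := by
    have := (abs_le.1 (hw0 y)).2
    calc _ ≤ (1 - Real.exp (-(lam * τ))) * (C0 + 1) := by
          apply mul_le_mul_of_nonneg_left (by linarith); linarith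
      _ ≤ _ := by
          have : lam * τ ≤ τ ^ 2 * 1 := by gcongr
          gcongr; linarith
  linarith

end K5

namespace K5
variable {d : ℕ} {H : Phase d → ℝ}

lemma chain_upper {a lam C M τ : ℝ} {w : Euc d → ℝ} (hl : 0 ≤ lam) (hD : Dom H a lam C M w) (hC : 0 ≤ C)
    (h0 : 0 ≤ τ) (h1 : τ ≤ 1) (y v : ℕ → Euc d) (N : ℕ) (hy : ∀ k < N, y (k+1) = y k - τ • v k)
    (hv : ∀ k < N, ‖v k‖ ≤ M) :
    w (y 0) ≤ Real.exp (-(lam * τ)) ^ N * w (y N) +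
      ∑ k ∈ Finset.range N, Real.exp (-(lam * τ)) ^ k * (τ * (LegendreL H (y k, v k) + a)) + N * (C * τ ^ 2) := by
  set r := Real.exp (-(lam * τ)) with hr
  have hr0 : 0 < r := Real.exp_pos _
  have hr1 : r ≤ 1 := by rw [hr, Real.exp_le_one_iff]; have := mul_nonneg hl (show 0 ≤ τ by linarith); linarith
  induction N with
  | zero => simp
  | succ N ih =>
    have i1 := ih (fun k hk => hy k (by omega)) (fun k hk => hv k (by omega))
    have i2 := hD (y N) (v N) τ (hv N (by omega)) h0 h1
    rw [← hy N (by omega), ← hr] at i2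
    have i3 := mul_le_mul_of_nonneg_left i2 (pow_pos hr0 N).le
    have i4 : r ^ N * (C * τ ^ 2) ≤ 1 * (C * τ ^ 2) := by
      gcongr; exact pow_le_one₀ hr0.le hr1
    rw [Finset.sum_range_succ, pow_succ]
    push_cast
    linarith

/-- one-step inequality with error `e` at step size `τ` -/
def StepAt (H : Phase d → ℝ) (a lam e M τ : ℝ) (w : Euc d → ℝ) : Prop :=
  ∀ x, ∃ v, ‖v‖ ≤ M ∧
    Real.exp (-(lam * τ)) * w (x - τ • v) + τ * (LegendreL H (x, v) + a) ≤ w x + e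

def StepE (H : Phase d → ℝ) (a lam M : ℝ) (w : Euc d → ℝ) : Prop :=
  ∀ ε > (0:ℝ), ∃ τ0 > (0:ℝ), ∀ τ, 0 < τ → τ ≤ τ0 → StepAt H a lam (ε * τ) M τ w

lemma Step.stepE {a lam C M : ℝ} {w : Euc d → ℝ} (hC : 0 < C) (h : Step H a lam C M w) : StepE H a lam M w := by
  intro ε hε
  refine ⟨min 1 (ε / C), by positivity, fun τ h0 h1 x => ?_⟩
  obtain ⟨v, hv, hle⟩ := h x τ h0 (h1.trans (min_le_left _ _))
  refine ⟨v, hv, hle.trans ?_⟩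
  have : τ ≤ ε / C := h1.trans (min_le_right _ _)
  rw [le_div_iff₀ hC] at this
  linarith [mul_le_mul_of_nonneg_left this h0.le]

lemma chain_lower {a lam e M τ : ℝ} {w : Euc d → ℝ} (hl : 0 ≤ lam) (hS : StepAt H a lam e M τ w) (hC : 0 ≤ e)
    (h0 : 0 < τ) (x : Euc d) : ∃ y v : ℕ → Euc d, y 0 = x ∧ (∀ k, y (k+1) = y k - τ • v k) ∧
    (∀ k, ‖v k‖ ≤ M) ∧
    (∀ k, Real.exp (-(lam * τ)) * w (y (k+1)) + τ * (LegendreL H (y k, v k) + a) ≤ w (y k) + e) ∧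
    ∀ N : ℕ, Real.exp (-(lam * τ)) ^ N * w (y N) +
      ∑ k ∈ Finset.range N, Real.exp (-(lam * τ)) ^ k * (τ * (LegendreL H (y k, v k) + a)) ≤ 
      w x + N * e := by
  set r := Real.exp (-(lam * τ)) with hr
  have hr0 : 0 < r := Real.exp_pos _
  have hr1 : r ≤ 1 := by rw [hr, Real.exp_le_one_iff]; have := mul_nonneg hl (show 0 ≤ τ by linarith); linarith
  choose V hV1 hV2 using hS
  set y : ℕ → Euc d := fun k => Nat.rec x (fun _ z => z - τ • V z) k with hy
  have hys : ∀ k, y (k+1) = y k - τ • V (y k) := fun k => rfl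
  have hst : ∀ k, r * w (y (k+1)) + τ * (LegendreL H (y k, V (y k)) + a) ≤ w (y k) + e := by
    intro k; rw [hys]; exact hV2 (y k)
  refine ⟨y, fun k => V (y k), rfl, hys, fun k => hV1 _, hst, fun N => ?_⟩
  induction N with
  | zero => simp [hy]
  | succ N ih =>
    have i3 := mul_le_mul_of_nonneg_left (hst N) (pow_pos hr0 N).le
    have i4 : r ^ N * e ≤ 1 * e := by
      gcongr; exact pow_le_one₀ hr0.le hr1
    rw [Finset.sum_range_succ, pow_succ]
    push_cast
    linarith

set_option maxHeartbeats 1000000 in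
lemma scl (hH : TonelliHam H) (a M : ℝ) : ∃ K R : ℝ, 0 < K ∧ 0 < R ∧ ∀ lam C' w, 0 ≤ lam → 0 ≤ C' →
    StepE H a lam M w → Dom H a lam C' (M+1) w → ∀ x, ∃ p, ‖p‖ ≤ R ∧ ∀ h : Euc d, ‖h‖ ≤ 1 →
      w (x + h) ≤ w x + ⟪p, h⟫ + K * ‖h‖ ^ 2 := by
  obtain ⟨Cs, hCs, hsc⟩ := leg_sc hH M
  obtain ⟨R, hR, hRb⟩ := leg_bound hH M
  obtain ⟨CH, _, hCH, -, hb⟩ := bounds hH R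
  refine ⟨2 * Cs, R + CH, by positivity, by positivity, ?_⟩
  intro lam C' w hl hC' hS hD x
  have key : ∀ N : ℕ, ∃ p : Euc d, p ∈ closedBall 0 (R + CH) ∧ ∀ h : Euc d, ‖h‖ ≤ 1 →
      w (x + h) ≤ w x + ⟪p, h⟫ + 2 * Cs * ‖h‖ ^ 2 + (1 + C') * (1 / ((N:ℝ) + 1)) := by
    intro n
    obtain ⟨τ0, hτ0, hst⟩ := hS (1 / ((n:ℝ) + 1)) (by positivity)
    obtain ⟨N0, hN0⟩ := exists_nat_one_div_lt hτ0
    obtain ⟨N, hN1, hN2⟩ : ∃ N : ℕ, n ≤ N ∧ N0 ≤ N := ⟨max n N0, le_max_left _ _, le_max_right _ _⟩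
    set τ : ℝ := 1 / ((N:ℝ) + 1) with hτ
    have h0 : 0 < τ := by positivity
    have hNτ : ((N + 1 : ℕ) : ℝ) * τ = 1 := by rw [hτ]; push_cast; field_simp
    have h1 : τ ≤ 1 := by
      rw [hτ, div_le_one (by positivity)]; linarith [(Nat.cast_nonneg N : (0:ℝ) ≤ N)]
    have hττ : τ ≤ τ0 := by
      refine le_trans ?_ hN0.le
      rw [hτ]; gcongr
    have hτn : τ ≤ 1 / ((n:ℝ) + 1) := by rw [hτ]; gcongr
    obtain ⟨y, v, hy0, hy, hv, -, hsum⟩ := chain_lower hl (hst τ h0 hττ) (by positivity) h0 x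
    have hlow := hsum (N+1)
    set r := Real.exp (-(lam * τ)) with hr
    have hr0 : 0 < r := Real.exp_pos _
    have hr1 : r ≤ 1 := by rw [hr, Real.exp_le_one_iff]; have := mul_nonneg hl h0.le; linarith
    choose p hp using fun k => leg_exists hH (y k) (v k)
    have hpR : ∀ k, ‖p k‖ ≤ R := fun k => hRb _ _ _ (hv k) (hp k)
    obtain ⟨P, hP⟩ : ∃ P : ℕ → Euc d, ∀ k, P k = p k - (1 - k * τ) • Hq H (y k, p k) := ⟨_, fun k => rfl⟩
    have hkτ : ∀ k < N + 1, 0 ≤ 1 - k * τ ∧ 1 - k * τ ≤ 1 := by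
      intro k hk
      have : (k:ℝ) * τ ≤ ((N + 1 : ℕ) : ℝ) * τ := by gcongr
      have : 0 ≤ (k:ℝ) * τ := by positivity
      constructor <;> linarith
    have hPb : ∀ k < N + 1, ‖P k‖ ≤ R + CH := by
      intro k hk
      rw [hP]
      refine (norm_sub_le (p k) ((1 - k * τ) • Hq H (y k, p k))).trans (add_le_add (hpR k) ?_)
      rw [norm_smul, Real.norm_of_nonneg (hkτ k hk).1]
      have h2 : ‖Hq H (y k, p k)‖ ≤ CH := (norm_Hq_le hH.smooth (y k, p k)).trans (hb (y k, p k) (hpR k)).2.1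
      calc _ ≤ 1 * CH := by
            have := (hkτ k hk).2; gcongr
        _ = CH := one_mul _
    have hrk : ∀ k, 0 < r ^ k ∧ r ^ k ≤ 1 := fun k => ⟨pow_pos hr0 k, pow_le_one₀ hr0.le hr1⟩
    refine ⟨∑ k ∈ Finset.range (N+1), (r ^ k * τ) • P k, ?_, ?_⟩
    · rw [mem_closedBall_zero_iff]
      calc _ ≤ ∑ k ∈ Finset.range (N+1), τ * (R + CH) := by
            refine (norm_sum_le _ _).trans (Finset.sum_le_sum fun k hk => ?_)
            have := hPb k (Finset.mem_range.1 hk)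
            rw [norm_smul, Real.norm_of_nonneg (by have := (hrk k).1; positivity)]
            have h3 : r ^ k * τ ≤ 1 * τ := by have := (hrk k).2; gcongr
            rw [one_mul] at h3
            gcongr
        _ = _ := by
            rw [Finset.sum_const, Finset.card_range, nsmul_eq_mul, ← mul_assoc, hNτ, one_mul]
    · intro h hh
      have hup := chain_upper hl hD hC' h0.le h1 (fun k => y k + (1 - k * τ) • h) (fun k => v k + h) (N+1)
        (fun k hk => by simp only [hy]; push_cast; module)
        (fun k hk => (norm_add_le _ _).trans (add_le_add (hv k) hh))
      rw [← hr] at hup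
      simp only [hNτ, sub_self, zero_smul, add_zero, Nat.cast_zero, zero_mul, sub_zero, one_smul, hy0] at hup
      have hterm : ∑ k ∈ Finset.range (N+1), r ^ k * (τ * (LegendreL H (y k + (1 - k * τ) • h, v k + h) + a))
          ≤ ∑ k ∈ Finset.range (N+1), (r ^ k * (τ * (LegendreL H (y k, v k) + a)) +
            (⟪(r ^ k * τ) • P k, h⟫ + τ * (2 * Cs * ‖h‖ ^ 2))) := by
        apply Finset.sum_le_sum
        intro k hk
        have hkk := hkτ k (Finset.mem_range.1 hk)
        have i1 := hsc (y k) (v k) (p k) ((1 - k * τ) • h) h (hv k) (hp k) hh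
        have i2 : ‖(1 - k * τ) • h‖ ≤ 1 * ‖h‖ := by
          rw [norm_smul, Real.norm_of_nonneg hkk.1]; have := hkk.2; gcongr
        have i3 : ‖(1 - k * τ) • h‖ ^ 2 ≤ ‖h‖ ^ 2 := by rw [one_mul] at i2; gcongr
        have i4 : ⟪P k, h⟫ = - ⟪Hq H (y k, p k), (1 - k * τ) • h⟫ + ⟪p k, h⟫ := by
          simp only [hP, inner_sub_left, inner_smul_left, inner_smul_right]
          simp; ring
        have i5 : LegendreL H (y k + (1 - k * τ) • h, v k + h) ≤ LegendreL H (y k, v k) + ⟪P k, h⟫ + 2 * Cs * ‖h‖ ^ 2 := by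
          have : Cs * ‖(1 - k * τ) • h‖ ^ 2 ≤ Cs * ‖h‖ ^ 2 := by gcongr
          rw [i4]; linarith
        have i6 : r ^ k * (τ * (LegendreL H (y k + (1 - k * τ) • h, v k + h) + a)) ≤ 
            r ^ k * (τ * (LegendreL H (y k, v k) + ⟪P k, h⟫ + 2 * Cs * ‖h‖ ^ 2 + a)) := by
          have := (hrk k).1
          gcongr
        have i7 : r ^ k * (τ * (2 * Cs * ‖h‖ ^ 2)) ≤ 1 * (τ * (2 * Cs * ‖h‖ ^ 2)) := by
          have := (hrk k).2; gcongr
        rw [inner_smul_left]; simp only [conj_trivial]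
        linarith
      rw [Finset.sum_add_distrib, Finset.sum_add_distrib, ← sum_inner, Finset.sum_const, Finset.card_range,
        nsmul_eq_mul, ← mul_assoc, hNτ, one_mul] at hterm
      have e1 : ((N + 1 : ℕ) : ℝ) * (1 / ((n:ℝ) + 1) * τ) = 1 / ((n:ℝ) + 1) := by
        rw [show ((N + 1 : ℕ) : ℝ) * (1 / ((n:ℝ) + 1) * τ) = (((N + 1 : ℕ) : ℝ) * τ) * (1 / ((n:ℝ) + 1)) by ring, hNτ, one_mul]
      have e2 : ((N + 1 : ℕ) : ℝ) * (C' * τ ^ 2) = C' * τ := by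
        rw [show ((N + 1 : ℕ) : ℝ) * (C' * τ ^ 2) = (((N + 1 : ℕ) : ℝ) * τ) * (C' * τ) by ring, hNτ, one_mul]
      rw [e1] at hlow
      rw [e2] at hup
      have e3 : C' * τ ≤ C' * (1 / ((n:ℝ) + 1)) := by gcongr
      linarith
  choose p hpb hp using key
  obtain ⟨q, hq, φ, hφ, hlim⟩ := (isCompact_closedBall (0 : Euc d) (R + CH)).tendsto_subseq hpb
  refine ⟨q, by simpa using hq, fun h hh => ?_⟩
  have t1 : Tendsto (fun n => w x + ⟪p (φ n), h⟫ + 2 * Cs * ‖h‖ ^ 2 + (1 + C') * (1 / (((φ n : ℕ):ℝ) + 1))) atTop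
      (nhds (w x + ⟪q, h⟫ + 2 * Cs * ‖h‖ ^ 2 + (1 + C') * 0)) := by
    have t2 := (tendsto_one_div_add_atTop_nhds_zero_nat (𝕜 := ℝ)).comp hφ.tendsto_atTop
    have t3 : Tendsto (fun n => ⟪p (φ n), h⟫) atTop (nhds ⟪q, h⟫) := hlim.inner tendsto_const_nhds
    exact ((tendsto_const_nhds.add t3).add tendsto_const_nhds).add (t2.const_mul _)
  rw [mul_zero, add_zero] at t1
  exact ge_of_tendsto' t1 fun n => hp (φ n) h hh

lemma scl_global (C0 K R : ℝ) (hC0 : 0 ≤ C0) (hK : 0 ≤ K) (hR : 0 ≤ R) {w : Euc d → ℝ} (hw : ∀ x, |w x| ≤ C0)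
    {x p : Euc d} (hp : ‖p‖ ≤ R) (h : ∀ h : Euc d, ‖h‖ ≤ 1 → w (x + h) ≤ w x + ⟪p, h⟫ + K * ‖h‖ ^ 2) (h' : Euc d) :
    w (x + h') ≤ w x + ⟪p, h'⟫ + (K + R + 2 * C0) * ‖h'‖ ^ 2 := by
  rcases le_total ‖h'‖ 1 with h1 | h1
  · have : 0 ≤ (R + 2 * C0) * ‖h'‖ ^ 2 := by positivity
    linarith [h h' h1]
  · have i1 := abs_le.1 (hw x)
    have i2 := abs_le.1 (hw (x + h'))
    have i3 := (abs_le.1 (abs_real_inner_le_norm p h')).1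
    have i4 : ‖p‖ * ‖h'‖ ≤ R * ‖h'‖ := by gcongr
    have i5 : 1 ≤ ‖h'‖ ^ 2 := by exact one_le_pow₀ h1
    have i6 : ‖h'‖ ≤ ‖h'‖ ^ 2 := by exact le_self_pow₀ h1 two_ne_zero
    have i7 : R * ‖h'‖ ≤ R * ‖h'‖ ^ 2 := by gcongr
    have i8 : 2 * C0 * 1 ≤ 2 * C0 * ‖h'‖ ^ 2 := by gcongr
    have : 0 ≤ K * ‖h'‖ ^ 2 := by positivity
    linarith

end K5

namespace K5
variable {d : ℕ} {H : Phase d → ℝ}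

lemma inner_grad (u : Euc d → ℝ) (x h : Euc d) : ⟪gradient u x, h⟫ = fderiv ℝ u x h := by
  rw [gradient, InnerProductSpace.toDual_symm_apply]

lemma perFun_fderiv {u : Euc d → ℝ} (hp : PerFun u) : PerFun (fderiv ℝ u) := by
  intro k x
  have : (fun y => u (y + intVec k)) = u := funext fun y => hp k y
  have h2 : fderiv ℝ (fun y => u (y + intVec k)) x = fderiv ℝ u (x + intVec k) :=
    fderiv_comp_add_right _
  rw [← h2, this]

lemma perFun_gradient {u : Euc d → ℝ} (hp : PerFun u) : PerFun (gradient u) := by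
  intro k x; rw [gradient, gradient, perFun_fderiv hp]

lemma per_bound0 {E : Type*} [NormedAddCommGroup E] {F : Euc d → E} (hc : Continuous F) (hp : PerFun F) :
    ∃ C : ℝ, 0 < C ∧ ∀ x, ‖F x‖ ≤ C := by
  obtain ⟨C, hC, h⟩ := per_bound (F := fun z : Phase d => F z.1) (by fun_prop) (fun k q _ => hp k q) 0
  exact ⟨C, hC, fun x => h (x, 0) (by simp)⟩

lemma per_ucont0 {E : Type*} [NormedAddCommGroup E] {F : Euc d → E} (hc : Continuous F) (hp : PerFun F)
    (ε : ℝ) (hε : 0 < ε) : ∃ δ : ℝ, 0 < δ ∧ ∀ x y, ‖y - x‖ < δ → ‖F y - F x‖ < ε := by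
  obtain ⟨δ, hδ, h⟩ := per_ucont (F := fun z : Phase d => F z.1) (by fun_prop) (fun k q _ => hp k q) 0 ε hε
  refine ⟨δ, hδ, fun x y hxy => h (x, 0) (y, 0) (by simp) ?_⟩
  simpa [Prod.norm_def] using hxy

lemma u_exp {u : Euc d → ℝ} (hu : ContDiff ℝ 1 u) (hp : PerFun u) (ε : ℝ) (hε : 0 < ε) :
    ∃ δ : ℝ, 0 < δ ∧ ∀ x h, ‖h‖ < δ → |u (x + h) - u x - ⟪gradient u x, h⟫| ≤ ε * ‖h‖ := by
  obtain ⟨δ, hδ, h⟩ := per_ucont0 (hu.continuous_fderiv (by norm_num)) (perFun_fderiv hp) ε hε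
  refine ⟨δ, hδ, fun x k hk => ?_⟩
  have := (convex_ball x δ).norm_image_sub_le_of_norm_fderiv_le' (𝕜 := ℝ) (f := u) (C := ε)
    (φ := fderiv ℝ u x) (x := x) (y := x + k)
    (fun y _ => (hu.differentiable (by norm_num)) y)
    (fun y hy => (h x y (by rw [← dist_eq_norm]; exact hy)).le) (mem_ball_self hδ)
    (by rw [mem_ball, dist_eq_norm, add_sub_cancel_left]; exact hk)
  rw [add_sub_cancel_left, ← inner_grad] at this
  exact this

lemma touch_above {u : Euc d → ℝ} {x g p : Euc d} {K : ℝ} (hg : HasGradientAt u g x)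
    (h : ∀ h : Euc d, ‖h‖ ≤ 1 → u (x + h) ≤ u x + ⟪p, h⟫ + K * ‖h‖ ^ 2) : p = g := by
  by_contra hne
  have he : g - p ≠ 0 := sub_ne_zero.2 (Ne.symm hne)
  obtain ⟨e, hee⟩ : ∃ e, e = g - p := ⟨_, rfl⟩
  rw [← hee] at he
  have h1 : HasDerivAt (fun s : ℝ => x + s • e) e 0 := by
    simpa using ((hasDerivAt_id (0:ℝ)).smul_const e).const_add x
  have h2 : HasDerivAt (fun s : ℝ => u (x + s • e)) ⟪g, e⟫ 0 := by
    have h3 : HasFDerivAt u ((InnerProductSpace.toDual ℝ (Euc d)) g) (x + (0:ℝ) • e) := by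
      simpa using hg.hasFDerivAt
    exact (h3.comp_hasDerivAt (0:ℝ) h1).congr_deriv (InnerProductSpace.toDual_apply_apply ..)
  have h4 : HasDerivAt (fun s : ℝ => u (x + s • e) - s * ⟪p, e⟫ - K * (s ^ 2 * ‖e‖ ^ 2)) (⟪g, e⟫ - ⟪p, e⟫) 0 := by
    have i1 : HasDerivAt (fun s : ℝ => s * ⟪p, e⟫) ⟪p, e⟫ 0 := by simpa using (hasDerivAt_id (0:ℝ)).mul_const ⟪p, e⟫
    have i2 : HasDerivAt (fun s : ℝ => K * (s ^ 2 * ‖e‖ ^ 2)) 0 0 := by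
      simpa using ((hasDerivAt_pow 2 (0:ℝ)).mul_const (‖e‖ ^ 2)).const_mul K
    exact ((h2.sub i1).sub i2).congr_deriv (by ring)
  have hmax : IsLocalMax (fun s : ℝ => u (x + s • e) - s * ⟪p, e⟫ - K * (s ^ 2 * ‖e‖ ^ 2)) 0 := by
    have hpos : 0 < ‖e‖ := norm_pos_iff.2 he
    have : ball (0:ℝ) (1 / ‖e‖) ∈ nhds (0:ℝ) := ball_mem_nhds _ (by positivity)
    filter_upwards [this] with s hs
    rw [mem_ball_zero_iff, lt_div_iff₀ hpos] at hs
    have := h (s • e) (by rw [norm_smul]; exact hs.le)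
    rw [inner_smul_right, norm_smul, mul_pow, Real.norm_eq_abs, sq_abs] at this
    simp; linarith
  have := hmax.hasDerivAt_eq_zero h4
  rw [← inner_sub_left, ← hee, real_inner_self_eq_norm_sq] at this
  exact he (norm_eq_zero.1 (pow_eq_zero_iff (by norm_num) |>.1 this))

structure USol (H : Phase d → ℝ) (a : ℝ) (u : Euc d → ℝ) : Prop where
  c1 : ContDiff ℝ 1 u
  per : PerFun u
  dom : ∀ M, ∃ C, 0 ≤ C ∧ Dom H a 0 C M u
  step : ∃ M, 0 < M ∧ StepE H a 0 M u

lemma USol.grad {a : ℝ} {u : Euc d → ℝ} (hu : USol H a u) (x : Euc d) : HasGradientAt u (gradient u x) x :=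
  ((hu.c1.differentiable (by norm_num)) x).hasGradientAt

lemma USol.hj (hH : TonelliHam H) {a : ℝ} {u : Euc d → ℝ} (hu : USol H a u) (x : Euc d) :
    H (x, gradient u x) = a := by
  obtain ⟨p, hp⟩ : ∃ p, p = gradient u x := ⟨_, rfl⟩
  rw [← hp]
  apply le_antisymm
  · obtain ⟨v, hv⟩ : ∃ v, v = Hp H (x, p) := ⟨_, rfl⟩
    obtain ⟨C, hC, hD⟩ := hu.dom ‖v‖
    have hL := leg_Hp hH x p
    rw [← hv] at hL
    apply le_of_forall_pos_le_add
    intro ε hε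
    obtain ⟨δ, hδ, hexp⟩ := u_exp hu.c1 hu.per (ε / (2 * (‖v‖ + 1))) (by positivity)
    obtain ⟨τ, hτ⟩ : ∃ τ, τ = min 1 (min (δ / (2 * (‖v‖ + 1))) (ε / (2 * (C + 1)))) := ⟨_, rfl⟩
    have h0 : 0 < τ := by rw [hτ]; positivity
    have h1 : τ ≤ 1 := by rw [hτ]; exact min_le_left _ _
    have h2 : τ * (2 * (‖v‖ + 1)) ≤ δ := by
      have : τ ≤ δ / (2 * (‖v‖ + 1)) := by rw [hτ]; exact (min_le_right _ _).trans (min_le_left _ _)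
      rwa [le_div_iff₀ (by positivity)] at this
    have h3 : τ * (2 * (C + 1)) ≤ ε := by
      have : τ ≤ ε / (2 * (C + 1)) := by rw [hτ]; exact (min_le_right _ _).trans (min_le_right _ _)
      rwa [le_div_iff₀ (by positivity)] at this
    have hd := hD x v τ le_rfl h0.le h1
    simp only [zero_mul, neg_zero, Real.exp_zero, one_mul] at hd
    have hn : ‖-(τ • v)‖ = τ * ‖v‖ := by rw [norm_neg, norm_smul, Real.norm_of_nonneg h0.le]
    have he := (abs_le.1 (hexp x (-(τ • v)) (by rw [hn]; linarith [mul_nonneg h0.le (norm_nonneg v)]))).2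
    rw [← sub_eq_add_neg, ← hp, inner_neg_right, inner_smul_right, hn] at he
    have h4 : ε / (2 * (‖v‖ + 1)) * (τ * ‖v‖) ≤ τ * (ε / 2) := by
      rw [div_mul_eq_mul_div, div_le_iff₀ (by positivity)]
      linarith [mul_pos hε h0, mul_nonneg (mul_pos hε h0).le (norm_nonneg v)]
    rw [hL] at hd
    have h5 : τ * H (x, p) ≤ τ * (a + ε) := by linarith [mul_le_mul_of_nonneg_left h3 h0.le, mul_pos h0 h0]
    exact le_of_mul_le_mul_left h5 h0
  · obtain ⟨M, hM, hS⟩ := hu.step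
    apply le_of_forall_pos_le_add
    intro ε hε
    obtain ⟨τ0, hτ0, hS⟩ := hS (ε / 2) (by positivity)
    obtain ⟨δ, hδ, hexp⟩ := u_exp hu.c1 hu.per (ε / (2 * M)) (by positivity)
    obtain ⟨τ, hτ⟩ : ∃ τ, τ = min τ0 (δ / (2 * M)) := ⟨_, rfl⟩
    have h0 : 0 < τ := by rw [hτ]; positivity
    have h1 : τ ≤ τ0 := by rw [hτ]; exact min_le_left _ _
    have h2 : τ * (2 * M) ≤ δ := by
      have : τ ≤ δ / (2 * M) := by rw [hτ]; exact (min_le_right _ _)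
      rwa [le_div_iff₀ (by positivity)] at this
    obtain ⟨v, hv, hle⟩ := hS τ h0 h1 x
    simp only [zero_mul, neg_zero, Real.exp_zero, one_mul] at hle
    have hn : ‖-(τ • v)‖ = τ * ‖v‖ := by rw [norm_neg, norm_smul, Real.norm_of_nonneg h0.le]
    have he := (abs_le.1 (hexp x (-(τ • v)) (by rw [hn]; linarith [mul_le_mul_of_nonneg_left hv h0.le, mul_nonneg h0.le (norm_nonneg v)]))).1
    rw [← sub_eq_add_neg, ← hp, inner_neg_right, inner_smul_right, hn] at he
    have h4 : ε / (2 * M) * (τ * ‖v‖) ≤ τ * (ε / 2) := by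
      rw [div_mul_eq_mul_div, div_le_iff₀ (by positivity)]
      linarith [mul_le_mul_of_nonneg_left hv (mul_pos hε h0).le]
    have h6 := fenchel hH x v p
    have h7 : τ * (⟪p, v⟫ - H (x, p)) ≤ τ * LegendreL H (x, v) := by gcongr
    have h5 : τ * a ≤ τ * (H (x, p) + ε) := by linarith
    exact le_of_mul_le_mul_left h5 h0

def Hrev (H : Phase d → ℝ) : Phase d → ℝ := fun z => H (z.1, -z.2)

lemma Hrev_leg (H : Phase d → ℝ) (x v : Euc d) : LegendreL (Hrev H) (x, v) = LegendreL H (x, -v) := by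
  unfold LegendreL Hrev
  congr 1
  ext r
  constructor
  · rintro ⟨p, rfl⟩; exact ⟨-p, by simp⟩
  · rintro ⟨p, rfl⟩; exact ⟨-p, by simp⟩

lemma Hrev_ton (hH : TonelliHam H) : TonelliHam (Hrev H) := by
  refine ⟨fun k q p => hH.periodic k q (-p), ?_, ?_, ?_⟩
  · exact hH.smooth.comp (contDiff_fst.prodMk contDiff_snd.neg)
  · intro q p v hv
    have hs : ContDiff ℝ 2 (fun p' => H (q, p')) := hH.smooth.comp (contDiff_const.prodMk contDiff_id)
    have := (-(ContinuousLinearMap.id ℝ (Euc d))).iteratedFDeriv_comp_right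
      hs p (i := 2) le_rfl
    have e : (fun p' => Hrev H (q, p')) = (fun p' => H (q, p')) ∘ (-(ContinuousLinearMap.id ℝ (Euc d))) := by
      funext p'; simp [Hrev]
    rw [e, this]
    simp only [ContinuousMultilinearMap.compContinuousLinearMap_apply]
    have h2 := hH.convex q (-p) (-v) (neg_ne_zero.2 hv)
    convert h2 using 2
    · rfl
    · funext i; fin_cases i <;> simp
  · intro A
    obtain ⟨B, hB⟩ := hH.superlinear A
    exact ⟨B, fun q p => by have := hB q (-p); rw [norm_neg] at this; exact this⟩

lemma USol.reg (hH : TonelliHam H) {a : ℝ} {u : Euc d → ℝ} (hu : USol H a u) : ∃ K : ℝ, 0 < K ∧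
    ∀ x h, |u (x + h) - u x - ⟪gradient u x, h⟫| ≤ K * ‖h‖ ^ 2 := by
  obtain ⟨C0, hC0, hb⟩ := per_bound0 hu.c1.continuous hu.per
  -- upper
  obtain ⟨M, hM, hS⟩ := hu.step
  obtain ⟨C, hC, hD⟩ := hu.dom (M + 1)
  obtain ⟨K1, R1, hK1, hR1, h1⟩ := scl hH a M
  have up : ∀ x h, u (x + h) ≤ u x + ⟪gradient u x, h⟫ + (K1 + R1 + 2 * C0) * ‖h‖ ^ 2 := by
    intro x h
    obtain ⟨p, hpR, hp⟩ := h1 0 C u le_rfl hC hS hD x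
    rw [← touch_above (hu.grad x) hp]
    exact scl_global C0 K1 R1 hC0.le hK1.le hR1.le hb hpR hp h
  -- lower
  obtain ⟨Rg, hRg, hRgb⟩ := per_bound0 (F := fun x => gradient u x) (by
    have := hu.c1.continuous_fderiv (by norm_num)
    exact (InnerProductSpace.toDual ℝ (Euc d)).symm.continuous.comp this) (perFun_gradient hu.per)
  obtain ⟨CH, _, hCH, -, hbb⟩ := bounds hH Rg
  have hXb : ∀ x, ‖Hp H (x, gradient u x)‖ ≤ CH := fun x =>
    (norm_Hp_le hH.smooth (x, gradient u x)).trans (hbb (x, gradient u x) (hRgb x)).2.1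
  have hS' : StepE (Hrev H) a 0 CH (fun x => - u x) := by
    intro ε hε
    obtain ⟨δ, hδ, hexp⟩ := u_exp hu.c1 hu.per (ε / CH) (by positivity)
    refine ⟨δ / (2 * CH), by positivity, fun τ h0 hτ x => ?_⟩
    rw [le_div_iff₀ (by positivity)] at hτ
    obtain ⟨p, hp⟩ : ∃ p, p = gradient u x := ⟨_, rfl⟩
    have hX := hXb x
    rw [← hp] at hX
    obtain ⟨v, hv⟩ : ∃ v, v = Hp H (x, p) := ⟨_, rfl⟩
    refine ⟨-v, by rwa [norm_neg, hv], ?_⟩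
    have hL := leg_Hp hH x p
    rw [← hv] at hL hX
    have hj := hu.hj hH x
    rw [← hp] at hj
    simp only [zero_mul, neg_zero, Real.exp_zero, one_mul]
    rw [Hrev_leg, neg_neg, hL, hj, smul_neg, sub_neg_eq_add]
    have hn : ‖τ • v‖ = τ * ‖v‖ := by rw [norm_smul, Real.norm_of_nonneg h0.le]
    have hn2 : τ * ‖v‖ ≤ τ * CH := by gcongr
    have he := (abs_le.1 (hexp x (τ • v) (by rw [hn]; nlinarith))).1
    rw [← hp, inner_smul_right, hn] at he
    have h4 : ε / CH * (τ * ‖v‖) ≤ ε * τ := by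
      rw [div_mul_eq_mul_div, div_le_iff₀ (by positivity)]
      have := mul_le_mul_of_nonneg_left hn2 hε.le
      linarith
    linarith
  obtain ⟨C', hC', hD'⟩ := hu.dom (CH + 1)
  obtain ⟨Cl, hCl, hlip⟩ := leg_lip hH (CH + 1)
  have hDr : Dom (Hrev H) a 0 (C' + Cl * (CH + 1)) (CH + 1) (fun x => - u x) := by
    intro x v τ hv h0 h1
    have i1 := hD' (x - τ • v) (-v) τ (by rwa [norm_neg]) h0 h1
    simp only [zero_mul, neg_zero, Real.exp_zero, one_mul] at i1 ⊢
    rw [smul_neg, sub_neg_eq_add, sub_add_cancel] at i1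
    rw [Hrev_leg]
    have i2 := (abs_le.1 (hlip x (x - τ • v) (-v) (by rwa [norm_neg]))).2
    have i3 : ‖x - τ • v - x‖ ≤ τ * (CH + 1) := by
      rw [sub_sub_cancel_left, norm_neg, norm_smul, Real.norm_of_nonneg h0]; gcongr
    have i4 : Cl * ‖x - τ • v - x‖ ≤ Cl * (τ * (CH + 1)) := by gcongr
    have i5 : τ * LegendreL H (x - τ • v, -v) ≤ τ * (LegendreL H (x, -v) + Cl * (τ * (CH + 1))) := by
      apply mul_le_mul_of_nonneg_left _ h0; linarith
    linarith
  obtain ⟨K2, R2, hK2, hR2, h2⟩ := scl (Hrev_ton hH) a CH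
  have lo : ∀ x h, - u (x + h) ≤ - u x + ⟪- gradient u x, h⟫ + (K2 + R2 + 2 * C0) * ‖h‖ ^ 2 := by
    intro x h
    obtain ⟨p, hpR, hp⟩ := h2 0 _ (fun x => - u x) le_rfl (by positivity) hS' hDr x
    have hg : HasGradientAt (fun x => - u x) (- gradient u x) x := by
      have := (hu.grad x).hasFDerivAt.neg
      rw [HasGradientAt, HasGradientAtFilter, map_neg]
      exact this
    rw [← touch_above hg hp]
    exact scl_global C0 K2 R2 hC0.le hK2.le hR2.le (fun x => by rw [abs_neg]; exact hb x) hpR hp h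
  refine ⟨K1 + R1 + 2 * C0 + (K2 + R2 + 2 * C0), by positivity, fun x h => ?_⟩
  have e1 := up x h
  have e2 := lo x h
  rw [inner_neg_left] at e2
  have e3 : 0 ≤ (K1 + R1 + 2 * C0) * ‖h‖ ^ 2 := by positivity
  have e4 : 0 ≤ (K2 + R2 + 2 * C0) * ‖h‖ ^ 2 := by positivity
  rw [abs_le]; constructor <;> linarith

lemma lip_of_reg {u : Euc d → ℝ} {g : Euc d → Euc d} {K : ℝ} (hK : 0 < K)
    (h : ∀ x h, |u (x + h) - u x - ⟪g x, h⟫| ≤ K * ‖h‖ ^ 2) (x y : Euc d) :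
    ‖g y - g x‖ ≤ 6 * K * ‖y - x‖ := by
  rcases eq_or_ne (g y) (g x) with h0 | h0
  · rw [h0, sub_self, norm_zero]; positivity
  have hn : 0 < ‖g y - g x‖ := norm_pos_iff.2 (sub_ne_zero.2 h0)
  obtain ⟨k, hk⟩ : ∃ k, k = (‖y - x‖ / ‖g y - g x‖) • (g y - g x) := ⟨_, rfl⟩
  have hkn : ‖k‖ = ‖y - x‖ := by
    rw [hk, norm_smul, Real.norm_of_nonneg (by positivity)]; field_simp
  have i1 := (abs_le.1 (h x (y - x + k))).2
  have i2 := (abs_le.1 (h x (y - x))).1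
  have i3 := (abs_le.1 (h y k)).1
  rw [← add_assoc, add_sub_cancel, inner_add_right] at i1
  rw [add_sub_cancel] at i2
  have i4 : ‖y - x + k‖ ≤ 2 * ‖y - x‖ := (norm_add_le _ _).trans (by rw [hkn]; linarith)
  have i5 : ‖y - x + k‖ ^ 2 ≤ (2 * ‖y - x‖) ^ 2 := by gcongr
  have i6 : K * ‖y - x + k‖ ^ 2 ≤ K * (2 * ‖y - x‖) ^ 2 := by gcongr
  rw [hkn] at i3
  have i7 : ⟪g y - g x, k⟫ = ‖y - x‖ * ‖g y - g x‖ := by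
    rw [hk, inner_smul_right, real_inner_self_eq_norm_sq]; field_simp
  have i8 : ⟪g y - g x, k⟫ ≤ 6 * K * ‖y - x‖ ^ 2 := by rw [inner_sub_left]; linarith
  rw [i7] at i8
  have hxy : 0 < ‖y - x‖ := norm_pos_iff.2 (sub_ne_zero.2 fun e => h0 (by rw [e]))
  have : ‖y - x‖ * ‖g y - g x‖ ≤ ‖y - x‖ * (6 * K * ‖y - x‖) := by linarith
  exact le_of_mul_le_mul_left this hxy

end K5

namespace K5
variable {d : ℕ}

def Sup (w : Euc d → ℝ) (K : ℝ) (x p : Euc d) : Prop :=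
  ∀ y, w y ≤ w x + ⟪p, y - x⟫ + K * ‖y - x‖ ^ 2

lemma part_lim (f : ℝ → ℝ) (c C : ℝ)
    (h : ∀ s s', 0 ≤ s → s ≤ s' → s' ≤ 1 → |f s' - f s| ≤ c * (s' - s) + C * (s' - s) ^ 2) :
    |f 1 - f 0| ≤ c := by
  have key : ∀ N : ℕ, 0 < N → |f 1 - f 0| ≤ c + C * (1 / (N:ℝ)) := by
    intro N hN
    have hN' : (0:ℝ) < N := by exact_mod_cast hN
    have e : f 1 - f 0 = ∑ k ∈ Finset.range N, (f (((k + 1 : ℕ) : ℝ) / N) - f ((k : ℝ) / N)) := by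
      rw [Finset.sum_range_sub (fun k : ℕ => f ((k : ℝ) / N)) N]
      simp [hN'.ne']
    rw [e]
    refine (Finset.abs_sum_le_sum_abs _ _).trans ?_
    have : ∀ k ∈ Finset.range N, |f (((k + 1 : ℕ) : ℝ) / N) - f ((k : ℝ) / N)| ≤ c * (1 / N) + C * (1 / N) ^ 2 := by
      intro k hk
      have hk' : ((k + 1 : ℕ) : ℝ) ≤ N := by exact_mod_cast Finset.mem_range.1 hk
      have := h ((k : ℝ) / N) (((k + 1 : ℕ) : ℝ) / N) (by positivity)
        (by gcongr; simp) (by rw [div_le_one hN']; exact hk')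
      have e2 : ((k + 1 : ℕ) : ℝ) / N - (k : ℝ) / N = 1 / N := by push_cast; ring
      rwa [e2] at this
    refine (Finset.sum_le_sum this).trans (le_of_eq ?_)
    rw [Finset.sum_const, Finset.card_range, nsmul_eq_mul]
    field_simp
  have hlim : Tendsto (fun N : ℕ => c + C * (1 / (N:ℝ))) atTop (nhds (c + C * 0)) :=
    (tendsto_one_div_atTop_nhds_zero_nat.const_mul C).const_add c
  have := ge_of_tendsto hlim (eventually_atTop.2 ⟨1, fun N hN => key N hN⟩)
  simpa using this

lemma alex_of_diff {w : Euc d → ℝ} {K : ℝ} (hK : 0 ≤ K) {P : Euc d → Euc d} (hP : ∀ x, Sup w K x (P x))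
    {x : Euc d} {S : Euc d →L[ℝ] Euc d} (hS : HasFDerivAt P S x) : HasAlexandrovAt w (P x) S x := by
  have main : ∀ ε : ℝ, 0 < ε → ∃ δ : ℝ, 0 < δ ∧ ∀ h : Euc d, ‖h‖ < δ →
      |w (x + h) - w x - ⟪P x, h⟫ - (1/2) * ⟪S h, h⟫| ≤ ε * ‖h‖ ^ 2 := by
    intro ε hε
    have h1 := (hasFDerivAt_iff_isLittleO_nhds_zero.1 hS).bound hε
    obtain ⟨δ, hδ, h1⟩ := Metric.eventually_nhds_iff.1 h1
    refine ⟨δ, hδ, fun h hh => ?_⟩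
    have hP' : ∀ s : ℝ, 0 ≤ s → s ≤ 1 → |⟪P (x + s • h), h⟫ - ⟪P x, h⟫ - s * ⟪S h, h⟫| ≤ ε * ‖h‖ ^ 2 := by
      intro s h0 hs1
      have hn : ‖s • h‖ ≤ ‖h‖ := by
        rw [norm_smul, Real.norm_of_nonneg h0]; exact mul_le_of_le_one_left (norm_nonneg _) hs1
      have i1 := h1 (y := s • h) (by rw [dist_zero_right]; exact hn.trans_lt hh)
      have e : ⟪P (x + s • h), h⟫ - ⟪P x, h⟫ - s * ⟪S h, h⟫ = ⟪P (x + s • h) - P x - S (s • h), h⟫ := by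
        rw [inner_sub_left, inner_sub_left, map_smul, real_inner_smul_left]
      rw [e]
      refine (abs_real_inner_le_norm _ _).trans ?_
      calc _ ≤ (ε * ‖s • h‖) * ‖h‖ := by gcongr
        _ ≤ (ε * ‖h‖) * ‖h‖ := by gcongr
        _ = _ := by ring
    have := part_lim (fun s => w (x + s • h) - s * ⟪P x, h⟫ - (1/2) * s ^ 2 * ⟪S h, h⟫)
      (ε * ‖h‖ ^ 2) (K * ‖h‖ ^ 2 + |⟪S h, h⟫|) ?_
    · simp only [one_smul, zero_smul, add_zero] at this
      convert this using 2
      ring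
    intro s s' h0 hss h1
    have a1 := hP (x + s • h) (x + s' • h)
    have a2 := hP (x + s' • h) (x + s • h)
    have e1 : x + s' • h - (x + s • h) = (s' - s) • h := by rw [sub_smul]; abel
    have e2 : x + s • h - (x + s' • h) = -((s' - s) • h) := by rw [sub_smul]; abel
    rw [e1, inner_smul_right, norm_smul, mul_pow, Real.norm_eq_abs, sq_abs] at a1
    rw [e2, inner_neg_right, inner_smul_right, norm_neg, norm_smul, mul_pow, Real.norm_eq_abs, sq_abs] at a2
    have b1 := (abs_le.1 (hP' s h0 (hss.trans h1))).2
    have b2 := (abs_le.1 (hP' s' (h0.trans hss) h1)).1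
    have hd : 0 ≤ s' - s := sub_nonneg.2 hss
    have c1 := mul_le_mul_of_nonneg_left b1 hd
    have c2 := mul_le_mul_of_nonneg_left b2 hd
    have d1 := mul_le_mul_of_nonneg_left (le_abs_self ⟪S h, h⟫) (sq_nonneg (s' - s))
    have d2 := mul_le_mul_of_nonneg_left (neg_abs_le ⟪S h, h⟫) (sq_nonneg (s' - s))
    have d3 : 0 ≤ (s' - s)^2 * |⟪S h, h⟫| := by positivity
    beta_reduce
    rw [abs_le]; constructor <;> linarith
  constructor
  · rw [hasGradientAt_iff_hasFDerivAt, hasFDerivAt_iff_isLittleO_nhds_zero]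
    obtain ⟨δ, hδ, h1⟩ := main 1 one_pos
    rw [isLittleO_iff]
    intro c hc
    obtain ⟨c', hc'⟩ : ∃ c', c' = c / (‖S‖ + 1) := ⟨_, rfl⟩
    have hcp : 0 < c' := by rw [hc']; positivity
    filter_upwards [Metric.ball_mem_nhds (0 : Euc d) hδ, Metric.ball_mem_nhds (0 : Euc d) hcp] with h hh hh2
    rw [mem_ball_zero_iff] at hh hh2
    have h2 := h1 h hh
    rw [InnerProductSpace.toDual_apply_apply, Real.norm_eq_abs]
    have h3 : |⟪S h, h⟫| ≤ ‖S‖ * ‖h‖ ^ 2 := by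
      refine (abs_real_inner_le_norm _ _).trans ?_
      have := mul_le_mul_of_nonneg_right (S.le_opNorm h) (norm_nonneg h)
      linarith
    have h4 : (‖S‖ + 1) * ‖h‖ ^ 2 ≤ c * ‖h‖ := by
      rw [hc', lt_div_iff₀ (by positivity)] at hh2
      have := mul_le_mul_of_nonneg_right hh2.le (norm_nonneg h)
      linarith
    have h5 : 0 ≤ ‖S‖ * ‖h‖ ^ 2 := by positivity
    rw [abs_le] at h2 h3 ⊢
    constructor <;> linarith
  · rw [isLittleO_iff]
    intro c hc
    obtain ⟨δ, hδ, h1⟩ := main c hc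
    filter_upwards [Metric.ball_mem_nhds x hδ] with y hy
    have := h1 (y - x) (by rwa [mem_ball, dist_eq_norm] at hy)
    rw [add_sub_cancel] at this
    rw [Real.norm_eq_abs, Real.norm_of_nonneg (by positivity)]
    exact this

lemma lip_null {T : Euc d → Euc d} {C : NNReal} (hT : LipschitzWith C T) {s : Set (Euc d)} (hs : volume s = 0) :
    volume (T '' s) = 0 := by
  have h1 : (volume : Measure (Euc d)) ≪ Measure.hausdorffMeasure (Module.finrank ℝ (Euc d)) :=
    Measure.absolutelyContinuous_isAddHaarMeasure _ _
  have h2 : Measure.hausdorffMeasure (Module.finrank ℝ (Euc d)) ≪ (volume : Measure (Euc d)) :=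
    Measure.absolutelyContinuous_isAddHaarMeasure _ _
  apply h1
  have := hT.hausdorffMeasure_image_le (d := (Module.finrank ℝ (Euc d))) (by positivity) s
  rw [h2 hs, mul_zero] at this
  exact le_antisymm this bot_le

theorem alexandrov {w : Euc d → ℝ} {K C0 : ℝ} (hK : 0 ≤ K) (hc : Continuous w) (hb : ∀ x, |w x| ≤ C0)
    (hw : ∀ x, ∃ p, Sup w K x p) : ∀ᵐ x ∂(volume : Measure (Euc d)), ∃ p S, HasAlexandrovAt w p S x := by
  choose P hP using hw
  -- the relation
  obtain ⟨D, hD⟩ : ∃ D : Set (Euc d), D = {y | ∃ x, Sup w K x ((2 * K + 1) • x - y)} := ⟨_, rfl⟩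
  have hex : ∀ y, ∃ x, y ∈ D → Sup w K x ((2 * K + 1) • x - y) := by
    intro y
    by_cases h : y ∈ D
    · have h' := h
      rw [hD] at h'
      obtain ⟨x, hx⟩ := h'
      exact ⟨x, fun _ => hx⟩
    · exact ⟨0, fun h' => absurd h' h⟩
  choose T0 hT0 using hex
  have mono : ∀ x1 x2 y1 y2, Sup w K x1 ((2 * K + 1) • x1 - y1) → Sup w K x2 ((2 * K + 1) • x2 - y2) →
      ‖x1 - x2‖ ≤ ‖y1 - y2‖ := by
    intro x1 x2 y1 y2 h1 h2
    have a1 := h1 x2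
    have a2 := h2 x1
    have e : x2 - x1 = -(x1 - x2) := by abel
    rw [e, norm_neg, inner_neg_right] at a1
    have e2 : ⟪(2 * K + 1) • x1 - y1, x1 - x2⟫ - ⟪(2 * K + 1) • x2 - y2, x1 - x2⟫
        = (2 * K + 1) * ‖x1 - x2‖ ^ 2 - ⟪y1 - y2, x1 - x2⟫ := by
      rw [← real_inner_self_eq_norm_sq]
      simp only [inner_sub_left, real_inner_smul_left]
      ring
    have e3 := real_inner_le_norm (y1 - y2) (x1 - x2)
    have e4 : ‖x1 - x2‖ ^ 2 ≤ ‖y1 - y2‖ * ‖x1 - x2‖ := by linarith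
    rcases (norm_nonneg (x1 - x2)).eq_or_lt with h | h
    · rw [← h]; exact norm_nonneg _
    · rw [sq] at e4
      exact le_of_mul_le_mul_right e4 h
  have hlip : LipschitzOnWith 1 T0 D := by
    apply LipschitzOnWith.of_dist_le_mul
    intro y1 h1 y2 h2
    rw [NNReal.coe_one, one_mul, dist_eq_norm, dist_eq_norm]
    exact mono _ _ _ _ (hT0 y1 h1) (hT0 y2 h2)
  obtain ⟨T, hT, hTe⟩ := hlip.extend_finite_dimension
  have hTT : ∀ x p, Sup w K x p → T ((2 * K + 1) • x - p) = x := by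
    intro x p h
    have hy : (2 * K + 1) • x - p ∈ D := by
      rw [hD]; exact ⟨x, by rwa [sub_sub_cancel]⟩
    rw [← hTe hy]
    have := mono _ _ _ _ (hT0 _ hy) (show Sup w K x ((2 * K + 1) • x - ((2 * K + 1) • x - p)) by rwa [sub_sub_cancel])
    rw [sub_self, norm_zero] at this
    exact sub_eq_zero.1 (norm_le_zero_iff.1 this)
  -- null sets
  obtain ⟨N1, hN1⟩ : ∃ N1 : Set (Euc d), N1 = {y | ¬ DifferentiableAt ℝ T y} := ⟨_, rfl⟩
  obtain ⟨N2, hN2⟩ : ∃ N2 : Set (Euc d), N2 = {y | DifferentiableAt ℝ T y ∧ (fderiv ℝ T y).det = 0} := ⟨_, rfl⟩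
  have z1 : volume (T '' N1) = 0 := by
    apply lip_null hT
    rw [hN1]
    exact hT.ae_differentiableAt
  have z2 : volume (T '' N2) = 0 := by
    apply addHaar_image_eq_zero_of_det_fderivWithin_eq_zero volume (f' := fun y => fderiv ℝ T y)
    · intro y hy
      rw [hN2] at hy
      exact hy.1.hasFDerivAt.hasFDerivWithinAt
    · intro y hy
      rw [hN2] at hy
      exact hy.2
  have z3 : ∀ᵐ x ∂(volume : Measure (Euc d)), x ∉ T '' N1 := by
    exact measure_eq_zero_iff_ae_notMem.1 z1
  have z4 : ∀ᵐ x ∂(volume : Measure (Euc d)), x ∉ T '' N2 := by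
    exact measure_eq_zero_iff_ae_notMem.1 z2
  have hcl : IsClosed {z : Euc d × Euc d | Sup w K z.1 z.2} := by
    simp only [Sup, ofPred_forall]
    refine isClosed_iInter fun y => isClosed_le (by fun_prop) (by fun_prop)
  have hbd : ∀ x p, Sup w K x p → ‖p‖ ≤ 2 * C0 + K := by
    intro x p h
    rcases eq_or_ne p 0 with h0 | h0
    · rw [h0, norm_zero]
      have := (abs_nonneg _).trans (hb x)
      positivity
    · have hp : 0 < ‖p‖ := norm_pos_iff.2 h0
      have a1 := h (x - ‖p‖⁻¹ • p)
      rw [sub_sub_cancel_left, inner_neg_right, inner_smul_right, norm_neg, norm_smul, norm_inv, norm_norm,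
        real_inner_self_eq_norm_sq, inv_mul_cancel₀ hp.ne', one_pow, mul_one, sq, ← mul_assoc,
        inv_mul_cancel₀ hp.ne', one_mul] at a1
      have b1 := abs_le.1 (hb x)
      have b2 := abs_le.1 (hb (x - ‖p‖⁻¹ • p))
      linarith
  filter_upwards [z3, z4] with x hx1 hx2
  have hgood : ∀ p, Sup w K x p → DifferentiableAt ℝ T ((2 * K + 1) • x - p) ∧
      (fderiv ℝ T ((2 * K + 1) • x - p)).det ≠ 0 := by
    intro p hp
    have h1 : DifferentiableAt ℝ T ((2 * K + 1) • x - p) := by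
      by_contra h
      exact hx1 ⟨_, by rw [hN1]; exact h, hTT x p hp⟩
    refine ⟨h1, fun h2 => hx2 ⟨_, by rw [hN2]; exact ⟨h1, h2⟩, hTT x p hp⟩⟩
  obtain ⟨hd, hdet⟩ := hgood (P x) (hP x)
  obtain ⟨A, hA⟩ : ∃ A : Euc d ≃L[ℝ] Euc d, (A : Euc d →L[ℝ] Euc d) = fderiv ℝ T ((2 * K + 1) • x - P x) :=
    ⟨_, ContinuousLinearMap.coe_toContinuousLinearEquivOfDetNeZero _ hdet⟩
  have hTd : HasFDerivAt T (A : Euc d →L[ℝ] Euc d) ((2 * K + 1) • x - P x) := by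
    rw [hA]; exact hd.hasFDerivAt
  -- uniqueness
  have huniq : ∀ p, Sup w K x p → p = P x := by
    intro p hp
    have hseg : ∀ s : ℝ, 0 ≤ s → s ≤ 1 → T ((2 * K + 1) • x - P x + s • (P x - p)) = x := by
      intro s h0 h1
      have : Sup w K x (P x - s • (P x - p)) := by
        intro y
        have a1 := hP x y
        have a2 := hp y
        have e : ⟪P x - s • (P x - p), y - x⟫ = (1 - s) * ⟪P x, y - x⟫ + s * ⟪p, y - x⟫ := by
          simp only [inner_sub_left, real_inner_smul_left]; ring
        rw [e]
        have b1 := mul_le_mul_of_nonneg_left a1 (sub_nonneg.2 h1)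
        have b2 := mul_le_mul_of_nonneg_left a2 h0
        linarith
      have h3 := hTT _ _ this
      rwa [← sub_add] at h3
    have hl : HasDerivAt (fun s : ℝ => (2 * K + 1) • x - P x + s • (P x - p)) (P x - p) 0 := by
      simpa using ((hasDerivAt_id (0:ℝ)).smul_const (P x - p)).const_add ((2 * K + 1) • x - P x)
    have hcomp : HasDerivWithinAt (fun s : ℝ => T ((2 * K + 1) • x - P x + s • (P x - p))) (A (P x - p)) (Icc 0 1) 0 := by
      have hTd' : HasFDerivAt T (A : Euc d →L[ℝ] Euc d) ((2 * K + 1) • x - P x + (0:ℝ) • (P x - p)) := by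
        rwa [zero_smul, add_zero]
      exact (hTd'.comp_hasDerivAt (0:ℝ) hl).hasDerivWithinAt
    have hconst : HasDerivWithinAt (fun s : ℝ => T ((2 * K + 1) • x - P x + s • (P x - p))) 0 (Icc 0 1) 0 := by
      refine (hasDerivWithinAt_const (0:ℝ) (Icc 0 1) x).congr (fun s hs => hseg s hs.1 hs.2) (hseg 0 le_rfl zero_le_one)
    have := (uniqueDiffOn_Icc (zero_lt_one (α := ℝ)) 0 (by simp)).eq_deriv _ hcomp hconst
    have h0 : P x - p = 0 := A.map_eq_zero_iff.1 this
    exact (sub_eq_zero.1 h0).symm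
  have hcont : ContinuousAt P x := by
    apply (isCompact_closedBall (0 : Euc d) (2 * C0 + K)).tendsto_nhds_of_unique_mapClusterPt
    · exact Eventually.of_forall fun y => by rw [mem_closedBall_zero_iff]; exact hbd _ _ (hP y)
    · intro p _ hp
      apply huniq
      obtain ⟨U, hU, hUp⟩ := mapClusterPt_iff_ultrafilter.1 hp
      have ht : Tendsto (fun y => (y, P y)) (U : Filter (Euc d)) (nhds (x, p)) :=
        Tendsto.prodMk_nhds (tendsto_id'.2 hU) hUp
      exact hcl.mem_of_tendsto ht (Eventually.of_forall fun y => hP y)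
  have hYc : ContinuousAt (fun y => (2 * K + 1) • y - P y) x := (by fun_prop : ContinuousAt (fun y : Euc d => (2 * K + 1) • y) x).sub hcont
  have hinv : HasFDerivAt (fun y => (2 * K + 1) • y - P y) (A.symm : Euc d →L[ℝ] Euc d) x :=
    HasFDerivAt.of_local_left_inverse (f := T) (g := fun y => (2 * K + 1) • y - P y) hYc hTd (Eventually.of_forall fun y => hTT y (P y) (hP y))
  have hlast : HasFDerivAt P ((2 * K + 1) • ContinuousLinearMap.id ℝ (Euc d) - (A.symm : Euc d →L[ℝ] Euc d)) x := by
    have := ((hasFDerivAt_id x).const_smul (2 * K + 1)).sub hinv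
    refine this.congr_of_eventuallyEq (Eventually.of_forall fun y => ?_)
    simp
  exact ⟨P x, _, alex_of_diff hK hP hlast⟩

end K5

namespace K5
variable {d : ℕ} {H : Phase d → ℝ}

lemma Hp_sub_le (hs : ContDiff ℝ 2 H) (z z' : Phase d) : ‖Hp H z' - Hp H z‖ ≤ ‖fderiv ℝ H z' - fderiv ℝ H z‖ := by
  rcases eq_or_ne (Hp H z' - Hp H z) 0 with h0 | h0
  · rw [h0, norm_zero]; exact norm_nonneg _
  have hn : 0 < ‖Hp H z' - Hp H z‖ := norm_pos_iff.2 h0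
  obtain ⟨w, hw⟩ : ∃ w, w = Hp H z' - Hp H z := ⟨_, rfl⟩
  have h1 : ⟪Hp H z' - Hp H z, w⟫ = (fderiv ℝ H z' - fderiv ℝ H z) (0, w) := by
    rw [inner_sub_left, hp_inner hs, hp_inner hs]; rfl
  rw [← hw, real_inner_self_eq_norm_sq] at h1
  have h2 := (fderiv ℝ H z' - fderiv ℝ H z).le_opNorm (0, w)
  rw [← h1] at h2
  have e : ‖((0 : Euc d), w)‖ = ‖w‖ := by simp [Prod.norm_def]
  rw [e, Real.norm_of_nonneg (by positivity), sq] at h2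
  rw [← hw] at hn ⊢
  exact le_of_mul_le_mul_right h2 hn

lemma Hq_sub_le (hs : ContDiff ℝ 2 H) (z z' : Phase d) : ‖Hq H z' - Hq H z‖ ≤ ‖fderiv ℝ H z' - fderiv ℝ H z‖ := by
  rcases eq_or_ne (Hq H z' - Hq H z) 0 with h0 | h0
  · rw [h0, norm_zero]; exact norm_nonneg _
  have hn : 0 < ‖Hq H z' - Hq H z‖ := norm_pos_iff.2 h0
  obtain ⟨w, hw⟩ : ∃ w, w = Hq H z' - Hq H z := ⟨_, rfl⟩
  have h1 : ⟪Hq H z' - Hq H z, w⟫ = (fderiv ℝ H z' - fderiv ℝ H z) (w, 0) := by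
    rw [inner_sub_left, hq_inner hs, hq_inner hs]; rfl
  rw [← hw, real_inner_self_eq_norm_sq] at h1
  have h2 := (fderiv ℝ H z' - fderiv ℝ H z).le_opNorm (w, 0)
  rw [← h1] at h2
  have e : ‖(w, (0 : Euc d))‖ = ‖w‖ := by simp [Prod.norm_def]
  rw [e, Real.norm_of_nonneg (by positivity), sq] at h2
  rw [← hw] at hn ⊢
  exact le_of_mul_le_mul_right h2 hn

lemma dH_lip (hH : TonelliHam H) {R C : ℝ} (hC : ∀ z : Phase d, ‖z.2‖ ≤ R → ‖BB H z‖ ≤ C)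
    (z z' : Phase d) (hz : ‖z.2‖ ≤ R) (hz' : ‖z'.2‖ ≤ R) : ‖fderiv ℝ H z' - fderiv ℝ H z‖ ≤ C * ‖z' - z‖ :=
  slab_lip ((contDiff_fderivH hH.smooth).differentiable (by norm_num)) hC z z' hz hz'

lemma BB_upper_aux {C : ℝ} (b : Phase d →L[ℝ] Phase d →L[ℝ] ℝ) (ζ : Phase d) (hC : ‖b‖ ≤ C) :
    |b ζ ζ| ≤ C * ‖ζ‖ ^ 2 := by
  have b1 := b.le_opNorm₂ ζ ζ
  have k1 : ‖b‖ * ‖ζ‖ * ‖ζ‖ ≤ C * ‖ζ‖ * ‖ζ‖ := by gcongr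
  rw [Real.norm_eq_abs] at b1
  linarith

/-- algebra of the second variation -/
lemma sq_complete (hs : ContDiff ℝ 2 H) {z0 : Phase d} {J P J' P' D : Euc d} {ρ B Q : ℝ}
    (hcv : ∀ w : Euc d, 0 ≤ BB H z0 (0, w) (0, w))
    (hJ : ‖J‖ ≤ B) (hP : ‖P‖ ≤ B) (hD : ‖D‖ ≤ Q) (hρ : 0 ≤ ρ)
    (h1 : ∀ w, |⟪J', w⟫ - BB H z0 (J, P) (0, w)| ≤ ρ * ‖w‖)
    (h2 : ∀ w, |⟪P', w⟫ + BB H z0 (J, P) (w, 0)| ≤ ρ * ‖w‖) :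
    2 * ⟪D, J'⟫ - BB H z0 (J, D) (J, D) ≤ ⟪P, J'⟫ + ⟪P', J⟫ + ρ * (2 * Q + 4 * B) := by
  have e1 : ((J, D) : Phase d) = (J, P) + (0, D - P) := by simp
  have e2 : ((J, P) : Phase d) = (J, 0) + (0, P) := by simp
  have s1 := BB_symm hs z0 (0, D - P) (J, P)
  have c1 := hcv (D - P)
  have i1 : BB H z0 (J, D) (J, D) = BB H z0 (J, P) (J, P) + 2 * BB H z0 (J, P) (0, D - P)
      + BB H z0 (0, D - P) (0, D - P) := by
    rw [e1]; simp only [map_add, _root_.add_apply]; rw [s1]; ring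
  have i2 : BB H z0 (J, P) (J, P) = BB H z0 (J, P) (J, 0) + BB H z0 (J, P) (0, P) := by
    conv_lhs => rw [show BB H z0 (J, P) (J, P) = BB H z0 (J, P) ((J, 0) + (0, P)) by rw [← e2]]
    rw [map_add]
  have a1 := (abs_le.1 (h1 (D - P))).2
  have a2 := (abs_le.1 (h1 P)).2
  have a3 := (abs_le.1 (h2 J)).2
  have a2' := (abs_le.1 (h1 P)).1
  have a3' := (abs_le.1 (h2 J)).1
  have n1 : ρ * ‖D - P‖ ≤ ρ * (Q + B) := by
    apply mul_le_mul_of_nonneg_left _ hρ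
    exact (norm_sub_le _ _).trans (add_le_add hD hP)
  have n2 : ρ * ‖P‖ ≤ ρ * B := by gcongr
  have n3 : ρ * ‖J‖ ≤ ρ * B := by gcongr
  rw [inner_sub_right] at a1
  have c2 := real_inner_comm J' D
  have c3 := real_inner_comm J' P
  have c4 := real_inner_comm P' J
  linarith

lemma good_sd (hH : TonelliHam H) (R B ε : ℝ) (hB : 0 < B) (hε : 0 < ε) : ∃ κ : ℝ, 0 < κ ∧ κ ≤ 1 ∧
    ∀ x0 p0 x v J P J' P' η : Euc d, ∀ h : ℝ, ‖p0‖ ≤ R → ‖x - x0‖ ≤ κ → ‖v - Hp H (x0, p0)‖ ≤ κ →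
      ‖J‖ ≤ B → ‖P‖ ≤ B → ‖J'‖ ≤ B → ‖η - J'‖ ≤ κ → 0 < h → h ≤ κ →
      (∀ w, |⟪J', w⟫ - BB H (x0, p0) (J, P) (0, w)| ≤ κ * ‖w‖) →
      (∀ w, |⟪P', w⟫ + BB H (x0, p0) (J, P) (w, 0)| ≤ κ * ‖w‖) →
      LegendreL H (x + h • J, v + h • η) + LegendreL H (x - h • J, v - h • η) - 2 * LegendreL H (x, v)
        ≤ h ^ 2 * (⟪P, J'⟫ + ⟪P', J⟫ + ε) := by
  obtain ⟨C0, _, hC0, -, hb0⟩ := bounds hH R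
  obtain ⟨R1, hR1, hRb⟩ := leg_bound hH (C0 + B + 3)
  obtain ⟨R2, hR2⟩ : ∃ R2, R2 = max R R1 := ⟨_, rfl⟩
  have hRR : R ≤ R2 := by rw [hR2]; exact le_max_left _ _
  have hRR1 : R1 ≤ R2 := by rw [hR2]; exact le_max_right _ _
  obtain ⟨C, c, hC, hc, hb⟩ := bounds hH R2
  have hbB : ∀ z : Phase d, ‖z.2‖ ≤ R2 → ‖BB H z‖ ≤ C := fun z hz => (hb z hz).2.2.1
  have hcc : ∀ z : Phase d, ‖z.2‖ ≤ R2 → ∀ w : Euc d, c * ‖w‖ ^ 2 ≤ BB H z (0, w) (0, w) := fun z hz => (hb z hz).2.2.2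
  have hHpl : ∀ x y p : Euc d, ‖p‖ ≤ R2 → ‖Hp H (y, p) - Hp H (x, p)‖ ≤ C * ‖y - x‖ := by
    intro x y p hp
    have h1 := (Hp_sub_le hH.smooth (x, p) (y, p)).trans (dH_lip hH hbB (x, p) (y, p) hp hp)
    have e : ‖((y, p) - (x, p) : Phase d)‖ = ‖y - x‖ := by simp [Prod.norm_def]
    rwa [e] at h1
  obtain ⟨D, hD⟩ : ∃ D, D = (B + 1 + C * B) / c := ⟨_, rfl⟩
  have hD0 : 0 < D := by rw [hD]; positivity
  obtain ⟨Q, hQ⟩ : ∃ Q, Q = B + D := ⟨_, rfl⟩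
  have hQ0 : 0 < Q := by rw [hQ]; positivity
  obtain ⟨δ0, hδ0, huc⟩ := per_ucont (cont_BB hH.smooth) (perBB hH) R (ε / (3 * Q ^ 2)) (by positivity)
  obtain ⟨E, hE⟩ : ∃ E, E = (B + 2 + C * (1 + B)) / c := ⟨_, rfl⟩
  have hE0 : 0 < E := by rw [hE]; positivity
  obtain ⟨κ, hκ⟩ : ∃ κ, κ = min 1 (min (δ0 / (2 * (1 + B + E))) (min (ε / (6 * D)) (ε / (3 * (2 * D + 4 * B))))) := ⟨_, rfl⟩
  have k0 : 0 < κ := by rw [hκ]; positivity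
  have k1 : κ ≤ 1 := by rw [hκ]; exact min_le_left _ _
  have k2 : κ * (2 * (1 + B + E)) ≤ δ0 := by
    have : κ ≤ δ0 / (2 * (1 + B + E)) := by rw [hκ]; exact (min_le_right _ _).trans (min_le_left _ _)
    rwa [le_div_iff₀ (by positivity)] at this
  have k3 : κ * (6 * D) ≤ ε := by
    have : κ ≤ ε / (6 * D) := by
      rw [hκ]; exact (min_le_right _ _).trans ((min_le_right _ _).trans (min_le_left _ _))
    rwa [le_div_iff₀ (by positivity)] at this
  have k4 : κ * (3 * (2 * D + 4 * B)) ≤ ε := by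
    have : κ ≤ ε / (3 * (2 * D + 4 * B)) := by
      rw [hκ]; exact (min_le_right _ _).trans ((min_le_right _ _).trans (min_le_right _ _))
    rwa [le_div_iff₀ (by positivity)] at this
  clear hκ
  refine ⟨κ, k0, k1, ?_⟩
  intro x0 p0 x v J P J' P' η h hp0 hx hv hJ hP hJ' hη h0 hh h1 h2
  have hη' : ‖η‖ ≤ B + 1 := by
    have := norm_add_le (η - J') J'
    rw [sub_add_cancel] at this; linarith
  have hhη : ‖h • η‖ ≤ h * (B + 1) := by
    rw [norm_smul, Real.norm_of_nonneg h0.le]; gcongr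
  have hhJ : ‖h • J‖ ≤ h * B := by
    rw [norm_smul, Real.norm_of_nonneg h0.le]; gcongr
  have hhB : h * B ≤ κ * B := by gcongr
  have hhB1 : h * (B + 1) ≤ κ * (B + 1) := by gcongr
  have hkB : κ * B ≤ 1 * B := by gcongr
  have hv0 : ‖v‖ ≤ C0 + 1 := by
    have := norm_add_le (v - Hp H (x0, p0)) (Hp H (x0, p0))
    rw [sub_add_cancel] at this
    have := norm_Hp_le hH.smooth (x0, p0)
    have := (hb0 (x0, p0) hp0).2.1
    linarith
  obtain ⟨pp, hpp⟩ := leg_exists hH (x + h • J) (v + h • η)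
  obtain ⟨pm, hpm⟩ := leg_exists hH (x - h • J) (v - h • η)
  have bpp : ‖pp‖ ≤ R2 := (hRb _ _ pp ((norm_add_le _ _).trans (by linarith)) hpp).trans hRR1
  have bpm : ‖pm‖ ≤ R2 := (hRb _ _ pm ((norm_sub_le _ _).trans (by linarith)) hpm).trans hRR1
  have bp0 : ‖p0‖ ≤ R2 := hp0.trans hRR
  have near : ∀ (s : ℝ) (q : Euc d), |s| = 1 → ‖q‖ ≤ R2 → Hp H (x + s • h • J, q) = v + s • h • η → ‖q - p0‖ ≤ κ * E := by
    intro s q hs hq hHq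
    have i1 := leg_near hH.smooth hc hcc (x + s • h • J) p0 q bp0 hq
    refine i1.trans ?_
    rw [hE, ← mul_div_assoc]
    gcongr
    have i2 := hHpl (x + s • h • J) x0 p0 bp0
    have e : Hp H (x + s • h • J, q) - Hp H (x + s • h • J, p0) =
      (v - Hp H (x0, p0)) + s • h • η + (Hp H (x0, p0) - Hp H (x + s • h • J, p0)) := by rw [hHq]; abel
    rw [e]
    have n1 : ‖s • h • η‖ ≤ κ * (B + 1) := by
      rw [norm_smul, Real.norm_eq_abs, hs, one_mul]; exact hhη.trans hhB1
    have n2 : ‖x0 - (x + s • h • J)‖ ≤ κ * (1 + B) := by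
      have : x0 - (x + s • h • J) = -((x - x0) + s • h • J) := by abel
      rw [this, norm_neg]
      refine (norm_add_le _ _).trans ?_
      rw [norm_smul, Real.norm_eq_abs, hs, one_mul]; linarith
    have n3 : C * ‖x0 - (x + s • h • J)‖ ≤ C * (κ * (1 + B)) := by gcongr
    refine (norm_add₃_le).trans ?_
    linarith
  have np := near 1 pp (by simp) bpp (by simpa using hpp)
  have nm := near (-1) pm (by simp) bpm (by simpa [← sub_eq_add_neg] using hpm)
  -- pp - pm
  obtain ⟨δ, hδ⟩ : ∃ δ : Euc d, δ = (1/2 : ℝ) • (pp - pm) := ⟨_, rfl⟩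
  have hδb : ‖δ‖ ≤ h * D := by
    have i1 := leg_near hH.smooth hc hcc (x + h • J) pm pp bpm bpp
    have i2 := hHpl (x + h • J) (x - h • J) pm bpm
    have e : Hp H (x + h • J, pp) - Hp H (x + h • J, pm) =
      (2:ℝ) • h • η + (Hp H (x - h • J, pm) - Hp H (x + h • J, pm)) := by rw [hpp, hpm]; module
    have e2 : (x - h • J) - (x + h • J) = -((2:ℝ) • h • J) := by module
    rw [e2, norm_neg, norm_smul, Real.norm_of_nonneg (by norm_num)] at i2
    have n1 : ‖Hp H (x + h • J, pp) - Hp H (x + h • J, pm)‖ ≤ 2 * (h * (B + 1 + C * B)) := by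
      rw [e]
      refine (norm_add_le _ _).trans ?_
      rw [norm_smul, Real.norm_of_nonneg (by norm_num)]
      have n3 : C * (2 * ‖h • J‖) ≤ C * (2 * (h * B)) := by gcongr
      linarith
    have n2 : ‖pp - pm‖ ≤ 2 * (h * (B + 1 + C * B)) / c := i1.trans (by gcongr)
    rw [hδ, norm_smul, Real.norm_of_nonneg (by norm_num), hD, ← mul_div_assoc]
    rw [le_div_iff₀ hc] at n2 ⊢
    linarith
  obtain ⟨D1, hD1⟩ : ∃ D1 : Euc d, D1 = h⁻¹ • δ := ⟨_, rfl⟩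
  have hδD : δ = h • D1 := by rw [hD1, smul_smul, mul_inv_cancel₀ h0.ne', one_smul]
  have hD1b : ‖D1‖ ≤ D := by
    rw [hδD, norm_smul, Real.norm_of_nonneg h0.le] at hδb
    exact le_of_mul_le_mul_left hδb h0
  have hnJD : ‖((J, D1) : Phase d)‖ ≤ Q := by
    rw [Prod.norm_mk, hQ]; exact max_le (by linarith) (by linarith)
  have hsd := leg_sd_raw hH x v (h • J) (h • η) pp pm δ hpp hpm
    (h ^ 2 * (BB H (x0, p0) (J, D1) (J, D1) - ε / 3)) hδ (by
      intro s hs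
      have e : ((h • J, δ) : Phase d) = h • (J, D1) := by rw [hδD]; rfl
      rw [e]
      simp only [map_smul, _root_.smul_apply, smul_eq_mul]
      obtain ⟨zz, hzz⟩ : ∃ zz : Phase d, zz = (x + s • h • J, (1/2 : ℝ) • (pp + pm) + s • δ) := ⟨_, rfl⟩
      rw [← hzz]
      have hs1 : |s| ≤ 1 := abs_le.2 hs
      have hz1 : ‖zz - (x0, p0)‖ < δ0 := by
        have m1 : ‖x + s • h • J - x0‖ ≤ κ * (1 + B) := by
          have : x + s • h • J - x0 = (x - x0) + s • h • J := by abel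
          rw [this]
          refine (norm_add_le _ _).trans ?_
          rw [norm_smul, Real.norm_eq_abs]
          have : |s| * ‖h • J‖ ≤ 1 * (h * B) := by gcongr
          linarith
        have m2 : ‖(1/2 : ℝ) • (pp + pm) + s • δ - p0‖ ≤ κ * E := by
          have : (1/2 : ℝ) • (pp + pm) + s • δ - p0 = ((1 + s) / 2) • (pp - p0) + ((1 - s) / 2) • (pm - p0) := by
            rw [hδ]; module
          rw [this]
          refine (norm_add_le _ _).trans ?_
          rw [norm_smul, norm_smul, Real.norm_of_nonneg (by linarith [hs.1]), Real.norm_of_nonneg (by linarith [hs.2])]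
          have q1 : (1 + s) / 2 * ‖pp - p0‖ ≤ (1 + s) / 2 * (κ * E) :=
            mul_le_mul_of_nonneg_left np (by linarith [hs.1])
          have q2 : (1 - s) / 2 * ‖pm - p0‖ ≤ (1 - s) / 2 * (κ * E) :=
            mul_le_mul_of_nonneg_left nm (by linarith [hs.2])
          linarith
        rw [hzz, Prod.mk_sub_mk, Prod.norm_mk]
        have p1 : 0 < κ * E := by positivity
        have p2 : 0 < κ * (1 + B) := by positivity
        exact max_lt (by linarith) (by linarith)
      have hz2 := (huc (x0, p0) zz hp0 hz1).le
      have hz3 := BB_upper_aux (BB H zz - BB H (x0, p0)) (J, D1) hz2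
      have hz4 : ε / (3 * Q ^ 2) * ‖((J, D1) : Phase d)‖ ^ 2 ≤ ε / 3 := by
        rw [div_mul_eq_mul_div, div_le_iff₀ (by positivity)]
        have : ε * ‖((J, D1) : Phase d)‖ ^ 2 ≤ ε * Q ^ 2 := by gcongr
        linarith
      simp only [_root_.sub_apply] at hz3
      have hz5 := (abs_le.1 hz3).1
      have hz6 : BB H (x0, p0) (J, D1) (J, D1) - ε / 3 ≤ BB H zz (J, D1) (J, D1) := by linarith
      have := mul_le_mul_of_nonneg_left hz6 (sq_nonneg h)
      linarith)
  refine hsd.trans ?_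
  have e3 : ⟪δ, h • η⟫ = h ^ 2 * ⟪D1, η⟫ := by
    rw [hδD, real_inner_smul_left, inner_smul_right]; ring
  rw [e3]
  have fin1 := sq_complete hH.smooth (z0 := (x0, p0)) (J := J) (P := P) (J' := J') (P' := P') (D := D1) (ρ := κ) (B := B) (Q := D)
    (fun w => (by positivity : (0:ℝ) ≤ c * ‖w‖ ^ 2).trans (hcc (x0, p0) bp0 w)) hJ hP hD1b k0.le h1 h2
  have fin2 : ⟪D1, η⟫ ≤ ⟪D1, J'⟫ + D * κ := by
    have := real_inner_le_norm D1 (η - J')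
    have q : ‖D1‖ * ‖η - J'‖ ≤ D * κ := by gcongr
    rw [inner_sub_right] at this; linarith
  have fin3 : 2 * ⟪D1, η⟫ - (BB H (x0, p0) (J, D1) (J, D1) - ε / 3) ≤ ⟪P, J'⟫ + ⟪P', J⟫ + ε := by linarith
  have := mul_le_mul_of_nonneg_left fin3 (sq_nonneg h)
  linarith

end K5

namespace K5
variable {d : ℕ} {H : Phase d → ℝ}

lemma USol.gradb {a : ℝ} {u : Euc d → ℝ} (hu : USol H a u) : ∃ R : ℝ, 0 < R ∧ ∀ x, ‖gradient u x‖ ≤ R :=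
  per_bound0 (F := fun x => gradient u x) (by
    have := hu.c1.continuous_fderiv (by norm_num)
    exact (InnerProductSpace.toDual ℝ (Euc d)).symm.continuous.comp this) (perFun_gradient hu.per)

/-- regularity of the reduced vector field -/
lemma USol.Xreg (hH : TonelliHam H) {a : ℝ} {u : Euc d → ℝ} (hu : USol H a u) : ∃ R K Λ : ℝ, 0 < R ∧ 0 < K ∧ 0 < Λ ∧
    (∀ x, ‖gradient u x‖ ≤ R) ∧
    (∀ x h, |u (x + h) - u x - ⟪gradient u x, h⟫| ≤ K * ‖h‖ ^ 2) ∧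
    (∀ x y, ‖gradient u y - gradient u x‖ ≤ Λ * ‖y - x‖) ∧
    (∀ x, ‖Hp H (x, gradient u x)‖ ≤ Λ) ∧
    (∀ x y, ‖Hp H (y, gradient u y) - Hp H (x, gradient u x)‖ ≤ Λ * ‖y - x‖) := by
  obtain ⟨R, hR, hRb⟩ := hu.gradb
  obtain ⟨K, hK, hKb⟩ := hu.reg hH
  have hl := lip_of_reg hK hKb
  obtain ⟨C, c, hC, hc, hb⟩ := bounds hH R
  refine ⟨R, K, 6 * K + C + C * (1 + 6 * K), hR, hK, by positivity, hRb, hKb, ?_, ?_, ?_⟩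
  · intro x y
    refine (hl x y).trans ?_
    gcongr
    have : 0 < C * (1 + 6 * K) := by positivity
    linarith
  · intro x
    have := (norm_Hp_le hH.smooth (x, gradient u x)).trans (hb (x, gradient u x) (hRb x)).2.1
    have : 0 < C * (1 + 6 * K) := by positivity
    linarith
  · intro x y
    have h1 := (Hp_sub_le hH.smooth (x, gradient u x) (y, gradient u y)).trans
      (dH_lip hH (fun z hz => (hb z hz).2.2.1) (x, gradient u x) (y, gradient u y) (hRb x) (hRb y))
    have h2 : ‖((y, gradient u y) - (x, gradient u x) : Phase d)‖ ≤ (1 + 6 * K) * ‖y - x‖ := by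
      rw [Prod.mk_sub_mk, Prod.norm_mk]
      have h3 := hl x y
      have h4 : 0 ≤ 6 * K * ‖y - x‖ := by positivity
      have h5 := norm_nonneg (y - x)
      exact max_le (by linarith) (by linarith)
    refine h1.trans ?_
    calc C * _ ≤ C * ((1 + 6 * K) * ‖y - x‖) := by gcongr
      _ = (C * (1 + 6 * K)) * ‖y - x‖ := by ring
      _ ≤ _ := by gcongr; linarith

lemma chain_gap (hH : TonelliHam H) {a : ℝ} {u : Euc d → ℝ} (hu : USol H a u) {R K c M : ℝ}
    (hR : ∀ x, ‖gradient u x‖ ≤ R) (hK0 : 0 ≤ K)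
    (hK : ∀ x h, |u (x + h) - u x - ⟪gradient u x, h⟫| ≤ K * ‖h‖ ^ 2)
    (hc : ∀ x v p : Euc d, ‖v‖ ≤ M → ‖p‖ ≤ R → c * ‖v - Hp H (x, p)‖ ^ 2 ≤ LegendreL H (x, v) + H (x, p) - ⟪p, v⟫)
    {lam e τ δ C0 : ℝ} {w : Euc d → ℝ} (hl : 0 ≤ lam) (h0 : 0 < τ) (hw : ∀ x, |w x - u x| ≤ δ) (hwb : ∀ x, |w x| ≤ C0)
    {y v : ℕ → Euc d} (hy : ∀ k, y (k+1) = y k - τ • v k) (hv : ∀ k, ‖v k‖ ≤ M)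
    (hs : ∀ k, Real.exp (-(lam * τ)) * w (y (k+1)) + τ * (LegendreL H (y k, v k) + a) ≤ w (y k) + e) (N : ℕ) :
    c * ∑ k ∈ Finset.range N, τ * ‖v k - Hp H (y k, gradient u (y k))‖ ^ 2 ≤
      2 * δ + N * (lam * τ * C0 + e + K * (τ ^ 2 * M ^ 2)) := by
  have key : ∀ k, c * (τ * ‖v k - Hp H (y k, gradient u (y k))‖ ^ 2) ≤ (w (y k) - u (y k)) - (w (y (k+1)) - u (y (k+1)))
      + (lam * τ * C0 + e + K * (τ ^ 2 * M ^ 2)) := by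
    intro k
    have h1 := hc (y k) (v k) (gradient u (y k)) (hv k) (hR _)
    rw [hu.hj hH] at h1
    have h2 := hs k
    have h3 := (abs_le.1 (hK (y k) (-(τ • v k)))).1
    rw [← sub_eq_add_neg, ← hy k, inner_neg_right, inner_smul_right, norm_neg, norm_smul,
      Real.norm_of_nonneg h0.le, mul_pow] at h3
    have h4 : K * (τ ^ 2 * ‖v k‖ ^ 2) ≤ K * (τ ^ 2 * M ^ 2) := by
      have := hv k
      gcongr
    have h5 := mul_le_mul_of_nonneg_left h1 h0.le
    have h6 : (1 - Real.exp (-(lam * τ))) * w (y (k+1)) ≤ lam * τ * C0 := by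
      have i1 : 1 - lam * τ ≤ Real.exp (-(lam * τ)) := by
        have := Real.add_one_le_exp (-(lam * τ)); linarith
      have i2 : Real.exp (-(lam * τ)) ≤ 1 := by
        rw [Real.exp_le_one_iff]; have := mul_nonneg hl h0.le; linarith
      have i3 := (abs_le.1 (hwb (y (k+1)))).2
      have i4 : 0 ≤ C0 := (abs_nonneg _).trans (hwb (y (k+1)))
      calc _ ≤ (1 - Real.exp (-(lam * τ))) * C0 := mul_le_mul_of_nonneg_left i3 (by linarith)
        _ ≤ _ := mul_le_mul_of_nonneg_right (by linarith) i4
    linarith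
  rw [Finset.mul_sum]
  refine (Finset.sum_le_sum fun k _ => key k).trans ?_
  rw [Finset.sum_add_distrib, Finset.sum_range_sub' (fun k => w (y k) - u (y k)), Finset.sum_const, Finset.card_range, nsmul_eq_mul]
  have i1 := (abs_le.1 (hw (y 0))).2
  have i2 := (abs_le.1 (hw (y N))).1
  linarith

lemma disc_gronwall {α b : ℕ → ℝ} {τ Λ : ℝ} (hτ : 0 ≤ τ) (hΛ : 0 ≤ Λ) (h0 : α 0 = 0) (hb : ∀ k, 0 ≤ b k) (N : ℕ)
    (h : ∀ k < N, α (k+1) ≤ (1 + τ * Λ) * α k + b k) :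
    ∀ k ≤ N, α k ≤ Real.exp (N * τ * Λ) * ∑ j ∈ Finset.range N, b j := by
  have hq : 1 ≤ 1 + τ * Λ := by have := mul_nonneg hτ hΛ; linarith
  have key : ∀ k ≤ N, α k ≤ (1 + τ * Λ) ^ k * ∑ j ∈ Finset.range k, b j := by
    intro k
    induction k with
    | zero => intro _; simp [h0]
    | succ k ih =>
      intro hk
      have h1 := h k hk
      have h2 := mul_le_mul_of_nonneg_left (ih (by omega)) (by linarith : 0 ≤ 1 + τ * Λ)
      have h3 : b k ≤ (1 + τ * Λ) ^ (k+1) * b k := le_mul_of_one_le_left (hb k) (one_le_pow₀ hq)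
      rw [Finset.sum_range_succ, mul_add]
      have h4 : (1 + τ * Λ) * ((1 + τ * Λ) ^ k * ∑ j ∈ Finset.range k, b j) = (1 + τ * Λ) ^ (k+1) * ∑ j ∈ Finset.range k, b j := by ring
      linarith
  intro k hk
  refine (key k hk).trans ?_
  have h1 : (1 + τ * Λ) ^ k ≤ Real.exp (N * τ * Λ) := by
    calc _ ≤ (1 + τ * Λ) ^ N := pow_le_pow_right₀ hq hk
      _ ≤ (Real.exp (τ * Λ)) ^ N := by
        gcongr
        have := Real.add_one_le_exp (τ * Λ); linarith
      _ = _ := by rw [← Real.exp_nat_mul]; ring_nf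
  have h2 : ∑ j ∈ Finset.range k, b j ≤ ∑ j ∈ Finset.range N, b j :=
    Finset.sum_le_sum_of_subset_of_nonneg (Finset.range_mono hk) fun j _ _ => hb j
  have h3 : 0 ≤ ∑ j ∈ Finset.range k, b j := Finset.sum_nonneg fun j _ => hb j
  exact mul_le_mul h1 h2 h3 (Real.exp_pos _).le

lemma track (hH : TonelliHam H) {a : ℝ} {u : Euc d → ℝ} (hu : USol H a u) (M C0 t : ℝ) (hM : 0 < M) (hC0 : 0 ≤ C0) (ht : 0 < t)
    (γ : ℝ → Euc d) (A : ℝ)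
    (hγ : ∀ s τ, -t ≤ s - τ → s ≤ 0 → 0 ≤ τ → ‖γ (s - τ) - γ s + τ • Hp H (γ s, gradient u (γ s))‖ ≤ A * τ ^ 2) (hA : 0 ≤ A)
    (κ : ℝ) (hκ : 0 < κ) : ∃ δ : ℝ, 0 < δ ∧ ∀ (lam e τ : ℝ) (N : ℕ) (w : Euc d → ℝ) (y v : ℕ → Euc d),
      0 ≤ lam → lam ≤ δ → 0 < τ → τ ≤ δ → N * τ = t → e ≤ δ * τ → (∀ x, |w x - u x| ≤ δ) → (∀ x, |w x| ≤ C0) →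
      y 0 = γ 0 → (∀ k, y (k+1) = y k - τ • v k) → (∀ k, ‖v k‖ ≤ M) →
      (∀ k, Real.exp (-(lam * τ)) * w (y (k+1)) + τ * (LegendreL H (y k, v k) + a) ≤ w (y k) + e) →
      (∀ k ≤ N, ‖y k - γ (-(k * τ))‖ ≤ κ) ∧
        ∑ k ∈ Finset.range N, τ * ‖v k - Hp H (y k, gradient u (y k))‖ ^ 2 ≤ κ := by
  obtain ⟨R, K, Λ, hR, hK, hΛ, hRb, hKb, -, -, hXl⟩ := hu.Xreg hH
  obtain ⟨c, hc, hgap⟩ := leg_gap hH M R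
  obtain ⟨E, hE⟩ : ∃ E, E = Real.exp (t * Λ) := ⟨_, rfl⟩
  have hE0 : 0 < E := by rw [hE]; exact Real.exp_pos _
  -- target bound for the sum of squares
  obtain ⟨σ, hσ⟩ : ∃ σ, σ = min κ (κ ^ 2 / (4 * E ^ 2 * t)) := ⟨_, rfl⟩
  have hσ0 : 0 < σ := by rw [hσ]; positivity
  have hσ1 : σ ≤ κ := by rw [hσ]; exact min_le_left _ _
  have hσ2 : σ * (4 * E ^ 2 * t) ≤ κ ^ 2 := by
    have : σ ≤ κ ^ 2 / (4 * E ^ 2 * t) := by rw [hσ]; exact min_le_right _ _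
    rwa [le_div_iff₀ (by positivity)] at this
  obtain ⟨Q, hQ⟩ : ∃ Q, Q = 2 + t * (C0 + 1 + K * M ^ 2) := ⟨_, rfl⟩
  have hQ0 : 0 < Q := by rw [hQ]; positivity
  obtain ⟨δ, hδ⟩ : ∃ δ, δ = min (c * σ / Q) (κ / (2 * E * t * (A + 1))) := ⟨_, rfl⟩
  have hδ0 : 0 < δ := by rw [hδ]; positivity
  have hδ1 : δ * Q ≤ c * σ := by
    have : δ ≤ c * σ / Q := by rw [hδ]; exact min_le_left _ _
    rwa [le_div_iff₀ (by positivity)] at this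
  have hδ2 : δ * (2 * E * t * (A + 1)) ≤ κ := by
    have : δ ≤ κ / (2 * E * t * (A + 1)) := by rw [hδ]; exact min_le_right _ _
    rwa [le_div_iff₀ (by positivity)] at this
  clear hδ hσ
  refine ⟨δ, hδ0, ?_⟩
  intro lam e τ N w y v hl hlδ h0 hτ hN he hwu hwb hy0 hy hv hs
  have g1 := chain_gap hH hu hRb hK.le hKb hgap hl h0 hwu hwb hy hv hs N
  obtain ⟨b, hb⟩ : ∃ b : ℕ → ℝ, ∀ k, b k = ‖v k - Hp H (y k, gradient u (y k))‖ := ⟨_, fun _ => rfl⟩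
  have hb0 : ∀ k, 0 ≤ b k := fun k => by rw [hb]; exact norm_nonneg _
  simp only [← hb] at g1 ⊢
  have hNN : (0:ℝ) ≤ N := Nat.cast_nonneg _
  have g2 : ∑ k ∈ Finset.range N, τ * b k ^ 2 ≤ σ := by
    have e1 : (N:ℝ) * (lam * τ * C0 + e + K * (τ ^ 2 * M ^ 2)) ≤ N * (δ * τ * C0 + δ * τ + K * (δ * τ * M ^ 2)) := by
      have i1 : lam * τ * C0 ≤ δ * τ * C0 := by gcongr
      have i2 : τ ^ 2 ≤ δ * τ := by rw [sq]; gcongr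
      have i3 : K * (τ ^ 2 * M ^ 2) ≤ K * (δ * τ * M ^ 2) := by gcongr
      apply mul_le_mul_of_nonneg_left _ hNN
      linarith
    have e2 : (N:ℝ) * (δ * τ * C0 + δ * τ + K * (δ * τ * M ^ 2)) = δ * (t * (C0 + 1 + K * M ^ 2)) := by
      rw [← hN]; ring
    have e3 : c * ∑ k ∈ Finset.range N, τ * b k ^ 2 ≤ c * σ := by
      rw [hQ] at hδ1; linarith
    exact le_of_mul_le_mul_left e3 hc
  refine ⟨?_, g2.trans hσ1⟩
  -- Cauchy-Schwarz
  have g3 : ∑ k ∈ Finset.range N, τ * b k ≤ κ / (2 * E) := by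
    have cs2 : (∑ k ∈ Finset.range N, b k) ^ 2 ≤ N * ∑ k ∈ Finset.range N, b k ^ 2 := by
      simpa using sq_sum_le_card_mul_sum_sq (s := Finset.range N) (f := b)
    have cs3 : (∑ k ∈ Finset.range N, τ * b k) ^ 2 ≤ (κ / (2 * E)) ^ 2 := by
      rw [← Finset.mul_sum, mul_pow]
      have i1 := mul_le_mul_of_nonneg_left cs2 (sq_nonneg τ)
      have i2 : τ ^ 2 * (N * ∑ k ∈ Finset.range N, b k ^ 2) = t * ∑ k ∈ Finset.range N, τ * b k ^ 2 := by
        rw [← hN, ← Finset.mul_sum]; ring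
      have i3 : t * ∑ k ∈ Finset.range N, τ * b k ^ 2 ≤ t * σ := by gcongr
      have i4 : t * σ ≤ (κ / (2 * E)) ^ 2 := by
        rw [div_pow, le_div_iff₀ (by positivity)]; linarith
      linarith
    exact le_of_sq_le_sq cs3 (by positivity)
  have gr := disc_gronwall (α := fun k => ‖y k - γ (-(k * τ))‖) (b := fun k => τ * b k + A * τ ^ 2) h0.le hΛ.le
    (by simp [hy0]) (fun k => by have := hb0 k; positivity) N (by
      intro k hk
      have hk' : ((k:ℝ) + 1) * τ ≤ t := by
        rw [← hN]; gcongr; exact_mod_cast hk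
      have hγk := hγ (-(k * τ)) τ (by linarith) (by have : 0 ≤ (k:ℝ) * τ := by positivity
                                                    linarith) h0.le
      have hxl := hXl (γ (-(k * τ))) (y k)
      have e1 : -(((k+1 : ℕ) : ℝ) * τ) = -(k * τ) - τ := by push_cast; ring
      rw [e1, hy k]
      obtain ⟨g, hg⟩ : ∃ g, g = γ (-(k * τ)) := ⟨_, rfl⟩
      rw [← hg] at hγk hxl ⊢
      obtain ⟨X1, hX1⟩ : ∃ X1, X1 = Hp H (g, gradient u g) := ⟨_, rfl⟩
      obtain ⟨X2, hX2⟩ : ∃ X2, X2 = Hp H (y k, gradient u (y k)) := ⟨_, rfl⟩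
      have hbk := hb k
      rw [← hX1] at hγk hxl
      rw [← hX2] at hxl hbk
      have e2 : y k - τ • v k - γ (-(k * τ) - τ) = (y k - g) - τ • (X2 - X1) - τ • (v k - X2) - (γ (-(k * τ) - τ) - g + τ • X1) := by
        module
      rw [e2]
      have n1 : ‖τ • (X2 - X1)‖ ≤ τ * (Λ * ‖y k - g‖) := by
        rw [norm_smul, Real.norm_of_nonneg h0.le]; gcongr
      have n2 : ‖τ • (v k - X2)‖ = τ * b k := by
        rw [norm_smul, Real.norm_of_nonneg h0.le, hbk]
      have n3 := norm_sub_le ((y k - g) - τ • (X2 - X1) - τ • (v k - X2)) (γ (-(k * τ) - τ) - g + τ • X1)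
      have n4 := norm_sub_le ((y k - g) - τ • (X2 - X1)) (τ • (v k - X2))
      have n5 := norm_sub_le (y k - g) (τ • (X2 - X1))
      linarith)
  intro k hk
  refine (gr k hk).trans ?_
  rw [hN, ← hE, Finset.sum_add_distrib, Finset.sum_const, Finset.card_range, nsmul_eq_mul]
  have f1 : (N:ℝ) * (A * τ ^ 2) ≤ t * A * δ := by
    have : (N:ℝ) * (A * τ ^ 2) = t * A * τ := by rw [← hN]; ring
    rw [this]; gcongr
  have f2 : E * (t * A * δ) ≤ κ / 2 := by
    have : 0 < δ * (2 * E * t) := by positivity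
    linarith
  have f3 : E * ∑ k ∈ Finset.range N, τ * b k ≤ κ / 2 := by
    have := mul_le_mul_of_nonneg_left g3 hE0.le
    have e : E * (κ / (2 * E)) = κ / 2 := by field_simp
    linarith
  have f4 := mul_le_mul_of_nonneg_left f1 hE0.le
  rw [mul_add]
  linarith

end K5

namespace K5
variable {d : ℕ} {H : Phase d → ℝ}

lemma c1_step {E : Type*} [NormedAddCommGroup E] [NormedSpace ℝ E] {f f' : ℝ → E}
    (hf : ∀ s, HasDerivAt f (f' s) s) (hc : Continuous f') (t : ℝ) {ω : ℝ} (hω : 0 < ω) :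
    ∃ δ > (0:ℝ), ∀ s τ, s ≤ 0 → 0 ≤ τ → τ ≤ δ → -t ≤ s - τ → ‖f s - f (s - τ) - τ • f' s‖ ≤ ω * τ := by
  have huc := (isCompact_Icc (a := -t) (b := (0:ℝ))).uniformContinuousOn_of_continuous hc.continuousOn
  obtain ⟨δ, hδ, h⟩ := Metric.uniformContinuousOn_iff.1 huc ω hω
  refine ⟨δ / 2, by positivity, fun s τ hs h0 hτ hst => ?_⟩
  have hd : ∀ r ∈ Icc (s - τ) s, HasDerivWithinAt (fun r => f r - r • f' s) (f' r - f' s) (Icc (s - τ) s) r := by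
    intro r hr
    have := ((hf r).sub ((hasDerivAt_id r).smul_const (f' s))).hasDerivWithinAt (s := Icc (s - τ) s)
    rw [one_smul] at this
    exact this
  have hb : ∀ r ∈ Icc (s - τ) s, ‖f' r - f' s‖ ≤ ω := by
    intro r hr
    have := h r ⟨by linarith [hr.1], by linarith [hr.2]⟩ s ⟨by linarith, hs⟩ (by
      rw [Real.dist_eq, abs_lt]; constructor <;> linarith [hr.1, hr.2])
    rw [dist_eq_norm] at this
    exact this.le
  have := (convex_Icc (s - τ) s).norm_image_sub_le_of_norm_hasDerivWithin_le hd hb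
    (x := s - τ) (y := s) ⟨le_rfl, by linarith⟩ ⟨by linarith, le_rfl⟩
  have e : f s - s • f' s - (f (s - τ) - (s - τ) • f' s) = f s - f (s - τ) - τ • f' s := by module
  rw [e] at this
  have e2 : ‖s - (s - τ)‖ = τ := by rw [sub_sub_cancel, Real.norm_of_nonneg h0]
  rwa [e2] at this

lemma telescope {Φ f : ℝ → ℝ} {τ ω : ℝ} (N : ℕ)
    (h : ∀ k < N, |Φ (-(k * τ)) - Φ (-(((k+1:ℕ):ℝ) * τ)) - τ * f (-(k * τ))| ≤ ω * τ) :
    ∑ k ∈ Finset.range N, τ * f (-(k * τ)) ≤ Φ 0 - Φ (-(N * τ)) + N * (ω * τ) := by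
  have h1 : ∀ k ∈ Finset.range N, τ * f (-(k * τ)) ≤ -(Φ (-(((k+1:ℕ):ℝ) * τ)) - Φ (-(k * τ))) + ω * τ := by
    intro k hk
    have := (abs_le.1 (h k (Finset.mem_range.1 hk))).1
    linarith
  refine (Finset.sum_le_sum h1).trans (le_of_eq ?_)
  rw [Finset.sum_add_distrib, Finset.sum_neg_distrib, Finset.sum_range_sub (fun k : ℕ => Φ (-((k:ℝ) * τ)))]
  simp

lemma main_sum (hH : TonelliHam H) {a : ℝ} {u : Euc d → ℝ} (hu : USol H a u) {t B ε : ℝ} (ht : 0 < t)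
    (hB : 0 < B) (hε : 0 < ε) {M C C0 : ℝ} (hM : 0 < M) (hC : 0 < C) (hC0 : 0 < C0) : ∃ ρ > (0:ℝ), 
    ∀ (γ J P J' P' : ℝ → Euc d) (A q : ℝ), 0 ≤ A →
    (∀ s τ, -t ≤ s - τ → s ≤ 0 → 0 ≤ τ → ‖γ (s - τ) - γ s + τ • Hp H (γ s, gradient u (γ s))‖ ≤ A * τ ^ 2) →
    (∀ s, HasDerivAt J (J' s) s) → (∀ s, HasDerivAt P (P' s) s) → Continuous J' → Continuous P' →
    (∀ s, -t ≤ s → s ≤ 0 → ‖J s‖ ≤ B ∧ ‖P s‖ ≤ B ∧ ‖J' s‖ ≤ B ∧ ‖P' s‖ ≤ B) →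
    (∀ s, -t ≤ s → s ≤ 0 → ∀ w, |⟪J' s, w⟫ - BB H (γ s, gradient u (γ s)) (J s, P s) (0, w)| ≤ ρ * ‖w‖) →
    (∀ s, -t ≤ s → s ≤ 0 → ∀ w, |⟪P' s, w⟫ + BB H (γ s, gradient u (γ s)) (J s, P s) (w, 0)| ≤ ρ * ‖w‖) →
    J (-t) = 0 → ⟪P 0, J 0⟫ ≤ q →
    ∃ δ > (0:ℝ), ∀ lam w h, 0 ≤ lam → lam ≤ δ → Dom H a lam C (M + 1) w → StepE H a lam M w →
      (∀ x, |w x - u x| ≤ δ) → (∀ x, |w x| ≤ C0) → 0 < h → h ≤ δ →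
      w (γ 0 + h • J 0) + w (γ 0 - h • J 0) - 2 * w (γ 0) ≤ h ^ 2 * (q + ε) := by
  obtain ⟨R, K, Λ, hR, hK, hΛ, hRb, -, -, -, hX⟩ := hu.Xreg hH
  obtain ⟨Cs, hCs, hcr⟩ := leg_sd_crude hH M
  obtain ⟨κ, hκ, hκ1, hgood⟩ := good_sd hH R B (ε / (8 * t)) hB (by positivity)
  refine ⟨κ, hκ, fun γ J P J' P' A q hA hγ hJd hPd hJc hPc hbd hJe hPe hJt hq => ?_⟩
  obtain ⟨E, hE⟩ : ∃ E, E = (Cs * (B ^ 2 + (B + 1) ^ 2) + 2 * B ^ 2) / (κ / 2) ^ 2 := ⟨_, rfl⟩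
  have hE0 : 0 < E := by rw [hE]; positivity
  obtain ⟨κ2, hκ2⟩ : ∃ κ2, κ2 = min (κ / (2 * (1 + Λ))) (ε / (8 * E)) := ⟨_, rfl⟩
  have hκ20 : 0 < κ2 := by rw [hκ2]; positivity
  have hκ2a : κ2 * (1 + Λ) ≤ κ / 2 := by
    have : κ2 ≤ κ / (2 * (1 + Λ)) := hκ2 ▸ min_le_left _ _
    calc κ2 * (1 + Λ) ≤ κ / (2 * (1 + Λ)) * (1 + Λ) := by gcongr
      _ = κ / 2 := by field_simp
  have hκ2b : E * κ2 ≤ ε / 8 := by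
    have : κ2 ≤ ε / (8 * E) := hκ2 ▸ min_le_right _ _
    calc E * κ2 ≤ E * (ε / (8 * E)) := by gcongr
      _ = ε / 8 := by field_simp
  obtain ⟨δ1, hδ1, htr⟩ := track hH hu M C0 t hM hC0.le ht γ A hγ hA κ2 hκ20
  obtain ⟨δJ, hδJ, hJs⟩ := c1_step hJd hJc t (ω := min κ 1) (by positivity)
  obtain ⟨δP, hδP, hPs⟩ := c1_step (f := fun s => ⟪P s, J s⟫) (f' := fun s => ⟪P s, J' s⟫ + ⟪P' s, J s⟫)
    (fun s => (hPd s).inner ℝ (hJd s))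
    (by
      have c1 : Continuous P := continuous_iff_continuousAt.2 fun s => (hPd s).continuousAt
      have c2 : Continuous J := continuous_iff_continuousAt.2 fun s => (hJd s).continuousAt
      fun_prop) t (ω := ε / (8 * t)) (by positivity)
  refine ⟨min δ1 (min (κ / (B + 1)) (min (1 / (B + 1)) (min κ (ε / (16 * B ^ 2 * t ^ 2))))), by positivity, ?_⟩
  intro lam w h hl0 hl hD hS hwu hwb hh0 hh
  simp only [le_min_iff] at hl hh
  have hB1 : 0 < B + 1 := by linarith
  have hhB : h * (B + 1) ≤ 1 := by
    have := hh.2.2.1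
    rwa [le_div_iff₀ hB1] at this
  -- choose the step
  obtain ⟨ε', hε'⟩ : ∃ ε', ε' = min δ1 (h ^ 2 * ε / (16 * t)) := ⟨_, rfl⟩
  have hε'0 : 0 < ε' := by rw [hε']; positivity
  have hε'1 : ε' ≤ δ1 := hε' ▸ min_le_left _ _
  have hε'2 : ε' * t ≤ h ^ 2 * ε / 16 := by
    have : ε' ≤ h ^ 2 * ε / (16 * t) := hε' ▸ min_le_right _ _
    calc ε' * t ≤ h ^ 2 * ε / (16 * t) * t := by gcongr
      _ = _ := by field_simp
  obtain ⟨τ0, hτ0, hSt⟩ := hS ε' hε'0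
  obtain ⟨m, hm⟩ : ∃ m, m = min δ1 (min δJ (min δP (min 1 (min τ0 (h ^ 2 * ε / (16 * C * t)))))) := ⟨_, rfl⟩
  have hm0 : 0 < m := by rw [hm]; positivity
  obtain ⟨N', hN'⟩ := exists_nat_gt (t / m)
  obtain ⟨N, hN⟩ : ∃ N, N = N' + 1 := ⟨_, rfl⟩
  have hN0 : (0:ℝ) < N := by rw [hN]; positivity
  obtain ⟨τ, hτ⟩ : ∃ τ, τ = t / N := ⟨_, rfl⟩
  have h0 : 0 < τ := by rw [hτ]; positivity
  have hNτ : N * τ = t := by rw [hτ]; field_simp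
  have hτm : τ ≤ m := by
    rw [hτ, div_le_iff₀ hN0]
    rw [div_lt_iff₀ hm0] at hN'
    have : (N:ℝ) = N' + 1 := by rw [hN]; push_cast; ring
    rw [this, mul_add]
    linarith
  rw [hm] at hτm
  simp only [le_min_iff] at hτm
  obtain ⟨hτ1, hτJ, hτP, hτone, hττ0, hτC⟩ := hτm
  have hτC' : C * t * τ ≤ h ^ 2 * ε / 16 := by
    calc C * t * τ ≤ C * t * (h ^ 2 * ε / (16 * C * t)) := by gcongr
      _ = _ := by field_simp
  obtain ⟨y, v, hy0, hy, hv, hst, hsum⟩ := chain_lower hl0 (hSt τ h0 hττ0) (by positivity) h0 (γ 0)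
  obtain ⟨htr1, htr2⟩ := htr lam (ε' * τ) τ N w y v hl0 hl.1 h0 hτ1 hNτ (by gcongr)
    (fun x => (hwu x).trans (min_le_left _ _)) hwb hy0 hy hv hst
  have hkt : ∀ k : ℕ, k ≤ N → -t ≤ -(k * τ) ∧ -(k * τ) ≤ 0 := by
    intro k hk
    have h1 : (k:ℝ) ≤ N := by exact_mod_cast hk
    have h2 : (k:ℝ) * τ ≤ N * τ := by gcongr
    exact ⟨by linarith, by have : 0 ≤ (k:ℝ) * τ := by positivity
                           linarith⟩
  obtain ⟨η, hη⟩ : ∃ η : ℕ → Euc d, ∀ k, η k = τ⁻¹ • (J (-(k * τ)) - J (-(((k+1:ℕ):ℝ) * τ))) := ⟨_, fun _ => rfl⟩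
  have hstep : ∀ k : ℕ, -((k:ℝ) * τ) - τ = -(((k+1:ℕ):ℝ) * τ) := by intro k; push_cast; ring
  have hηJ : ∀ k < N, ‖η k - J' (-(k * τ))‖ ≤ min κ 1 := by
    intro k hk
    have h1 := hJs (-(k * τ)) τ (hkt k hk.le).2 h0.le hτJ (by rw [hstep]; exact (hkt (k+1) hk).1)
    rw [hstep] at h1
    have e : η k - J' (-(k * τ)) = τ⁻¹ • (J (-(k * τ)) - J (-(((k+1:ℕ):ℝ) * τ)) - τ • J' (-(k * τ))) := by
      rw [hη, smul_sub _ _ (τ • _), smul_smul, inv_mul_cancel₀ h0.ne', one_smul]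
    rw [e, norm_smul, norm_inv, Real.norm_of_nonneg h0.le]
    rw [inv_mul_le_iff₀ h0]
    linarith
  have hηb : ∀ k < N, ‖η k‖ ≤ B + 1 := by
    intro k hk
    have h1 := (hηJ k hk).trans (min_le_right _ _)
    have h2 := (hbd _ (hkt k hk.le).1 (hkt k hk.le).2).2.2.1
    have h3 := norm_le_norm_add_norm_sub' (η k) (J' (-(k * τ)))
    linarith
  have hhη : ∀ k < N, ‖h • η k‖ ≤ h * (B + 1) := by
    intro k hk
    rw [norm_smul, Real.norm_of_nonneg hh0.le]
    have := hηb k hk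
    gcongr
  have hτη : ∀ k, τ • η k = J (-(k * τ)) - J (-(((k+1:ℕ):ℝ) * τ)) := by
    intro k; rw [hη, smul_smul, mul_inv_cancel₀ h0.ne', one_smul]
  have hup1 := chain_upper hl0 hD hC.le h0.le hτone (fun k => y k + h • J (-(k * τ))) (fun k => v k + h • η k) N
    (fun k hk => by
      simp only [hy]
      rw [smul_add, smul_comm τ h (η k), hτη]; module)
    (fun k hk => (norm_add_le _ _).trans (add_le_add (hv k) ((hhη k hk).trans hhB)))
  have hup2 := chain_upper hl0 hD hC.le h0.le hτone (fun k => y k - h • J (-(k * τ))) (fun k => v k - h • η k) N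
    (fun k hk => by
      simp only [hy]
      rw [smul_sub, smul_comm τ h (η k), hτη]; module)
    (fun k hk => (norm_sub_le _ _).trans (add_le_add (hv k) ((hhη k hk).trans hhB)))
  have hlow := hsum N
  obtain ⟨r, hr⟩ : ∃ r, r = Real.exp (-(lam * τ)) := ⟨_, rfl⟩
  rw [← hr] at hup1 hup2 hlow
  have hr0 : 0 < r := by rw [hr]; exact Real.exp_pos _
  have hr1 : r ≤ 1 := by rw [hr, Real.exp_le_one_iff]; have := mul_nonneg hl0 h0.le; linarith
  have hrk : ∀ k < N, 1 - r ^ k ≤ lam * t := by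
    intro k hk
    have e : r ^ k = Real.exp (-(lam * (k * τ))) := by rw [hr, ← Real.exp_nat_mul]; congr 1; ring
    have h1 := Real.add_one_le_exp (-(lam * (k * τ)))
    have h2 := mul_le_mul_of_nonneg_left (hkt k hk.le).1 hl0
    rw [e]; linarith
  simp only [hNτ, hJt, smul_zero, add_zero, sub_zero, Nat.cast_zero, zero_mul, neg_zero, hy0] at hup1 hup2
  obtain ⟨f, hf⟩ : ∃ f : ℝ → ℝ, ∀ s, f s = ⟪P s, J' s⟫ + ⟪P' s, J s⟫ := ⟨_, fun _ => rfl⟩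
  have hfb : ∀ k < N, |f (-(k * τ))| ≤ 2 * B ^ 2 := by
    intro k hk
    obtain ⟨b1, b2, b3, b4⟩ := hbd _ (hkt k hk.le).1 (hkt k hk.le).2
    rw [hf]
    refine (abs_add_le _ _).trans ?_
    have h1 := (abs_real_inner_le_norm (P (-(k * τ))) (J' (-(k * τ)))).trans (mul_le_mul b2 b3 (norm_nonneg _) hB.le)
    have h2 := (abs_real_inner_le_norm (P' (-(k * τ))) (J (-(k * τ)))).trans (mul_le_mul b4 b1 (norm_nonneg _) hB.le)
    linarith
  have htel := telescope (Φ := fun s => ⟪P s, J s⟫) (f := f) (τ := τ) (ω := ε / (8 * t)) N (by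
    intro k hk
    have h1 := hPs (-(k * τ)) τ (hkt k hk.le).2 h0.le hτP (by rw [hstep]; exact (hkt (k+1) hk).1)
    rw [hstep] at h1
    rw [hf]
    simpa only [Real.norm_eq_abs, smul_eq_mul] using h1)
  simp only [hNτ, hJt, inner_zero_right, sub_zero] at htel
  have hSD : ∀ k < N, LegendreL H (y k + h • J (-(k * τ)), v k + h • η k) + LegendreL H (y k - h • J (-(k * τ)), v k - h • η k)
      - 2 * LegendreL H (y k, v k) ≤ h ^ 2 * (f (-(k * τ)) + ε / (8 * t) + E * ‖v k - Hp H (y k, gradient u (y k))‖ ^ 2) := by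
    intro k hk
    obtain ⟨b1, b2, b3, b4⟩ := hbd _ (hkt k hk.le).1 (hkt k hk.le).2
    have hyγ := htr1 k hk.le
    by_cases hg : ‖v k - Hp H (y k, gradient u (y k))‖ ≤ κ / 2
    · have h2 := hX (γ (-(k * τ))) (y k)
      have h3 : ‖v k - Hp H (γ (-(k * τ)), gradient u (γ (-(k * τ))))‖ ≤ κ := by
        have h4 := norm_sub_le_norm_sub_add_norm_sub (v k) (Hp H (y k, gradient u (y k))) (Hp H (γ (-(k * τ)), gradient u (γ (-(k * τ)))))
        have h5 : Λ * ‖y k - γ (-(k * τ))‖ ≤ Λ * κ2 := by gcongr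
        linarith
      have h6 : ‖y k - γ (-(k * τ))‖ ≤ κ := by
        have : 0 ≤ κ2 * Λ := by positivity
        linarith
      have := hgood (γ (-(k * τ))) (gradient u (γ (-(k * τ)))) (y k) (v k) (J (-(k * τ))) (P (-(k * τ))) (J' (-(k * τ)))
        (P' (-(k * τ))) (η k) h (hRb _) h6 h3 b1 b2 b3 ((hηJ k hk).trans (min_le_left _ _)) hh0 hh.2.2.2.1
        (hJe _ (hkt k hk.le).1 (hkt k hk.le).2) (hPe _ (hkt k hk.le).1 (hkt k hk.le).2)
      refine this.trans ?_
      rw [← hf]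
      have : 0 ≤ E * ‖v k - Hp H (y k, gradient u (y k))‖ ^ 2 := by positivity
      exact mul_le_mul_of_nonneg_left (by linarith) (sq_nonneg h)
    · push Not at hg
      have h1 := hcr (y k) (v k) (h • J (-(k * τ))) (h • η k) (hv k) ((hhη k hk).trans hhB)
      refine h1.trans ?_
      rw [norm_smul, norm_smul, Real.norm_of_nonneg hh0.le]
      have h2 : Cs * ((h * ‖J (-(k * τ))‖) ^ 2 + (h * ‖η k‖) ^ 2) ≤ Cs * ((h * B) ^ 2 + (h * (B + 1)) ^ 2) := by
        have := hηb k hk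
        gcongr
      have h3 := (abs_le.1 (hfb k hk)).1
      have h4 : Cs * (B ^ 2 + (B + 1) ^ 2) + 2 * B ^ 2 ≤ E * ‖v k - Hp H (y k, gradient u (y k))‖ ^ 2 := by
        calc _ = E * (κ / 2) ^ 2 := by rw [hE]; field_simp
          _ ≤ _ := by gcongr
      have h5 : 0 < ε / (8 * t) := by positivity
      have h6 : Cs * ((h * B) ^ 2 + (h * (B + 1)) ^ 2) = h ^ 2 * (Cs * (B ^ 2 + (B + 1) ^ 2)) := by ring
      rw [h6] at h2
      refine h2.trans ?_
      gcongr
      linarith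
  have hterm : ∀ k ∈ Finset.range N, r ^ k * (τ * (LegendreL H (y k + h • J (-(k * τ)), v k + h • η k) + a)) +
      r ^ k * (τ * (LegendreL H (y k - h • J (-(k * τ)), v k - h • η k) + a)) - 2 * (r ^ k * (τ * (LegendreL H (y k, v k) + a)))
      ≤ h ^ 2 * (τ * f (-(k * τ)) + E * (τ * ‖v k - Hp H (y k, gradient u (y k))‖ ^ 2) + τ * (ε / (8 * t) + lam * t * (2 * B ^ 2))) := by
    intro k hk
    have hk' := Finset.mem_range.1 hk
    have h1 := hSD k hk'
    have hrk0 : 0 < r ^ k := by positivity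
    have hrk1 : r ^ k ≤ 1 := pow_le_one₀ hr0.le hr1
    have h2 := mul_le_mul_of_nonneg_left h1 (mul_nonneg hrk0.le h0.le)
    have h3 : r ^ k * (f (-(k * τ)) + ε / (8 * t) + E * ‖v k - Hp H (y k, gradient u (y k))‖ ^ 2) ≤
        f (-(k * τ)) + E * ‖v k - Hp H (y k, gradient u (y k))‖ ^ 2 + (ε / (8 * t) + lam * t * (2 * B ^ 2)) := by
      have p1 : 0 ≤ E * ‖v k - Hp H (y k, gradient u (y k))‖ ^ 2 := by positivity
      have p2 : 0 < ε / (8 * t) := by positivity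
      have p3 := mul_le_mul_of_nonneg_right hrk1 (add_nonneg p1 p2.le)
      have p4 : (1 - r ^ k) * -f (-(k * τ)) ≤ lam * t * (2 * B ^ 2) := by
        have q1 : (1 - r ^ k) * -f (-(k * τ)) ≤ (1 - r ^ k) * (2 * B ^ 2) :=
          mul_le_mul_of_nonneg_left ((neg_le_abs _).trans (hfb k hk')) (by linarith)
        exact q1.trans (mul_le_mul_of_nonneg_right (hrk k hk') (by positivity))
      linarith
    have h4 := mul_le_mul_of_nonneg_left h3 (mul_nonneg (sq_nonneg h) h0.le)
    linarith
  have hS2 := Finset.sum_le_sum hterm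
  have hS3 : ∑ k ∈ Finset.range N, r ^ k * (τ * (LegendreL H (y k + h • J (-(k * τ)), v k + h • η k) + a)) +
      ∑ k ∈ Finset.range N, r ^ k * (τ * (LegendreL H (y k - h • J (-(k * τ)), v k - h • η k) + a)) -
      2 * ∑ k ∈ Finset.range N, r ^ k * (τ * (LegendreL H (y k, v k) + a)) ≤
      h ^ 2 * (∑ k ∈ Finset.range N, τ * f (-(k * τ)) +
      E * ∑ k ∈ Finset.range N, τ * ‖v k - Hp H (y k, gradient u (y k))‖ ^ 2 + N * (τ * (ε / (8 * t) + lam * t * (2 * B ^ 2)))) := by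
    refine le_trans (le_of_eq ?_) (hS2.trans (le_of_eq ?_))
    · rw [Finset.sum_sub_distrib, Finset.sum_add_distrib, Finset.mul_sum _ _ (2:ℝ)]
    · rw [← Finset.mul_sum]
      congr 1
      rw [Finset.sum_add_distrib, Finset.sum_add_distrib, Finset.mul_sum _ _ E, Finset.sum_const, Finset.card_range, nsmul_eq_mul]
  clear hS2 hterm hSD
  have hlast : ∑ k ∈ Finset.range N, τ * f (-(k * τ)) +
      E * ∑ k ∈ Finset.range N, τ * ‖v k - Hp H (y k, gradient u (y k))‖ ^ 2 + N * (τ * (ε / (8 * t) + lam * t * (2 * B ^ 2)))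
      ≤ q + ε / 2 := by
    have q1 := mul_le_mul_of_nonneg_left htr2 hE0.le
    have q2 : N * (ε / (8 * t) * τ) = ε / 8 := by
      calc _ = (N * τ) * (ε / (8 * t)) := by ring
        _ = _ := by rw [hNτ]; field_simp
    have q3 : N * (τ * (ε / (8 * t) + lam * t * (2 * B ^ 2))) ≤ ε / 8 + ε / 8 := by
      have e : N * (τ * (ε / (8 * t) + lam * t * (2 * B ^ 2))) = N * (ε / (8 * t) * τ) + (N * τ) * (lam * t * (2 * B ^ 2)) := by ring
      rw [e, q2, hNτ]
      have := hl.2.2.2.2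
      have : t * (lam * t * (2 * B ^ 2)) ≤ t * (ε / (16 * B ^ 2 * t ^ 2) * t * (2 * B ^ 2)) := by gcongr
      have e2 : t * (ε / (16 * B ^ 2 * t ^ 2) * t * (2 * B ^ 2)) = ε / 8 := by field_simp; norm_num
      linarith
    linarith
  have hfin := mul_le_mul_of_nonneg_left hlast (sq_nonneg h)
  have e1 : N * (C * τ ^ 2) = C * t * τ := by
    calc _ = C * (N * τ) * τ := by ring
      _ = _ := by rw [hNτ]
  have e2 : N * (ε' * τ) = ε' * t := by
    calc _ = ε' * (N * τ) := by ring
      _ = _ := by rw [hNτ]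
  rw [e1] at hup1 hup2
  rw [e2] at hlow
  have hpos : 0 < h ^ 2 * ε := by positivity
  linarith

end K5

namespace K5
variable {d : ℕ} {H : Phase d → ℝ}

lemma flow_H (hH : TonelliHam H) {φ : ℝ → Phase d → Phase d} (hφ : IsConformalFlow H 0 φ) (z : Phase d) (s : ℝ) :
    H (φ s z) = H z := by
  have h1 : ∀ s, HasDerivAt (fun s => H (φ s z)) 0 s := by
    intro s
    have := (diffH hH.smooth (φ s z)).comp_hasDerivAt s (hφ.2.2 z s)
    refine this.congr_deriv ?_
    have e : hamVF H 0 (φ s z) = (Hp H (φ s z), -Hq H (φ s z)) := by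
      simp [hamVF, Hp, Hq]
    rw [e, dH_eq hH.smooth]
    simp only [inner_neg_right]
    rw [real_inner_comm]; ring
  have h2 := is_const_of_deriv_eq_zero (f := fun s => H (φ s z)) (fun s => (h1 s).differentiableAt) (fun s => (h1 s).deriv) s 0
  simpa [hφ.1] using h2

lemma flow_d {φ : ℝ → Phase d → Phase d} (hφ : IsConformalFlow H 0 φ) (z : Phase d) (s : ℝ) :
    HasDerivAt (fun s => φ s z) (Hp H (φ s z), -Hq H (φ s z)) s := by
  refine (hφ.2.2 z s).congr_deriv ?_
  simp [hamVF, Hp, Hq]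

lemma inv_pt (hH : TonelliHam H) {R C Λ a : ℝ} (hC0 : 0 < C) (hΛ : 0 < Λ) (hC : ∀ z : Phase d, ‖z.2‖ ≤ R → ‖BB H z‖ ≤ C)
    {g : Euc d → Euc d} (hg : ∀ x, ‖g x‖ ≤ R) (hgl : ∀ x y, ‖g y - g x‖ ≤ Λ * ‖y - x‖) (hj : ∀ x, H (x, g x) = a)
    (x p w : Euc d) (hp : ‖p‖ ≤ R) (hHp : H (x, p) = a) :
    ⟪g (x + w), Hp H (x, p)⟫ - ⟪g x, Hp H (x, p)⟫ + ⟪Hq H (x, p), w⟫ ≤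
      C * (2 + Λ) * (‖w‖ ^ 2 + ‖p - g x‖ ^ 2) := by
  have i1 := conv_fiber hH x p (g (x + w))
  have i2 := taylor_lower hH.smooth (x, g (x + w)) (w, 0) (-(C * ‖w‖ ^ 2)) (by
    intro s hs
    have h1 : ‖BB H ((x, g (x+w)) + s • ((w, 0) : Phase d))‖ ≤ C := hC _ (by simpa using hg _)
    have h2 := BB_upper h1 (w, 0)
    have e : ‖((w, 0) : Phase d)‖ = ‖w‖ := by simp [Prod.norm_def]
    rw [e] at h2
    exact (abs_le.1 h2).1)
  have i3 := taylor_upper hH.smooth (x, p) (0, g x - p) (C * ‖p - g x‖ ^ 2) (by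
    intro s hs
    have h1 : ‖BB H ((x, p) + s • ((0, g x - p) : Phase d))‖ ≤ C := hC _ (by
      have e : ((x, p) + s • ((0, g x - p) : Phase d)).2 = (1 - s) • p + s • g x := by
        simp only [Prod.snd_add, Prod.smul_snd]; module
      rw [e]
      refine (norm_add_le _ _).trans ?_
      rw [norm_smul, norm_smul, Real.norm_of_nonneg (by linarith [hs.2]), Real.norm_of_nonneg hs.1]
      have a1 := mul_le_mul_of_nonneg_left hp (by linarith [hs.2] : 0 ≤ 1 - s)
      have a2 := mul_le_mul_of_nonneg_left (hg x) hs.1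
      linarith)
    have h2 := BB_upper h1 (0, g x - p)
    have e : ‖((0, g x - p) : Phase d)‖ = ‖p - g x‖ := by simp [Prod.norm_def, norm_sub_rev]
    rw [e] at h2
    exact (abs_le.1 h2).2)
  simp only [Prod.mk_add_mk, add_zero, add_sub_cancel] at i2 i3
  rw [← hq_inner hH.smooth, hj] at i2
  rw [← hp_inner hH.smooth, hj, hHp] at i3
  have i4 : ⟪Hq H (x, p) - Hq H (x, g (x + w)), w⟫ ≤ C * (Λ * ‖w‖ + ‖p - g x‖) * ‖w‖ := by
    refine (real_inner_le_norm _ _).trans ?_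
    gcongr
    refine (Hq_sub_le hH.smooth (x, g (x+w)) (x, p)).trans ((dH_lip hH hC (x, g (x+w)) (x, p) (hg _) hp).trans ?_)
    gcongr
    have e : ‖((x, p) - (x, g (x + w)) : Phase d)‖ = ‖p - g (x + w)‖ := by simp [Prod.norm_def]
    rw [e]
    have h1 := norm_sub_le_norm_sub_add_norm_sub p (g x) (g (x + w))
    have h2 := hgl (x + w) x
    have e2 : ‖x - (x + w)‖ = ‖w‖ := by rw [sub_add_cancel_left, norm_neg]
    rw [e2] at h2
    linarith
  rw [hHp] at i1
  simp only [inner_sub_left, inner_sub_right] at i1 i3 i4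
  rw [real_inner_comm (Hp H (x, p)) (g (x + w)), real_inner_comm (Hp H (x, p)) (g x)]
  have s1 := mul_nonneg hC0.le (sq_nonneg (‖p - g x‖ - ‖w‖))
  have s2 : 0 ≤ C * ‖p - g x‖ ^ 2 := by positivity
  have s3 : 0 ≤ C * ‖w‖ ^ 2 := by positivity
  have s4 : 0 ≤ C * Λ * ‖p - g x‖ ^ 2 := by positivity
  linarith

lemma flow_inv (hH : TonelliHam H) {φ : ℝ → Phase d → Phase d} (hφ : IsConformalFlow H 0 φ) {a : ℝ} {u : Euc d → ℝ}
    (hu : USol H a u) (θ : Euc d) (s : ℝ) (hs : s ≤ 0) :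
    (φ s (θ, gradient u θ)).2 = gradient u (φ s (θ, gradient u θ)).1 := by
  obtain ⟨R, K, Λ, hR, hK, hΛ, hRb, hKb, hgl, -, -⟩ := hu.Xreg hH
  obtain ⟨z, hz⟩ : ∃ z : ℝ → Phase d, ∀ s, z s = φ s (θ, gradient u θ) := ⟨_, fun _ => rfl⟩
  have hzd : ∀ s, HasDerivAt z (Hp H (z s), -Hq H (z s)) s := by
    have : z = fun s => φ s (θ, gradient u θ) := funext hz
    rw [this]; exact fun s => flow_d hφ _ s
  have hz0 : z 0 = (θ, gradient u θ) := by rw [hz, hφ.1]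
  have hzH : ∀ s, H (z s) = a := fun s => by rw [hz, flow_H hH hφ, hu.hj hH]
  rw [← hz]
  clear hz
  have hzc : Continuous z := continuous_iff_continuousAt.2 fun s => (hzd s).continuousAt
  obtain ⟨t, ht⟩ : ∃ t, t = -s := ⟨_, rfl⟩
  have ht0 : 0 ≤ t := by linarith
  obtain ⟨R1, hR1⟩ : ∃ R1, ∀ σ ∈ Icc (-t) (0:ℝ), ‖(z σ).2‖ ≤ R1 :=
    isCompact_Icc.exists_bound_of_continuousOn (continuous_snd.comp hzc).continuousOn
  obtain ⟨R2, hR2⟩ : ∃ R2, R2 = max R R1 := ⟨_, rfl⟩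
  obtain ⟨C, _, hC0, -, hb⟩ := bounds hH R2
  have hg2 : ∀ x, ‖gradient u x‖ ≤ R2 := fun x => (hRb x).trans (hR2 ▸ le_max_left _ _)
  have hp2 : ∀ σ ∈ Icc (-t) (0:ℝ), ‖(z σ).2‖ ≤ R2 := fun σ h => (hR1 σ h).trans (hR2 ▸ le_max_right _ _)
  obtain ⟨C1, hC1⟩ : ∃ C1, C1 = C * (2 + Λ) := ⟨_, rfl⟩
  have hC10 : 0 < C1 := by rw [hC1]; positivity
  have hgc : Continuous (fun x => gradient u x) := by
    have := hu.c1.continuous_fderiv (by norm_num)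
    exact (InnerProductSpace.toDual ℝ (Euc d)).symm.continuous.comp this
  obtain ⟨e, he⟩ : ∃ e : ℝ → Euc d, ∀ σ, e σ = (z σ).2 - gradient u (z σ).1 := ⟨_, fun _ => rfl⟩
  have hec : Continuous e := by
    have : e = fun σ => (z σ).2 - gradient u (z σ).1 := funext he
    rw [this]
    exact (continuous_snd.comp hzc).sub (hgc.comp (continuous_fst.comp hzc))
  have hfc : Continuous (fun σ => ‖e (-σ)‖ ^ 2) := by fun_prop
  obtain ⟨G, hG⟩ : ∃ G : ℝ → ℝ, ∀ r, G r = ∫ σ in (0:ℝ)..r, ‖e (-σ)‖ ^ 2 := ⟨_, fun _ => rfl⟩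
  have hGd : ∀ r, HasDerivAt G (‖e (-r)‖ ^ 2) r := by
    intro r
    have : G = fun r => ∫ σ in (0:ℝ)..r, ‖e (-σ)‖ ^ 2 := funext hG
    rw [this]
    exact hfc.integral_hasStrictDerivAt 0 r |>.hasDerivAt
  have hG0 : G 0 = 0 := by rw [hG]; simp
  have hGn : ∀ r, 0 ≤ r → 0 ≤ G r := fun r hr => by
    rw [hG]; exact intervalIntegral.integral_nonneg hr (fun _ _ => by positivity)
  obtain ⟨C2, hC2⟩ : ∃ C2, C2 = 2 * K + C1 * t + C1 := ⟨_, rfl⟩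
  have hC20 : 0 < C2 := by rw [hC2]; positivity
  have key : ∀ σ ∈ Icc (-t) (0:ℝ), ∀ w, ⟪e σ, w⟫ ≤ C2 * (‖w‖ ^ 2 + G (-σ)) := by
    intro σ hσ w
    obtain ⟨Q, hQ⟩ : ∃ Q : ℝ → ℝ, ∀ r, Q r = u ((z r).1 + w) - u (z r).1 - ⟪(z r).2, w⟫ - C1 * ‖w‖ ^ 2 * r + C1 * G (-r) := ⟨_, fun _ => rfl⟩
    have hQd : ∀ r, HasDerivAt Q (⟪gradient u ((z r).1 + w), Hp H (z r)⟫ - ⟪gradient u (z r).1, Hp H (z r)⟫ + ⟪Hq H (z r), w⟫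
        - C1 * ‖w‖ ^ 2 - C1 * ‖e r‖ ^ 2) r := by
      intro r
      have h1 : HasDerivAt (fun r => (z r).1) (Hp H (z r)) r := (hzd r).fst
      have h2 : HasDerivAt (fun r => (z r).2) (-Hq H (z r)) r := (hzd r).snd
      have h3 := (hu.grad ((z r).1 + w)).hasFDerivAt.comp_hasDerivAt r (h1.add_const w)
      have h4 := (hu.grad (z r).1).hasFDerivAt.comp_hasDerivAt r h1
      have h5 := h2.inner ℝ (hasDerivAt_const r w)
      have h6 := (hGd (-r)).comp r (hasDerivAt_neg r)
      have h7 := (((h3.sub h4).sub h5).sub ((hasDerivAt_id r).const_mul (C1 * ‖w‖ ^ 2))).add (h6.const_mul C1)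
      have e : Q = fun r => u ((z r).1 + w) - u (z r).1 - ⟪(z r).2, w⟫ - C1 * ‖w‖ ^ 2 * r + C1 * G (-r) := funext hQ
      rw [e]
      refine HasDerivAt.congr_deriv (f := fun r => u ((z r).1 + w) - u (z r).1 - ⟪(z r).2, w⟫ - C1 * ‖w‖ ^ 2 * r + C1 * G (-r)) h7 ?_
      simp only [InnerProductSpace.toDual_apply_apply, inner_zero_right, inner_neg_left, neg_neg]
      ring
    have hanti : AntitoneOn Q (Icc (-t) 0) := by
      refine antitoneOn_of_deriv_nonpos (convex_Icc _ _) (fun r _ => (hQd r).continuousAt.continuousWithinAt)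
        (fun r _ => (hQd r).differentiableAt.differentiableWithinAt) (fun r hr => ?_)
      rw [(hQd r).deriv]
      rw [interior_Icc] at hr
      have hr' := Ioo_subset_Icc_self hr
      have := inv_pt hH hC0 hΛ (fun z hz => (hb z hz).2.2.1) hg2 hgl (fun x => hu.hj hH x) (z r).1 (z r).2 w
        (hp2 r hr') (hzH r)
      rw [← hC1, ← he] at this
      simp only [Prod.mk.eta] at this
      linarith
    have h1 := hanti hσ ⟨by linarith, le_rfl⟩ hσ.2
    rw [hQ, hQ, hz0, neg_zero, hG0] at h1
    simp only [mul_zero, sub_zero, add_zero] at h1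
    have h2 := (abs_le.1 (hKb θ w)).1
    have h3 := (abs_le.1 (hKb (z σ).1 w)).2
    have h4 : C1 * ‖w‖ ^ 2 * -σ ≤ C1 * ‖w‖ ^ 2 * t := by gcongr; linarith [hσ.1]
    rw [he, inner_sub_left]
    have h5 := hGn (-σ) (by linarith [hσ.2])
    have h6 : 0 ≤ (2 * K + C1 * t) * G (-σ) := by positivity
    have h7 : 0 ≤ C1 * ‖w‖ ^ 2 := by positivity
    rw [hC2]
    linarith
  have key2 : ∀ σ ∈ Icc (-t) (0:ℝ), ‖e σ‖ ^ 2 ≤ 4 * C2 ^ 2 * G (-σ) := by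
    intro σ hσ
    have h1 := key σ hσ ((1 / (2 * C2)) • e σ)
    rw [inner_smul_right, real_inner_self_eq_norm_sq, norm_smul, Real.norm_of_nonneg (by positivity)] at h1
    have h2 := mul_le_mul_of_nonneg_left h1 (by positivity : 0 ≤ 4 * C2)
    have e1 : 4 * C2 * (1 / (2 * C2) * ‖e σ‖ ^ 2) = 2 * ‖e σ‖ ^ 2 := by field_simp; norm_num
    have e2 : 4 * C2 * (C2 * ((1 / (2 * C2) * ‖e σ‖) ^ 2 + G (-σ))) = ‖e σ‖ ^ 2 + 4 * C2 ^ 2 * G (-σ) := by field_simp; ring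
    rw [e1, e2] at h2
    linarith
  have hGz : ∀ r ∈ Icc (0:ℝ) t, G r = 0 := by
    refine eq_zero_of_abs_deriv_le_mul_abs_self_of_eq_zero_right (K := 4 * C2 ^ 2) (fun r _ => (hGd r).continuousAt.continuousWithinAt)
      (fun r _ => (hGd r).hasDerivWithinAt) hG0 (fun r hr => ?_)
    have := key2 (-r) ⟨by linarith [hr.2], by linarith [hr.1]⟩
    rw [neg_neg] at this
    rw [Real.norm_of_nonneg (by positivity), Real.norm_of_nonneg (hGn r hr.1)]
    exact this
  have h1 := key2 s ⟨by linarith, hs⟩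
  rw [hGz (-s) ⟨by linarith, by linarith⟩, mul_zero] at h1
  have h2 : e s = 0 := by
    rw [← norm_eq_zero]
    exact pow_eq_zero_iff (two_ne_zero) |>.1 (le_antisymm h1 (sq_nonneg _))
  rw [he] at h2
  exact sub_eq_zero.1 h2

end K5

namespace K5
variable {d : ℕ} {H : Phase d → ℝ}

lemma bb_unif (hH : TonelliHam H) (R : ℝ) {ω : ℝ} (hω : 0 < ω) : ∃ δ > (0:ℝ), ∀ z z' : Phase d, ‖z.2‖ ≤ R → ‖z' - z‖ < δ →
    ‖fderiv ℝ H z' - fderiv ℝ H z - BB H z (z' - z)‖ ≤ ω * ‖z' - z‖ := by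
  obtain ⟨δ, hδ, h⟩ := per_ucont (cont_BB hH.smooth) (perBB hH) R ω hω
  refine ⟨δ, hδ, fun z z' hz hzz => ?_⟩
  refine (convex_ball z δ).norm_image_sub_le_of_norm_hasFDerivWithin_le' (f := fderiv ℝ H) (f' := BB H)
    (fun x _ => (diffdH hH.smooth x).hasFDerivWithinAt) (fun x hx => (h z x hz ?_).le) (mem_ball_self hδ) ?_
  · rwa [← dist_eq_norm]
  · rwa [mem_ball, dist_eq_norm]

lemma VF_lip (hH : TonelliHam H) {R C : ℝ} (hC : ∀ z : Phase d, ‖z.2‖ ≤ R → ‖BB H z‖ ≤ C)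
    (z z' : Phase d) (hz : ‖z.2‖ ≤ R) (hz' : ‖z'.2‖ ≤ R) :
    ‖((Hp H z', -Hq H z') : Phase d) - (Hp H z, -Hq H z)‖ ≤ C * ‖z' - z‖ := by
  have h := dH_lip hH hC z z' hz hz'
  rw [Prod.mk_sub_mk, Prod.norm_mk]
  refine max_le ((Hp_sub_le hH.smooth z z').trans h) ?_
  rw [neg_sub_neg, norm_sub_rev]
  exact (Hq_sub_le hH.smooth z z').trans h

lemma jac (hH : TonelliHam H) {φ : ℝ → Phase d → Phase d} (hφ : IsConformalFlow H 0 φ) {a : ℝ} {u : Euc d → ℝ}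
    (hu : USol H a u) (θ : Euc d) {t : ℝ} (ht : 0 < t) (w0 v b : Euc d)
    (hd : DifferentiableAt ℝ (φ t) (φ (-t) (θ, gradient u θ)))
    (hv : fderiv ℝ (φ t) (φ (-t) (θ, gradient u θ)) (0, w0) = (v, b)) :
    ∃ B > (0:ℝ), ∀ ρ > (0:ℝ), ∃ J P J' P' : ℝ → Euc d,
    (∀ s, HasDerivAt J (J' s) s) ∧ (∀ s, HasDerivAt P (P' s) s) ∧ Continuous J' ∧ Continuous P' ∧
    (∀ s, -t ≤ s → s ≤ 0 → ‖J s‖ ≤ B ∧ ‖P s‖ ≤ B ∧ ‖J' s‖ ≤ B ∧ ‖P' s‖ ≤ B) ∧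
    (∀ s, -t ≤ s → s ≤ 0 → ∀ w, |⟪J' s, w⟫ - BB H (φ s (θ, gradient u θ)) (J s, P s) (0, w)| ≤ ρ * ‖w‖) ∧
    (∀ s, -t ≤ s → s ≤ 0 → ∀ w, |⟪P' s, w⟫ + BB H (φ s (θ, gradient u θ)) (J s, P s) (w, 0)| ≤ ρ * ‖w‖) ∧
    J (-t) = 0 ∧ J 0 = v ∧ ‖P 0 - b‖ ≤ ρ := by
  obtain ⟨y, hy⟩ : ∃ y, y = φ (-t) (θ, gradient u θ) := ⟨_, rfl⟩
  rw [← hy] at hd hv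
  have hyφ : ∀ s, φ (s + t) y = φ s (θ, gradient u θ) := by
    intro s; rw [hy, hφ.2.1]; congr 1; ring
  have hyH : H y = a := by rw [hy, flow_H hH hφ, hu.hj hH]
  obtain ⟨b', hb'⟩ := hH.superlinear 1
  obtain ⟨R, hR⟩ : ∃ R, R = a + 1 - b' := ⟨_, rfl⟩
  have hsl : ∀ z : Phase d, H z ≤ a + 1 → ‖z.2‖ ≤ R := by
    intro z hz
    have := hb' z.1 z.2
    rw [Prod.mk.eta] at this
    linarith
  obtain ⟨C, _, hC0, -, hb⟩ := bounds hH R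
  have hbB : ∀ z : Phase d, ‖z.2‖ ≤ R → ‖BB H z‖ ≤ C := fun z hz => (hb z hz).2.2.1
  obtain ⟨B0, hB0⟩ : ∃ B0, B0 = ‖w0‖ * Real.exp (C * t) := ⟨_, rfl⟩
  have hB00 : 0 ≤ B0 := by rw [hB0]; positivity
  refine ⟨B0 + C * B0 + 1 + 1 / t, by positivity, fun ρ hρ => ?_⟩
  obtain ⟨m, hm⟩ : ∃ m, m = min 1 (ρ / (2 * (1 / t + C))) := ⟨_, rfl⟩
  have hm0 : 0 < m := by rw [hm]; positivity
  have hm1 : m ≤ 1 := hm ▸ min_le_left _ _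
  have hm2 : m * (1 / t + C) ≤ ρ / 2 := by
    have : m ≤ ρ / (2 * (1 / t + C)) := hm ▸ min_le_right _ _
    calc _ ≤ ρ / (2 * (1 / t + C)) * (1 / t + C) := by gcongr
      _ = _ := by field_simp
  obtain ⟨δ, hδ, hun⟩ := bb_unif hH R (ω := ρ / (2 * (B0 + 1))) (by positivity)
  -- choice of ε
  have hl : Tendsto (fun ε : ℝ => ε⁻¹ • (φ t (y + ε • ((0, w0) : Phase d)) - φ t y)) (nhdsWithin 0 (Ioi 0)) (nhds (v, b)) := by
    have := (hd.hasFDerivAt.hasLineDerivAt ((0, w0) : Phase d)).tendsto_slope_zero_right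
    rwa [hv] at this
  have hc1 : Tendsto (fun ε : ℝ => H (y + ε • ((0, w0) : Phase d))) (nhdsWithin 0 (Ioi 0)) (nhds a) := by
    have : ContinuousAt (fun ε : ℝ => H (y + ε • ((0, w0) : Phase d))) 0 := by
      have := hH.smooth.continuous
      fun_prop
    have h2 := this.tendsto.mono_left (nhdsWithin_le_nhds (s := Ioi 0))
    simpa [hyH] using h2
  have hc2 : Tendsto (fun ε : ℝ => ε * B0) (nhdsWithin 0 (Ioi 0)) (nhds 0) := by
    have : ContinuousAt (fun ε : ℝ => ε * B0) 0 := by fun_prop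
    have h2 := this.tendsto.mono_left (nhdsWithin_le_nhds (s := Ioi 0))
    simpa using h2
  obtain ⟨ε, hε1, hε2, hε3, hε0⟩ := (((hl.eventually (Metric.ball_mem_nhds _ (lt_min hm0 hρ))).and
    ((hc1.eventually (gt_mem_nhds (lt_add_one a))).and
    ((hc2.eventually (gt_mem_nhds hδ)).and self_mem_nhdsWithin))).exists)
  rw [dist_eq_norm] at hε1
  obtain ⟨z, hz⟩ : ∃ z : ℝ → Phase d, ∀ s, z s = φ s (θ, gradient u θ) := ⟨_, fun _ => rfl⟩
  obtain ⟨ζ, hζ⟩ : ∃ ζ : ℝ → Phase d, ∀ s, ζ s = φ (s + t) (y + ε • ((0, w0) : Phase d)) := ⟨_, fun _ => rfl⟩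
  have hzd : ∀ s, HasDerivAt z (Hp H (z s), -Hq H (z s)) s := by
    have : z = fun s => φ s (θ, gradient u θ) := funext hz
    rw [this]; exact fun s => flow_d hφ _ s
  have hζd : ∀ s, HasDerivAt ζ (Hp H (ζ s), -Hq H (ζ s)) s := by
    have : ζ = fun s => φ (s + t) (y + ε • ((0, w0) : Phase d)) := funext hζ
    rw [this]; exact fun s => (flow_d hφ (y + ε • ((0, w0) : Phase d)) (s + t)).comp_add_const s t
  have hzR : ∀ s, ‖(z s).2‖ ≤ R := fun s => hsl _ (by rw [hz, flow_H hH hφ, hu.hj hH]; linarith)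
  have hζR : ∀ s, ‖(ζ s).2‖ ≤ R := fun s => hsl _ (by rw [hζ, flow_H hH hφ]; exact hε2.le)
  have hzt : z (-t) = y := by rw [hz, hy]
  have hζt : ζ (-t) = y + ε • ((0, w0) : Phase d) := by rw [hζ, neg_add_cancel, hφ.1]
  have hz0 : z 0 = φ t y := by rw [hz, ← hyφ, zero_add]
  have hζ0 : ζ 0 = φ t (y + ε • ((0, w0) : Phase d)) := by rw [hζ, zero_add]
  have hgr : ∀ s, -t ≤ s → s ≤ 0 → ‖ζ s - z s‖ ≤ ε * B0 := by
    intro s h1 h2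
    have := dist_le_of_trajectories_ODE_of_mem (v := fun _ z => ((Hp H z, -Hq H z) : Phase d)) (s := fun _ => {z | ‖z.2‖ ≤ R})
      (K := ⟨C, hC0.le⟩) (f := ζ) (g := z) (a := -t) (b := 0) (δ := ε * ‖w0‖)
      (fun _ _ => LipschitzOnWith.of_dist_le_mul fun x hx y hy => by
        rw [dist_eq_norm, dist_eq_norm]
        exact VF_lip hH hbB y x hy hx)
      (fun s _ => (hζd s).continuousAt.continuousWithinAt) (fun s _ => (hζd s).hasDerivWithinAt) (fun s _ => hζR s)
      (fun s _ => (hzd s).continuousAt.continuousWithinAt) (fun s _ => (hzd s).hasDerivWithinAt) (fun s _ => hzR s)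
      (by
        rw [dist_eq_norm, hζt, hzt, add_sub_cancel_left, norm_smul, Real.norm_of_nonneg hε0.le]
        simp [Prod.norm_def]) s ⟨h1, h2⟩
    rw [dist_eq_norm] at this
    refine this.trans ?_
    rw [hB0, mul_assoc]
    have : Real.exp (C * (s - -t)) ≤ Real.exp (C * t) := by
      rw [Real.exp_le_exp]; gcongr; linarith
    exact mul_le_mul_of_nonneg_left (mul_le_mul_of_nonneg_left this (norm_nonneg _)) hε0.le
  obtain ⟨W, hW⟩ : ∃ W : ℝ → Phase d, ∀ s, W s = ε⁻¹ • (ζ s - z s) := ⟨_, fun _ => rfl⟩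
  obtain ⟨X, hX⟩ : ∃ X : ℝ → Phase d, ∀ s, X s = ε⁻¹ • (((Hp H (ζ s), -Hq H (ζ s)) : Phase d) - (Hp H (z s), -Hq H (z s))) := ⟨_, fun _ => rfl⟩
  have hWd : ∀ s, HasDerivAt W (X s) s := by
    intro s
    rw [hX, show W = fun s => ε⁻¹ • (ζ s - z s) from funext hW]
    exact ((hζd s).sub (hzd s)).const_smul ε⁻¹
  have hXc : Continuous X := by
    rw [show X = _ from funext hX]
    have c1 : Continuous z := continuous_iff_continuousAt.2 fun s => (hzd s).continuousAt
    have c2 : Continuous ζ := continuous_iff_continuousAt.2 fun s => (hζd s).continuousAt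
    have c3 := cont_Hp hH.smooth
    have c4 := cont_Hq hH.smooth
    exact (((c3.comp c2).prodMk (c4.comp c2).neg).sub ((c3.comp c1).prodMk (c4.comp c1).neg)).const_smul ε⁻¹
  have hsc : ∀ s, -t ≤ s → s ≤ 0 → ε⁻¹ * ‖ζ s - z s‖ ≤ B0 := by
    intro s h1 h2
    rw [inv_mul_le_iff₀ hε0]; exact hgr s h1 h2
  have hWb : ∀ s, -t ≤ s → s ≤ 0 → ‖W s‖ ≤ B0 := by
    intro s h1 h2
    rw [hW, norm_smul, norm_inv, Real.norm_of_nonneg hε0.le]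
    exact hsc s h1 h2
  have hXb : ∀ s, -t ≤ s → s ≤ 0 → ‖X s‖ ≤ C * B0 := by
    intro s h1 h2
    rw [hX, norm_smul, norm_inv, Real.norm_of_nonneg hε0.le]
    have h3 := VF_lip hH hbB (z s) (ζ s) (hzR s) (hζR s)
    calc _ ≤ ε⁻¹ * (C * ‖ζ s - z s‖) := by gcongr
      _ = C * (ε⁻¹ * ‖ζ s - z s‖) := by ring
      _ ≤ C * B0 := by gcongr; exact hsc s h1 h2
  have herr : ∀ s, -t ≤ s → s ≤ 0 → ∀ w : Phase d,
      |ε⁻¹ * (fderiv ℝ H (ζ s) w - fderiv ℝ H (z s) w) - BB H (z s) (W s) w| ≤ ρ / 2 * ‖w‖ := by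
    intro s h1 h2 w
    have h3 := hun (z s) (ζ s) (hzR s) ((hgr s h1 h2).trans_lt hε3)
    have e : ε⁻¹ * (fderiv ℝ H (ζ s) w - fderiv ℝ H (z s) w) - BB H (z s) (W s) w =
        ε⁻¹ * (fderiv ℝ H (ζ s) - fderiv ℝ H (z s) - BB H (z s) (ζ s - z s)) w := by
      rw [hW, map_smul]
      simp only [_root_.smul_apply, _root_.sub_apply, smul_eq_mul]
      ring
    rw [e, abs_mul, abs_of_pos (inv_pos.2 hε0), ← Real.norm_eq_abs]
    have h4 := (fderiv ℝ H (ζ s) - fderiv ℝ H (z s) - BB H (z s) (ζ s - z s)).le_of_opNorm_le h3 w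
    calc _ ≤ ε⁻¹ * (ρ / (2 * (B0 + 1)) * ‖ζ s - z s‖ * ‖w‖) := by gcongr
      _ = ρ / (2 * (B0 + 1)) * (ε⁻¹ * ‖ζ s - z s‖) * ‖w‖ := by ring
      _ ≤ ρ / (2 * (B0 + 1)) * (B0 + 1) * ‖w‖ := by
        have := hsc s h1 h2
        gcongr; linarith
      _ = _ := by field_simp
  obtain ⟨g, hg⟩ : ∃ g, g = v - (W 0).1 := ⟨_, rfl⟩
  have hW0 : ‖W 0 - (v, b)‖ < min m ρ := by rw [hW, hz0, hζ0]; exact hε1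
  have hgm : ‖g‖ ≤ m := by
    rw [hg, norm_sub_rev]
    exact (norm_fst_le (W 0 - (v, b))).trans (hW0.le.trans (min_le_left _ _))
  have hlin : ∀ s, -t ≤ s → s ≤ 0 → ‖(1 + s / t) • g‖ ≤ m := by
    intro s h1 h2
    have e1 : 0 ≤ 1 + s / t := by
      have : -1 ≤ s / t := by rw [le_div_iff₀ ht]; linarith
      linarith
    have e2 : 1 + s / t ≤ 1 := by
      have : s / t ≤ 0 := div_nonpos_of_nonpos_of_nonneg h2 ht.le
      linarith
    rw [norm_smul, Real.norm_of_nonneg e1]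
    have := mul_le_mul e2 hgm (norm_nonneg _) zero_le_one
    linarith
  have hBC : ∀ s, -t ≤ s → s ≤ 0 → ∀ w : Phase d, |BB H (z s) ((1 + s / t) • g, 0) w| ≤ C * m * ‖w‖ := by
    intro s h1 h2 w
    have h3 := (BB H (z s)).le_opNorm₂ ((1 + s / t) • g, 0) w
    rw [Real.norm_eq_abs] at h3
    have e : ‖(((1 + s / t) • g, 0) : Phase d)‖ ≤ m := by
      rw [Prod.norm_mk, norm_zero]; exact max_le (hlin s h1 h2) hm0.le
    have h4 := hbB _ (hzR s)
    refine h3.trans ?_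
    gcongr
  have hgt : ‖(1 / t) • g‖ ≤ m * (1 / t) := by
    rw [norm_smul, Real.norm_of_nonneg (by positivity), mul_comm]; gcongr
  have hgt1 : m * (1 / t) ≤ 1 / t := by
    have : 0 < 1 / t := by positivity
    have := mul_le_mul_of_nonneg_right hm1 this.le
    linarith
  have hCB : 0 ≤ C * B0 := by positivity
  have ht1 : 0 < 1 / t := by positivity
  refine ⟨fun s => (W s).1 + (1 + s / t) • g, fun s => (W s).2, fun s => (X s).1 + (1 / t) • g, fun s => (X s).2,
    ?_, fun s => (hWd s).snd, by fun_prop, by fun_prop, ?_, ?_, ?_, ?_, ?_, ?_⟩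
  · intro s
    have k1 : HasDerivAt (fun s => (W s).1) (X s).1 s := (hWd s).fst
    exact k1.add ((((hasDerivAt_id s).div_const t).const_add 1).smul_const g)
  · intro s h1 h2
    have a1 := (norm_fst_le (W s)).trans (hWb s h1 h2)
    have a2 := (norm_snd_le (W s)).trans (hWb s h1 h2)
    have a3 := (norm_fst_le (X s)).trans (hXb s h1 h2)
    have a4 := (norm_snd_le (X s)).trans (hXb s h1 h2)
    have a5 := hlin s h1 h2
    refine ⟨(norm_add_le _ _).trans ?_, ?_, (norm_add_le _ _).trans ?_, ?_⟩ <;> linarith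
  · intro s h1 h2 w
    have b1 := herr s h1 h2 (0, w)
    rw [← hp_inner hH.smooth, ← hp_inner hH.smooth] at b1
    have b2 := hBC s h1 h2 (0, w)
    have b3 := (abs_real_inner_le_norm ((1 / t) • g) w).trans (mul_le_mul_of_nonneg_right hgt (norm_nonneg w))
    have e1 : ‖((0, w) : Phase d)‖ = ‖w‖ := by simp [Prod.norm_def]
    rw [e1] at b1 b2
    have e2 : (((W s).1 + (1 + s / t) • g, (W s).2) : Phase d) = W s + ((1 + s / t) • g, 0) := by
      ext1 <;> simp
    have e3 : ⟪(X s).1, w⟫ = ε⁻¹ * (⟪Hp H (ζ s), w⟫ - ⟪Hp H (z s), w⟫) := by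
      rw [hX]
      simp only [Prod.smul_fst, Prod.fst_sub, real_inner_smul_left, inner_sub_left]
    rw [← hz, e2, map_add, inner_add_left, e3, _root_.add_apply]
    have b4 := mul_le_mul_of_nonneg_right hm2 (norm_nonneg w)
    rw [abs_le] at b1 b2 b3 ⊢
    constructor <;> linarith [b1.1, b1.2, b2.1, b2.2, b3.1, b3.2]
  · intro s h1 h2 w
    have b1 := herr s h1 h2 (w, 0)
    rw [← hq_inner hH.smooth, ← hq_inner hH.smooth] at b1
    have b2 := hBC s h1 h2 (w, 0)
    have e1 : ‖((w, 0) : Phase d)‖ = ‖w‖ := by simp [Prod.norm_def]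
    rw [e1] at b1 b2
    have e2 : (((W s).1 + (1 + s / t) • g, (W s).2) : Phase d) = W s + ((1 + s / t) • g, 0) := by
      ext1 <;> simp
    have e3 : ⟪(X s).2, w⟫ = -(ε⁻¹ * (⟪Hq H (ζ s), w⟫ - ⟪Hq H (z s), w⟫)) := by
      rw [hX]
      simp only [Prod.smul_snd, Prod.snd_sub, real_inner_smul_left, inner_sub_left, inner_neg_left]
      ring
    rw [← hz, e2, map_add, e3, _root_.add_apply]
    have b4 := mul_le_mul_of_nonneg_right hm2 (norm_nonneg w)
    have b5 : 0 ≤ m * (1 / t) * ‖w‖ := by positivity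
    rw [abs_le] at b1 b2 ⊢
    constructor <;> linarith [b1.1, b1.2, b2.1, b2.2]
  · beta_reduce
    rw [hW, hζt, hzt, add_sub_cancel_left, neg_div, div_self ht.ne']
    simp
  · beta_reduce
    rw [hg]; simp
  · exact (norm_snd_le (W 0 - (v, b))).trans (hW0.le.trans (min_le_right _ _))

lemma local_upper (hH : TonelliHam H) {φ : ℝ → Phase d → Phase d} (hφ : IsConformalFlow H 0 φ) {a : ℝ} {u : Euc d → ℝ}
    (hu : USol H a u) (θ : Euc d) {t : ℝ} (ht : 0 < t) {S : Euc d →L[ℝ] Euc d}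
    (hS : IsHeight (GreenT φ t (θ, gradient u θ)) S) (v : Euc d) {ε : ℝ} (hε : 0 < ε)
    {M C C0 : ℝ} (hM : 0 < M) (hC : 0 < C) (hC0 : 0 < C0) :
    ∃ δ > (0:ℝ), ∀ lam w h, 0 ≤ lam → lam ≤ δ → Dom H a lam C (M + 1) w → StepE H a lam M w →
      (∀ x, |w x - u x| ≤ δ) → (∀ x, |w x| ≤ C0) → 0 < h → h ≤ δ →
      w (θ + h • v) + w (θ - h • v) - 2 * w θ ≤ h ^ 2 * (⟪S v, v⟫ + ε) := by
  by_cases hv0 : v = 0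
  · refine ⟨1, one_pos, fun lam w h _ _ _ _ _ _ hh _ => ?_⟩
    rw [hv0]
    simp only [smul_zero, add_zero, sub_zero, inner_zero_right, zero_add]
    have : 0 < h ^ 2 * ε := by positivity
    linarith
  have hmem : ((v, S v) : Phase d) ∈ GreenT φ t (θ, gradient u θ) := by
    rw [hS.2]; simp [LinearMap.mem_graph_iff]
  rw [GreenT, pushV, Submodule.mem_map] at hmem
  obtain ⟨⟨w1, w0⟩, hw, hwv⟩ := hmem
  have hw1 : w1 = 0 := by
    rw [Vert, Submodule.mem_prod] at hw
    simpa using hw.1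
  subst hw1
  have hwv' : fderiv ℝ (φ t) (φ (-t) (θ, gradient u θ)) (0, w0) = (v, S v) := hwv
  have hd : DifferentiableAt ℝ (φ t) (φ (-t) (θ, gradient u θ)) := by
    by_contra hnd
    rw [fderiv_zero_of_not_differentiableAt hnd] at hwv'
    exact hv0 (congrArg Prod.fst hwv').symm
  obtain ⟨B, hB, hjac⟩ := jac hH hφ hu θ ht w0 v (S v) hd hwv'
  obtain ⟨ρ, hρ, hmain⟩ := main_sum hH hu ht hB (half_pos hε) hM hC hC0
  obtain ⟨J, P, J', P', a1, a2, a3, a4, a5, a6, a7, a8, a9, a10⟩ := hjac (min ρ (ε / (2 * (‖v‖ + 1)))) (by positivity)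
  obtain ⟨R, K, Λ, hR, hK, hΛ, hRb, hKb, hgl, hXb, hXl⟩ := hu.Xreg hH
  have hinv := fun s hs => flow_inv hH hφ hu θ s hs
  obtain ⟨γ, hγ⟩ : ∃ γ : ℝ → Euc d, ∀ s, γ s = (φ s (θ, gradient u θ)).1 := ⟨_, fun _ => rfl⟩
  have hz : ∀ s, s ≤ 0 → φ s (θ, gradient u θ) = (γ s, gradient u (γ s)) := by
    intro s hs
    rw [hγ, ← hinv s hs]
  have hγ0 : γ 0 = θ := by rw [hγ, hφ.1]
  have hγd : ∀ s, s ≤ 0 → HasDerivAt γ (Hp H (γ s, gradient u (γ s))) s := by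
    intro s hs
    rw [← hz s hs, show γ = fun s => (φ s (θ, gradient u θ)).1 from funext hγ]
    exact (flow_d hφ _ s).fst
  have hγe : ∀ s τ, -t ≤ s - τ → s ≤ 0 → 0 ≤ τ → ‖γ (s - τ) - γ s + τ • Hp H (γ s, gradient u (γ s))‖ ≤ Λ * Λ * τ ^ 2 := by
    intro s τ h1 h2 h3
    have hlip : ∀ r ∈ Icc (s - τ) s, ‖γ r - γ s‖ ≤ Λ * τ := by
      intro r hr
      have := (convex_Icc (s - τ) s).norm_image_sub_le_of_norm_hasDerivWithin_le (f := γ)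
        (fun x hx => (hγd x (hx.2.trans h2)).hasDerivWithinAt) (fun x hx => hXb (γ x))
        (x := s) (y := r) ⟨by linarith, le_rfl⟩ hr
      refine this.trans ?_
      gcongr
      rw [Real.norm_eq_abs, abs_le]
      constructor <;> linarith [hr.1, hr.2]
    have := (convex_Icc (s - τ) s).norm_image_sub_le_of_norm_hasDerivWithin_le
        (f := fun r => γ r - r • Hp H (γ s, gradient u (γ s)))
        (f' := fun r => Hp H (γ r, gradient u (γ r)) - (1:ℝ) • Hp H (γ s, gradient u (γ s))) (C := Λ * (Λ * τ))
        (fun x hx => ((hγd x (hx.2.trans h2)).sub ((hasDerivAt_id x).smul_const _)).hasDerivWithinAt)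
        (fun x hx => by
          rw [one_smul]
          exact (hXl (γ s) (γ x)).trans (mul_le_mul_of_nonneg_left (hlip x hx) hΛ.le))
        (x := s) (y := s - τ) ⟨by linarith, le_rfl⟩ ⟨le_rfl, by linarith⟩
    have e1 : ‖s - τ - s‖ = τ := by rw [sub_sub_cancel_left, norm_neg, Real.norm_of_nonneg h3]
    rw [e1] at this
    have e2 : γ (s - τ) - (s - τ) • Hp H (γ s, gradient u (γ s)) - (γ s - s • Hp H (γ s, gradient u (γ s))) =
      γ (s - τ) - γ s + τ • Hp H (γ s, gradient u (γ s)) := by module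
    rw [e2] at this
    refine this.trans (le_of_eq (by ring))
  obtain ⟨δ, hδ, h⟩ := hmain γ J P J' P' (Λ * Λ) (⟪S v, v⟫ + ε / 2) (by positivity) hγe a1 a2 a3 a4 a5
    (fun s h1 h2 w => by
      have := a6 s h1 h2 w
      rw [hz s h2] at this
      exact this.trans (mul_le_mul_of_nonneg_right (min_le_left _ _) (norm_nonneg _)))
    (fun s h1 h2 w => by
      have := a7 s h1 h2 w
      rw [hz s h2] at this
      exact this.trans (mul_le_mul_of_nonneg_right (min_le_left _ _) (norm_nonneg _))) a8 (by
      rw [a9]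
      have h1 := real_inner_le_norm (P 0 - S v) v
      have h2 := a10.trans (min_le_right _ _)
      have h3 : ‖P 0 - S v‖ * ‖v‖ ≤ ε / (2 * (‖v‖ + 1)) * (‖v‖ + 1) := by
        gcongr; linarith
      have h4 : ε / (2 * (‖v‖ + 1)) * (‖v‖ + 1) = ε / 2 := by field_simp
      rw [inner_sub_left] at h1
      linarith)
  · refine ⟨δ, hδ, fun lam w h' h1 h2 h3 h4 h5 h6 h7 h8 => ?_⟩
    have := h lam w h' h1 h2 h3 h4 h5 h6 h7 h8
    rw [hγ0, a9] at this
    refine this.trans (le_of_eq ?_)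
    ring

end K5

namespace K5
open scoped Pointwise
variable {d : ℕ}

def sd (w : Euc d → ℝ) (v : Euc d) (h : ℝ) (θ : Euc d) : ℝ := (w (θ + h • v) + w (θ - h • v) - 2 * w θ) / h ^ 2

lemma sd_lim {w : Euc d → ℝ} {p : Euc d} {S : Euc d →L[ℝ] Euc d} {θ : Euc d} (h : HasAlexandrovAt w p S θ) (v : Euc d) :
    Tendsto (fun n : ℕ => sd w v (1 / ((n:ℝ) + 1)) θ) atTop (nhds ⟪S v, v⟫) := by
  have hs : Tendsto (fun n : ℕ => (1 / ((n:ℝ) + 1))) atTop (nhds 0) := tendsto_one_div_add_atTop_nhds_zero_nat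
  rw [Metric.tendsto_atTop]
  intro ε hε
  obtain ⟨c, hc⟩ : ∃ c, c = ε / (4 * (‖v‖ ^ 2 + 1)) := ⟨_, rfl⟩
  have hc0 : 0 < c := by rw [hc]; positivity
  have h1 := h.2.def hc0
  have hp : Tendsto (fun n : ℕ => θ + (1 / ((n:ℝ) + 1)) • v) atTop (nhds θ) := by
    simpa using (hs.smul_const v).const_add θ
  have hm : Tendsto (fun n : ℕ => θ - (1 / ((n:ℝ) + 1)) • v) atTop (nhds θ) := by
    simpa using (hs.smul_const v).const_sub θ
  obtain ⟨N, hN⟩ := eventually_atTop.1 ((hp.eventually h1).and (hm.eventually h1))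
  refine ⟨N, fun n hn => ?_⟩
  obtain ⟨h2, h3⟩ := hN n hn
  obtain ⟨r, hr⟩ : ∃ r : ℝ, r = 1 / ((n:ℝ) + 1) := ⟨_, rfl⟩
  have hr0 : 0 < r := by rw [hr]; positivity
  rw [← hr] at h2 h3 ⊢
  have e1 : θ + r • v - θ = r • v := by abel
  have e2 : θ - r • v - θ = -(r • v) := by abel
  rw [e1] at h2
  rw [e2] at h3
  simp only [map_neg, inner_neg_left, norm_neg, inner_neg_right, map_smul, inner_smul_left, inner_smul_right, norm_smul,
    Real.norm_eq_abs, abs_of_pos hr0, RCLike.conj_to_real, abs_pow, abs_mul, abs_norm] at h2 h3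
  rw [abs_le] at h2 h3
  rw [Real.dist_eq, sd]
  have e3 : (w (θ + r • v) + w (θ - r • v) - 2 * w θ) / r ^ 2 - ⟪S v, v⟫
      = (w (θ + r • v) + w (θ - r • v) - 2 * w θ - r ^ 2 * ⟪S v, v⟫) / r ^ 2 := by field_simp
  rw [e3, abs_div, abs_of_pos (by positivity : 0 < r ^ 2), div_lt_iff₀ (by positivity)]
  have e4 : 2 * (c * (r * ‖v‖) ^ 2) < ε * r ^ 2 := by
    have : c * (4 * (‖v‖ ^ 2 + 1)) = ε := by rw [hc]; field_simp
    have h5 : 0 < c * r ^ 2 := by positivity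
    have h6 : 0 ≤ c * r ^ 2 * ‖v‖ ^ 2 := by positivity
    rw [← this]
    ring_nf
    linarith
  refine lt_of_le_of_lt ?_ e4
  rw [abs_le]
  constructor <;> linarith [h2.1, h2.2, h3.1, h3.2]

lemma D2_spec {w : Euc d → ℝ} {θ : Euc d} (h : ∃ p S, HasAlexandrovAt w p S θ) :
    ∃ p, HasAlexandrovAt w p (D2 w θ) θ := by
  obtain ⟨p, S, hS⟩ := h
  have h' : ∃ pS : Euc d × (Euc d →L[ℝ] Euc d), HasAlexandrovAt w pS.1 pS.2 θ := ⟨(p, S), hS⟩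
  refine ⟨h'.choose.1, ?_⟩
  rw [D2, dif_pos h']
  exact h'.choose_spec

lemma D2_lim {w : Euc d → ℝ} {θ : Euc d} (h : ∃ p S, HasAlexandrovAt w p S θ) (v : Euc d) :
    Tendsto (fun n : ℕ => sd w v (1 / ((n:ℝ) + 1)) θ) atTop (nhds ⟪D2 w θ v, v⟫) := by
  obtain ⟨p, hp⟩ := D2_spec h
  exact sd_lim hp v

def bb (d : ℕ) : Module.Basis (Fin d) ℝ (Euc d) := (EuclideanSpace.basisFun (Fin d) ℝ).toBasis

lemma cube_eq : fundCube d = ZSpan.fundamentalDomain (bb d) := by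
  ext x
  simp [fundCube, ZSpan.mem_fundamentalDomain, bb]

lemma cube_meas : MeasurableSet (fundCube d) := by
  rw [cube_eq]; exact ZSpan.fundamentalDomain_measurableSet _

lemma cube_fin : volume (fundCube d) ≠ ⊤ := by
  rw [cube_eq]; exact (ZSpan.fundamentalDomain_isBounded _).measure_lt_top.ne

instance cube_finm : IsFiniteMeasure (volume.restrict (fundCube d)) :=
  ⟨by rw [Measure.restrict_apply_univ]; exact cube_fin.lt_top⟩

lemma span_int (g : Submodule.span ℤ (range (bb d))) : ∃ k, (g : Euc d) = intVec k := by
  have h := (bb d).mem_span_iff_repr_mem ℤ (g : Euc d)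
  have h2 := h.1 g.2
  choose k hk using h2
  refine ⟨k, ?_⟩
  ext i
  have := hk i
  simp [bb] at this
  simp [intVec, this]

lemma cube_shift {w : Euc d → ℝ} (hp : PerFun w) (c : Euc d) :
    ∫ θ in fundCube d, w (θ + c) = ∫ θ in fundCube d, w θ := by
  have : VAddInvariantMeasure (Submodule.span ℤ (range (bb d))) (Euc d) volume :=
    ⟨fun g s _ => measure_preimage_add volume (g : Euc d) s⟩
  have : Countable (Submodule.span ℤ (range (bb d))) := inferInstance
  have hF : IsAddFundamentalDomain (Submodule.span ℤ (range (bb d))) (fundCube d) volume := by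
    rw [cube_eq]; exact ZSpan.isAddFundamentalDomain (bb d) volume
  have hF2 : IsAddFundamentalDomain (Submodule.span ℤ (range (bb d))) (c +ᵥ fundCube d) volume := by
    have : VAddCommClass (Euc d) (Submodule.span ℤ (range (bb d))) (Euc d) :=
      ⟨fun a b x => by
        change a + ((b : Euc d) + x) = (b : Euc d) + (a + x)
        abel⟩
    exact hF.vadd_of_comm c
  have h1 := hF.setIntegral_eq hF2 (f := w) (by
    intro g x
    obtain ⟨k, hk⟩ := span_int g
    change w ((g : Euc d) + x) = w x
    rw [hk, add_comm, hp k x])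
  rw [h1]
  have h2 := (measurePreserving_add_right (volume : Measure (Euc d)) c).setIntegral_image_emb
    (measurableEmbedding_addRight c) w (fundCube d)
  rw [← h2]
  congr 2
  ext x
  constructor
  · rintro ⟨y, hy, rfl⟩
    exact ⟨y, hy, by simp [add_comm]⟩
  · rintro ⟨y, hy, rfl⟩
    exact ⟨y, hy, by simp [add_comm]⟩

lemma cube_int {w : Euc d → ℝ} (hc : Continuous w) {C0 : ℝ} (hb : ∀ x, |w x| ≤ C0) :
    IntegrableOn w (fundCube d) volume :=
  Integrable.of_bound hc.aestronglyMeasurable C0 (Eventually.of_forall hb)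

lemma sd_cont {w : Euc d → ℝ} (hc : Continuous w) (v : Euc d) (h : ℝ) : Continuous (sd w v h) := by
  unfold sd; fun_prop

lemma sd_int0 {w : Euc d → ℝ} (hc : Continuous w) {C0 : ℝ} (hb : ∀ x, |w x| ≤ C0) (hp : PerFun w) (v : Euc d) (h : ℝ) :
    IntegrableOn (sd w v h) (fundCube d) volume ∧ ∫ θ in fundCube d, sd w v h θ = 0 := by
  have i1 : IntegrableOn (fun θ => w (θ + h • v)) (fundCube d) volume := cube_int (by fun_prop) (fun x => hb _)
  have i2 : IntegrableOn (fun θ => w (θ - h • v)) (fundCube d) volume := cube_int (by fun_prop) (fun x => hb _)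
  have i3 : IntegrableOn (fun θ => 2 * w θ) (fundCube d) volume := (cube_int hc hb).const_mul 2
  refine ⟨((i1.add i2).sub i3).div_const _, ?_⟩
  unfold sd
  rw [integral_div]
  have i4 : IntegrableOn (fun θ => w (θ + h • v) + w (θ - h • v)) (fundCube d) volume := i1.add i2
  rw [integral_sub i4 i3, integral_add i1 i2, integral_const_mul, cube_shift hp]
  simp only [sub_eq_add_neg]
  rw [cube_shift hp]
  ring_nf

lemma fatou {α : Type*} [MeasurableSpace α] {μ : Measure α} [IsFiniteMeasure μ] {f : ℕ → α → ℝ} {g : α → ℝ} {C : ℝ}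
    (hi : ∀ n, Integrable (f n) μ) (h0 : ∀ n, ∫ x, f n x ∂μ = 0) (hC : ∀ n x, f n x ≤ C)
    (hl : ∀ᵐ x ∂μ, Tendsto (fun n => f n x) atTop (nhds (g x))) : Integrable g μ ∧ 0 ≤ ∫ x, g x ∂μ ∧ ∀ᵐ x ∂μ, g x ≤ C := by
  have hgC : ∀ᵐ x ∂μ, g x ≤ C := by
    filter_upwards [hl] with x hx
    exact le_of_tendsto' hx (fun n => hC n x)
  have hm : AEStronglyMeasurable g μ := aestronglyMeasurable_of_tendsto_ae atTop (fun n => (hi n).1) hl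
  have hm2 : AEStronglyMeasurable (fun x => C - g x) μ := aestronglyMeasurable_const.sub hm
  have h1 : ∀ n, ∫⁻ x, ENNReal.ofReal (C - f n x) ∂μ = ENNReal.ofReal (∫ x, C ∂μ) := by
    intro n
    have hi2 : Integrable (fun x => C - f n x) μ := (integrable_const C).sub (hi n)
    rw [← ofReal_integral_eq_lintegral_ofReal hi2
      (Eventually.of_forall fun x => sub_nonneg.2 (hC n x)), integral_sub (integrable_const C) (hi n), h0 n, sub_zero]
  have h2 : ∫⁻ x, ENNReal.ofReal (C - g x) ∂μ ≤ ENNReal.ofReal (∫ x, C ∂μ) := by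
    calc ∫⁻ x, ENNReal.ofReal (C - g x) ∂μ = ∫⁻ x, liminf (fun n => ENNReal.ofReal (C - f n x)) atTop ∂μ := by
          refine lintegral_congr_ae ?_
          filter_upwards [hl] with x hx
          exact ((ENNReal.continuous_ofReal.tendsto _).comp (hx.const_sub C)).liminf_eq.symm
      _ ≤ liminf (fun n => ∫⁻ x, ENNReal.ofReal (C - f n x) ∂μ) atTop :=
          lintegral_liminf_le' (fun n => ((integrable_const C).sub (hi n)).1.aemeasurable.ennreal_ofReal)
      _ = _ := by simp [h1]
  have hnn : 0 ≤ᵐ[μ] fun x => C - g x := by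
    filter_upwards [hgC] with x hx
    exact sub_nonneg.2 hx
  have hI : Integrable (fun x => C - g x) μ :=
    ⟨hm2, (hasFiniteIntegral_iff_ofReal hnn).2 (h2.trans_lt ENNReal.ofReal_lt_top)⟩
  have hg : Integrable g μ := by
    have := (integrable_const C).sub hI
    refine this.congr (Eventually.of_forall fun x => ?_)
    simp
  refine ⟨hg, ?_, hgC⟩
  rw [← ofReal_integral_eq_lintegral_ofReal hI hnn, integral_sub (integrable_const C) hg] at h2
  rcases le_or_gt 0 (∫ x, C ∂μ) with hc | hc
  · have := (ENNReal.ofReal_le_ofReal_iff hc).1 h2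
    linarith
  · have h3 := integral_nonneg_of_ae hnn
    rw [ENNReal.ofReal_of_nonpos hc.le, nonpos_iff_eq_zero, ENNReal.ofReal_eq_zero] at h2
    rw [integral_sub (integrable_const C) hg] at h3
    have h4 : ∫ x, C - f 0 x ∂μ = ∫ x, C ∂μ := by
      rw [integral_sub (integrable_const C) (hi 0), h0 0, sub_zero]
    have h5 : 0 ≤ ∫ x, C - f 0 x ∂μ := integral_nonneg fun x => sub_nonneg.2 (hC 0 x)
    linarith

lemma l1conv {α : Type*} [MeasurableSpace α] {μ : Measure α} [IsFiniteMeasure μ] {f : ℕ → α → ℝ} {g : α → ℝ} {C : ℝ}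
    (hg : Integrable g μ) (hg0 : ∫ x, g x ∂μ = 0)
    (hf : ∀ᶠ n in atTop, Integrable (f n) μ ∧ 0 ≤ ∫ x, f n x ∂μ ∧ ∀ᵐ x ∂μ, f n x ≤ C)
    (hp : ∀ᵐ x ∂μ, ∀ ε > (0:ℝ), ∀ᶠ n in atTop, f n x ≤ g x + ε) :
    Tendsto (fun n => ∫ x, |f n x - g x| ∂μ) atTop (nhds 0) := by
  have h1 : Tendsto (fun n => ∫ x, max (f n x - g x) 0 ∂μ) atTop (nhds (∫ x, (0:ℝ) ∂μ)) := by
    refine tendsto_integral_filter_of_dominated_convergence (fun x => |C - g x|) ?_ ?_ ?_ ?_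
    · filter_upwards [hf] with n hn
      exact (hn.1.sub hg).pos_part.1
    · filter_upwards [hf] with n hn
      filter_upwards [hn.2.2] with x hx
      rw [Real.norm_eq_abs, abs_of_nonneg (le_max_right _ _)]
      exact max_le ((sub_le_sub_right hx _).trans (le_abs_self _)) (abs_nonneg _)
    · exact ((integrable_const C).sub hg).abs
    · filter_upwards [hp] with x hx
      rw [Metric.tendsto_nhds]
      intro ε hε
      filter_upwards [hx (ε / 2) (by positivity)] with n hn
      rw [Real.dist_eq, sub_zero, abs_of_nonneg (le_max_right _ _)]
      exact max_lt (by linarith) hε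
  rw [integral_zero] at h1
  have h2 := h1.const_mul 2
  rw [mul_zero] at h2
  refine squeeze_zero' (Eventually.of_forall fun n => integral_nonneg fun x => abs_nonneg _) ?_ h2
  filter_upwards [hf] with n hn
  have hs := hn.1.sub hg
  have e : ∀ x, |f n x - g x| = 2 * max (f n x - g x) 0 - (f n x - g x) := by
    intro x
    rcases le_total 0 (f n x - g x) with h | h
    · rw [max_eq_left h, abs_of_nonneg h]; ring
    · rw [max_eq_right h, abs_of_nonpos h]; ring
  simp_rw [e]
  have hs2 : Integrable (fun x => 2 * max (f n x - g x) 0) μ := hs.pos_part.const_mul 2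
  have hs3 : Integrable (fun x => f n x - g x) μ := hs
  rw [integral_sub hs2 hs3, integral_const_mul, integral_sub hn.1 hg, hg0]
  linarith [hn.2.1]
end K5

namespace K5
variable {d : ℕ}

abbrev ee (i : Fin d) : Euc d := EuclideanSpace.single i (1:ℝ)

lemma qNorm_nonneg (S : Euc d →L[ℝ] Euc d) : 0 ≤ qNorm S := Real.iSup_nonneg fun _ => abs_nonneg _

lemma quad_bound (A : Euc d →L[ℝ] Euc d) (v : Euc d) (hv : ‖v‖ = 1) : |⟪A v, v⟫| ≤
    ∑ i, ∑ j, (|⟪A (ee i + ee j), ee i + ee j⟫| + |⟪A (ee i), ee i⟫| + |⟪A (ee j), ee j⟫|) := by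
  have hv1 : ∀ i, |v i| ≤ 1 := fun i => by
    rw [← hv, ← Real.norm_eq_abs]; exact PiLp.norm_apply_le v i
  have hs : v = ∑ i, v i • ee i := by
    have := (EuclideanSpace.basisFun (Fin d) ℝ).sum_repr v
    simpa using this.symm
  have e1 : ⟪A v, v⟫ = ∑ i, ∑ j, v i * v j * ⟪A (ee i), ee j⟫ := by
    have hA : A v = ∑ i, v i • A (ee i) := by
      conv_lhs => rw [hs]
      rw [map_sum]
      simp only [map_smul]
    rw [hA, sum_inner]
    refine Finset.sum_congr rfl fun i _ => ?_
    have hi : ∀ z : Euc d, ⟪z, v⟫ = ∑ j, v j * ⟪z, ee j⟫ := fun z => by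
      conv_lhs => rw [hs]
      rw [inner_sum]
      simp only [real_inner_smul_right]
    rw [hi]
    refine Finset.sum_congr rfl fun j _ => ?_
    rw [real_inner_smul_left]
    ring
  have e2 : ⟪A v, v⟫ = ∑ i, ∑ j, v i * v j * ⟪A (ee j), ee i⟫ := by
    rw [e1, Finset.sum_comm]
    refine Finset.sum_congr rfl fun i _ => Finset.sum_congr rfl fun j _ => ?_
    ring
  have e3 : 2 * ⟪A v, v⟫ = ∑ i, ∑ j, v i * v j * (⟪A (ee i + ee j), ee i + ee j⟫ - ⟪A (ee i), ee i⟫ - ⟪A (ee j), ee j⟫) := by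
    rw [two_mul]
    nth_rw 1 [e1]
    rw [e2, ← Finset.sum_add_distrib]
    refine Finset.sum_congr rfl fun i _ => ?_
    rw [← Finset.sum_add_distrib]
    refine Finset.sum_congr rfl fun j _ => ?_
    rw [map_add, inner_add_left, inner_add_right, inner_add_right]
    ring
  have e4 : |2 * ⟪A v, v⟫| ≤ ∑ i, ∑ j, (|⟪A (ee i + ee j), ee i + ee j⟫| + |⟪A (ee i), ee i⟫| + |⟪A (ee j), ee j⟫|) := by
    rw [e3]
    refine (Finset.abs_sum_le_sum_abs _ _).trans (Finset.sum_le_sum fun i _ => ?_)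
    refine (Finset.abs_sum_le_sum_abs _ _).trans (Finset.sum_le_sum fun j _ => ?_)
    rw [abs_mul]
    have h1 : |v i * v j| ≤ 1 := by
      rw [abs_mul]; exact mul_le_one₀ (hv1 i) (abs_nonneg _) (hv1 j)
    have h2 := abs_sub (⟪A (ee i + ee j), ee i + ee j⟫ - ⟪A (ee i), ee i⟫) ⟪A (ee j), ee j⟫
    have h3 := abs_sub ⟪A (ee i + ee j), ee i + ee j⟫ ⟪A (ee i), ee i⟫
    exact (mul_le_of_le_one_left (abs_nonneg _) h1).trans (by linarith)
  rw [abs_mul, abs_two] at e4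
  linarith [abs_nonneg ⟪A v, v⟫]

lemma qNorm_le (A : Euc d →L[ℝ] Euc d) : qNorm A ≤
    ∑ i, ∑ j, (|⟪A (ee i + ee j), ee i + ee j⟫| + |⟪A (ee i), ee i⟫| + |⟪A (ee j), ee j⟫|) := by
  refine Real.iSup_le (fun v => quad_bound A v.1 ?_) ?_
  · simp
  · exact Finset.sum_nonneg fun i _ => Finset.sum_nonneg fun j _ => by positivity

structure Good (w : Euc d → ℝ) (K C0 : ℝ) : Prop where
  c : Continuous w
  per : PerFun w
  b : ∀ x, |w x| ≤ C0
  s : ∀ x, ∃ p, Sup w K x p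

lemma sd_le_of {w : Euc d → ℝ} {K C0 : ℝ} (hw : Good w K C0) (v : Euc d) {h : ℝ} (hh : 0 < h) (x : Euc d) :
    sd w v h x ≤ 2 * K * ‖v‖ ^ 2 := by
  obtain ⟨p, hp⟩ := hw.s x
  have h1 := hp (x + h • v)
  have h2 := hp (x - h • v)
  have e1 : x + h • v - x = h • v := by abel
  have e2 : x - h • v - x = -(h • v) := by abel
  rw [e1, norm_smul, Real.norm_eq_abs, abs_of_pos hh] at h1
  rw [e2, norm_neg, norm_smul, Real.norm_eq_abs, abs_of_pos hh, inner_neg_right] at h2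
  rw [sd, div_le_iff₀ (by positivity)]
  linarith

lemma npos (n : ℕ) : (0:ℝ) < 1 / ((n:ℝ) + 1) := by positivity

lemma good_D2 {w : Euc d → ℝ} {K C0 : ℝ} (hK : 0 ≤ K) (hw : Good w K C0) (v : Euc d) :
    IntegrableOn (fun θ => ⟪D2 w θ v, v⟫) (fundCube d) volume ∧ 0 ≤ ∫ θ in fundCube d, ⟪D2 w θ v, v⟫ ∧
      ∀ᵐ θ ∂(volume.restrict (fundCube d)), ⟪D2 w θ v, v⟫ ≤ 2 * K * ‖v‖ ^ 2 := by
  refine fatou (f := fun n : ℕ => sd w v (1 / ((n:ℝ) + 1))) (fun n => (sd_int0 hw.c hw.b hw.per v _).1)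
    (fun n => (sd_int0 hw.c hw.b hw.per v _).2) (fun n x => sd_le_of hw v (npos n) x) ?_
  refine ae_restrict_of_ae ?_
  filter_upwards [alexandrov hK hw.c hw.b hw.s] with θ hθ
  exact D2_lim hθ v

lemma reg_D2 {u : Euc d → ℝ} {K K' C0 : ℝ} (hK : 0 ≤ K) (hw : Good u K C0)
    (hlo : ∀ x, ∃ p, ∀ h, |u (x + h) - u x - ⟪p, h⟫| ≤ K' * ‖h‖ ^ 2) (v : Euc d) :
    ∫ θ in fundCube d, ⟪D2 u θ v, v⟫ = 0 := by
  have h1 : Tendsto (fun n : ℕ => ∫ θ in fundCube d, sd u v (1 / ((n:ℝ) + 1)) θ) atTop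
      (nhds (∫ θ in fundCube d, ⟪D2 u θ v, v⟫)) := by
    refine tendsto_integral_of_dominated_convergence (fun _ => 2 * K' * ‖v‖ ^ 2)
      (fun n => (sd_int0 hw.c hw.b hw.per v _).1.1) (integrable_const _) (fun n => Eventually.of_forall fun x => ?_) ?_
    · obtain ⟨h, hh⟩ : ∃ h : ℝ, h = 1 / ((n:ℝ) + 1) := ⟨_, rfl⟩
      have h0 : 0 < h := by rw [hh]; exact npos n
      rw [← hh]
      obtain ⟨p, hp⟩ := hlo x
      have h1 := hp (h • v)
      have h2 := hp (-(h • v))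
      rw [norm_smul, Real.norm_eq_abs, abs_of_pos h0, abs_le] at h1
      rw [norm_neg, norm_smul, Real.norm_eq_abs, abs_of_pos h0, inner_neg_right, ← sub_eq_add_neg, abs_le] at h2
      rw [sd, Real.norm_eq_abs, abs_div, abs_of_pos (by positivity : 0 < h ^ 2), div_le_iff₀ (by positivity), abs_le]
      constructor <;> linarith [h1.1, h1.2, h2.1, h2.2]
    · refine ae_restrict_of_ae ?_
      filter_upwards [alexandrov hK hw.c hw.b hw.s] with θ hθ
      exact D2_lim hθ v
  simp only [(sd_int0 hw.c hw.b hw.per v _).2] at h1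
  exact (tendsto_nhds_unique h1 tendsto_const_nhds)

theorem int_conv {u : Euc d → ℝ} {w : ℕ → Euc d → ℝ} {K K' C0 : ℝ} (hK : 0 ≤ K) (hu : Good u K C0)
    (hlo : ∀ x, ∃ p, ∀ h, |u (x + h) - u x - ⟪p, h⟫| ≤ K' * ‖h‖ ^ 2)
    (hw : ∀ᶠ n in atTop, Good (w n) K C0)
    (hpt : ∀ᵐ θ, ∀ v : Euc d, ∀ ε > (0:ℝ), ∃ δ > (0:ℝ), ∀ᶠ n in atTop, ∀ h, 0 < h → h ≤ δ →
      w n (θ + h • v) + w n (θ - h • v) - 2 * w n θ ≤ h ^ 2 * (⟪D2 u θ v, v⟫ + ε)) :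
    Tendsto (fun n => d21 (w n) u) atTop (nhds 0) := by
  have hv : ∀ v : Euc d, Tendsto (fun n => ∫ θ in fundCube d, |⟪D2 (w n) θ v, v⟫ - ⟪D2 u θ v, v⟫|) atTop (nhds 0) := by
    intro v
    refine l1conv (f := fun n θ => ⟪D2 (w n) θ v, v⟫) (good_D2 hK hu v).1 (reg_D2 hK hu hlo v)
      (hw.mono fun n hn => good_D2 hK hn v) ?_
    refine ae_restrict_of_ae ?_
    have hal : ∀ᵐ θ, ∀ n, Good (w n) K C0 → ∃ p S, HasAlexandrovAt (w n) p S θ := by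
      rw [ae_all_iff]
      intro n
      by_cases hg : Good (w n) K C0
      · filter_upwards [alexandrov hK hg.c hg.b hg.s] with θ hθ _ using hθ
      · exact Eventually.of_forall fun θ h => absurd h hg
    filter_upwards [hal, hpt] with θ h1 h2 ε hε
    obtain ⟨δ, hδ, h3⟩ := h2 v ε hε
    filter_upwards [h3, hw] with n h4 h5
    refine le_of_tendsto (D2_lim (h1 n h5) v) ?_
    have hs : Tendsto (fun n : ℕ => (1 / ((n:ℝ) + 1))) atTop (nhds 0) := tendsto_one_div_add_atTop_nhds_zero_nat
    filter_upwards [hs.eventually (eventually_le_nhds hδ)] with m hm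
    have h0 := npos m
    rw [sd, div_le_iff₀ (by positivity)]
    exact (h4 _ h0 hm).trans_eq (mul_comm _ _)
  have hsum : Tendsto (fun n => ∑ i, ∑ j, ((∫ θ in fundCube d, |⟪D2 (w n) θ (ee i + ee j), ee i + ee j⟫ - ⟪D2 u θ (ee i + ee j), ee i + ee j⟫|)
      + (∫ θ in fundCube d, |⟪D2 (w n) θ (ee i), ee i⟫ - ⟪D2 u θ (ee i), ee i⟫|)
      + (∫ θ in fundCube d, |⟪D2 (w n) θ (ee j), ee j⟫ - ⟪D2 u θ (ee j), ee j⟫|))) atTop (nhds 0) := by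
    have := tendsto_finsetSum (Finset.univ : Finset (Fin d)) fun i _ => tendsto_finsetSum (Finset.univ : Finset (Fin d)) fun j _ =>
      ((hv (ee i + ee j)).add (hv (ee i))).add (hv (ee j))
    simp only [add_zero, Finset.sum_const_zero] at this; exact this
  refine squeeze_zero' (Eventually.of_forall fun n => integral_nonneg fun θ => qNorm_nonneg _) ?_ hsum
  filter_upwards [hw] with n hn
  have hI : ∀ v : Euc d, IntegrableOn (fun θ => |⟪D2 (w n) θ v, v⟫ - ⟪D2 u θ v, v⟫|) (fundCube d) volume := fun v =>
    ((good_D2 hK hn v).1.sub (good_D2 hK hu v).1).abs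
  have hI3 : ∀ i j : Fin d, IntegrableOn (fun θ => |⟪D2 (w n) θ (ee i + ee j), ee i + ee j⟫ - ⟪D2 u θ (ee i + ee j), ee i + ee j⟫|
      + |⟪D2 (w n) θ (ee i), ee i⟫ - ⟪D2 u θ (ee i), ee i⟫| + |⟪D2 (w n) θ (ee j), ee j⟫ - ⟪D2 u θ (ee j), ee j⟫|) (fundCube d) volume :=
    fun i j => ((hI _).add (hI _)).add (hI _)
  have e : ∑ i, ∑ j, ((∫ θ in fundCube d, |⟪D2 (w n) θ (ee i + ee j), ee i + ee j⟫ - ⟪D2 u θ (ee i + ee j), ee i + ee j⟫|)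
      + (∫ θ in fundCube d, |⟪D2 (w n) θ (ee i), ee i⟫ - ⟪D2 u θ (ee i), ee i⟫|)
      + (∫ θ in fundCube d, |⟪D2 (w n) θ (ee j), ee j⟫ - ⟪D2 u θ (ee j), ee j⟫|)) =
      ∫ θ in fundCube d, ∑ i, ∑ j, (|⟪D2 (w n) θ (ee i + ee j), ee i + ee j⟫ - ⟪D2 u θ (ee i + ee j), ee i + ee j⟫|
      + |⟪D2 (w n) θ (ee i), ee i⟫ - ⟪D2 u θ (ee i), ee i⟫| + |⟪D2 (w n) θ (ee j), ee j⟫ - ⟪D2 u θ (ee j), ee j⟫|) := by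
    rw [integral_finsetSum _ fun i _ => integrable_finsetSum _ fun j _ => hI3 i j]
    refine Finset.sum_congr rfl fun i _ => ?_
    rw [integral_finsetSum _ fun j _ => hI3 i j]
    refine Finset.sum_congr rfl fun j _ => ?_
    have h2 : IntegrableOn (fun θ => |⟪D2 (w n) θ (ee i + ee j), ee i + ee j⟫ - ⟪D2 u θ (ee i + ee j), ee i + ee j⟫|
      + |⟪D2 (w n) θ (ee i), ee i⟫ - ⟪D2 u θ (ee i), ee i⟫|) (fundCube d) volume := (hI _).add (hI _)
    rw [integral_add h2 (hI _), integral_add (hI _) (hI _)]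
  rw [e]
  refine integral_mono_of_nonneg (Eventually.of_forall fun θ => qNorm_nonneg _)
    (integrable_finsetSum _ fun i _ => integrable_finsetSum _ fun j _ => hI3 i j) (Eventually.of_forall fun θ => ?_)
  have := qNorm_le (D2 (w n) θ - D2 u θ)
  simpa only [_root_.sub_apply, inner_sub_left] using this
end K5

namespace K5
variable {d : ℕ} {H : Phase d → ℝ}

lemma isHeight_heightOf {G : Submodule ℝ (Phase d)} (h : ∃ S, IsHeight G S) : IsHeight G (heightOf G) := by
  rw [heightOf, dif_pos h]
  exact h.choose_spec

theorem main_thm (hH : TonelliHam H) {φ : ℝ → Phase d → Phase d} (hφ : IsConformalFlow H 0 φ)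
    {ufam : ℝ → Euc d → ℝ} (hfam : ∀ lam ∈ Ioc (0:ℝ) 1, IsDiscountedSol H lam (ufam lam))
    {u : Euc d → ℝ} (hconv : TendstoUniformly ufam u (nhdsWithin 0 (Ioi 0)))
    (hu1 : ContDiff ℝ 1 u) (hreg : UpperGreenRegular φ u) :
    IsWeakKAM H u ∧
      Tendsto (fun lam => d21 (ufam lam) u) (nhdsWithin 0 (Ioi 0)) (nhds 0) := by
  obtain ⟨a, ha⟩ : ∃ a, a = maneCritical H := ⟨_, rfl⟩
  have hds : ∀ lam ∈ Ioc (0:ℝ) 1, DSol H a lam (ufam lam) := by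
    rw [ha]; exact fun lam hl => (hfam lam hl).2.2
  have hpos : ∀ δ > (0:ℝ), ∀ᶠ lam in nhdsWithin (0:ℝ) (Ioi 0), lam ∈ Ioc 0 δ := fun δ hδ => Ioc_mem_nhdsGT hδ
  have hcl : ∀ δ > (0:ℝ), ∀ᶠ lam in nhdsWithin (0:ℝ) (Ioi 0), ∀ x, |ufam lam x - u x| ≤ δ := by
    intro δ hδ
    filter_upwards [Metric.tendstoUniformly_iff.1 hconv δ hδ] with lam hl x
    rw [← Real.dist_eq, dist_comm]
    exact (hl x).le
  have hA : Appr H a u := by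
    intro δ hδ
    obtain ⟨lam, ⟨h1, h2⟩, h3⟩ := ((hpos δ hδ).and (hpos 1 one_pos)).and (hcl δ hδ) |>.exists
    exact ⟨lam, ufam lam, h1.1, h1.2, h2.2, hds lam h2, h3⟩
  have hper : PerFun u := by
    intro k x
    refine tendsto_nhds_unique ((hconv.tendsto_at (x + intVec k)).congr' ?_) (hconv.tendsto_at x)
    filter_upwards [hpos 1 one_pos] with lam hl
    exact (hfam lam hl).2.1 k x
  have hcu := hu1.continuous
  obtain ⟨B, hB, hbu⟩ := per_bound0 hcu hper
  simp only [Real.norm_eq_abs] at hbu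
  obtain ⟨C0, hC0⟩ : ∃ C0, C0 = B + 1 := ⟨_, rfl⟩
  have hC0p : 0 < C0 := by rw [hC0]; positivity
  refine ⟨weakKAM_of hH (ha ▸ hA) hbu hcu hper, ?_⟩
  obtain ⟨Cs, M, hCs, hM, hstep⟩ := step_of hH a C0 hC0p.le
  obtain ⟨Cd, hCd, hdom⟩ := dom_of hH a (M + 1)
  have hus : USol H a u := by
    refine ⟨hu1, hper, fun M' => ?_, ?_⟩
    · obtain ⟨C, hC, h⟩ := dom_limit hH a M'
      exact ⟨C, hC.le, h u B hA hbu⟩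
    · obtain ⟨C, M', hC, hM', h⟩ := step_limit hH a B hB.le
      exact ⟨M', hM', Step.stepE hC (h u hA hbu)⟩
  obtain ⟨Ks, R, hKs, hR, hscl⟩ := scl hH a M
  obtain ⟨Kr, hKr, hrg⟩ := hus.reg hH
  obtain ⟨K, hK⟩ : ∃ K, K = Kr + (Ks + R + 2 * C0) := ⟨_, rfl⟩
  have hK1 : Kr ≤ K := by
    have : 0 ≤ Ks + R + 2 * C0 := by positivity
    linarith
  have hK2 : Ks + R + 2 * C0 ≤ K := by linarith
  have hgu : Good u K C0 := by
    refine ⟨hcu, hper, fun x => (hbu x).trans (by linarith), fun x => ⟨gradient u x, fun y => ?_⟩⟩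
    have h1 := (abs_le.1 (hrg x (y - x))).2
    rw [add_sub_cancel] at h1
    have h2 := mul_le_mul_of_nonneg_right hK1 (sq_nonneg ‖y - x‖)
    linarith
  -- facts for small `lam`
  have hsm : ∀ᶠ lam in nhdsWithin (0:ℝ) (Ioi 0), Good (ufam lam) K C0 ∧ Dom H a lam Cd (M + 1) (ufam lam) ∧
      StepE H a lam M (ufam lam) := by
    filter_upwards [hpos 1 one_pos, hcl 1 one_pos] with lam hl hc
    have hb : ∀ x, |ufam lam x| ≤ C0 := by
      intro x
      have h1 := abs_sub_abs_le_abs_sub (ufam lam x) (u x)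
      linarith [hbu x, hc x]
    have hS := Step.stepE hCs (hstep lam _ hl.1 hl.2 (hds lam hl) hb)
    have hD := hdom lam _ hl.1 hl.2 (hds lam hl)
    refine ⟨⟨(hfam lam hl).1, (hfam lam hl).2.1, hb, fun x => ?_⟩, hD, hS⟩
    obtain ⟨p, hp, hq⟩ := hscl lam Cd _ hl.1.le hCd.le hS hD x
    refine ⟨p, fun y => ?_⟩
    have h1 := scl_global C0 Ks R hC0p.le hKs.le hR.le hb hp hq (y - x)
    rw [add_sub_cancel] at h1
    have h2 := mul_le_mul_of_nonneg_right hK2 (sq_nonneg ‖y - x‖)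
    linarith
  have hK0 : 0 ≤ K := hKr.le.trans hK1
  refine tendsto_of_seq_tendsto fun l hl => ?_
  refine int_conv (w := fun n => ufam (l n)) (K' := Kr) hK0 hgu (fun x => ⟨gradient u x, hrg x⟩)
    ((hl.eventually hsm).mono fun n hn => hn.1) ?_
  filter_upwards [hreg] with θ hθ v ε hε
  obtain ⟨p, S, hgp, hht, hlim, hal⟩ := hθ
  have hp : p = gradient u θ := hgp.gradient.symm
  subst hp
  have hSe : ⟪S v, v⟫ = ⟪D2 u θ v, v⟫ :=
    tendsto_nhds_unique (sd_lim hal v) (D2_lim ⟨_, S, hal⟩ v)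
  have hq : Tendsto (fun t : ℝ => ⟪heightOf (GreenT φ t (θ, gradient u θ)) v, v⟫) atTop (nhds ⟪S v, v⟫) := by
    have hc : Continuous fun A : Euc d →L[ℝ] Euc d => ⟪A v, v⟫ := by fun_prop
    exact (hc.tendsto S).comp hlim
  obtain ⟨t, ht1, ht0⟩ := ((hq.eventually (eventually_le_nhds (show ⟪S v, v⟫ < ⟪S v, v⟫ + ε / 2 by linarith))).and
    (eventually_gt_atTop 0)).exists
  obtain ⟨δ, hδ, hloc⟩ := local_upper hH hφ hus θ ht0 (isHeight_heightOf (hht t ht0)) v (half_pos hε) hM hCd hC0p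
  refine ⟨δ, hδ, ?_⟩
  filter_upwards [hl.eventually hsm, hl.eventually (hpos δ hδ), hl.eventually (hcl δ hδ)] with n h1 h2 h3 h h0 hhδ
  refine (hloc (l n) _ h h2.1.le h2.2 h1.2.1 h1.2.2 h3 h1.1.b h0 hhδ).trans ?_
  rw [← hSe]
  exact mul_le_mul_of_nonneg_left (by linarith) (sq_nonneg h)
end K5

/-- **Theorem (d_{2,1} convergence of the discounted solutions).** If the uniform limit
`u` of the discounted solutions `(u_λ)` is `C¹` and upper Green regular, then `u` is a
weak K.A.M. solution and `d_{2,1}(u_λ, u) → 0` as `λ → 0⁺`. -/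
theorem stmt_5 {d : ℕ} (H : Phase d → ℝ) (hH : TonelliHam H)
    (φ : ℝ → Phase d → Phase d) (hφ : IsConformalFlow H 0 φ)
    (ufam : ℝ → Euc d → ℝ)
    (hfam : ∀ lam ∈ Ioc (0:ℝ) 1, IsDiscountedSol H lam (ufam lam))
    (u : Euc d → ℝ)
    (hconv : TendstoUniformly ufam u (nhdsWithin 0 (Ioi 0)))
    (hu1 : ContDiff ℝ 1 u) (hreg : UpperGreenRegular φ u) :
    IsWeakKAM H u ∧
      Tendsto (fun lam => d21 (ufam lam) u) (nhdsWithin 0 (Ioi 0)) (nhds 0) := by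
  exact K5.main_thm hH hφ hfam hconv hu1 hreg
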